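/- arXiv:2412.02913 — 7 statements merged into one kernel-verified Lean document; each statement's English description precedes it below -/
import Mathlib

section
/- Let μ be a probability measure on ℝ with zero mean, absolutely continuous with density ρ supported on a bounded interval (a,b), and suppose inf_{x∈(a,b)} ρ(x) > 0. Let φ(θ) = q(|θ|/π) where q is the quantile function of μ, let aₙ = (1/π) ∫_{−π}^{π} φ(θ) cos(nθ) dθ, and let Φ(z) = Σ_{n=1}^∞ aₙ zⁿ. Then the power series Φ converges on the open unit disc 𝔻 and the image Φ(𝔻) is a bounded subset of ℂ. -/
open MeasureTheory Filter Set
open scoped Real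

/-- The cumulative distribution function of a measure `μ` on `ℝ`: `F(x) = μ((−∞, x])`. -/
noncomputable def cdfFn (μ : Measure ℝ) (x : ℝ) : ℝ := (μ (Iic x)).toReal

/-- The quantile function of `μ`: `q(u) = inf {x | F(x) ≥ u}`. -/
noncomputable def quantileFn (μ : Measure ℝ) (u : ℝ) : ℝ := sInf {x : ℝ | u ≤ cdfFn μ x}

/-- The Fourier cosine integrals of a Lipschitz function are absolutely summable. -/
theorem summable_abs_integral_mul_cos_of_lipschitzWith {K : NNReal} {g : ℝ → ℝ}
    (hg : LipschitzWith K g) :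
    Summable fun n : ℕ => |∫ θ in (-π)..π, g θ * Real.cos (((n + 1 : ℕ) : ℝ) * θ)| := by
  have hππ : -π < π := by linarith [Real.pi_pos]
  set d : ℝ → ℂ := fun θ => ((deriv g θ : ℝ) : ℂ) with hd
  have hdmeas : Measurable d := Complex.measurable_ofReal.comp (measurable_deriv g)
  have hdbound : ∀ θ, ‖d θ‖ ≤ K := fun θ => by
    simpa [hd] using norm_deriv_le_of_lipschitz (x₀ := θ) hg
  have hdL2 : MemLp d 2 (volume.restrict (Ioc (-π) π)) :=
    MemLp.of_bound hdmeas.aestronglyMeasurable K (ae_of_all _ hdbound)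
  have hsq := (hasSum_sq_fourierCoeffOn hππ hdL2).summable
  have hsq' : Summable fun n : ℕ => ‖fourierCoeffOn hππ d ((n + 1 : ℕ) : ℤ)‖ ^ 2 :=
    hsq.comp_injective (i := fun n : ℕ => ((n + 1 : ℕ) : ℤ)) fun m n h => by simpa using h
  have hinv : Summable fun n : ℕ => (1 : ℝ) / ((n + 1 : ℕ) : ℝ) ^ 2 :=
    (summable_nat_add_iff 1).2 (Real.summable_one_div_nat_pow.2 one_lt_two)
  refine Summable.of_nonneg_of_le (fun _ => abs_nonneg _) (fun n => ?_)
    ((hinv.add hsq').mul_left π)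
  set m : ℕ := n + 1 with hm
  have hm0 : (0 : ℝ) < m := by positivity
  have hparts : ∫ θ in (-π)..π, g θ * Real.cos (m * θ) =
      -((1 / m) * ∫ θ in (-π)..π, deriv g θ * Real.sin (m * θ)) := by
    set v : ℝ → ℝ := fun θ => Real.sin (m * θ) / m with hv
    have hvd : deriv v = fun θ => Real.cos (m * θ) := by
      funext θ
      have h := (((hasDerivAt_id θ).const_mul (m : ℝ)).sin).div_const (m : ℝ)
      have h' := h.deriv
      simp only [id, mul_one] at h'
      rw [hv, h']
      field_simp
    have hvc : ContDiff ℝ 1 v := by fun_prop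
    have hgac := (hg.lipschitzOnWith (s := uIcc (-π) π)).absolutelyContinuousOnInterval
    have h := hgac.integral_mul_deriv_eq_deriv_mul
      (hvc.contDiffOn (s := uIcc (-π) π)).absolutelyContinuousOnInterval
    rw [hvd] at h
    rw [h, ← intervalIntegral.integral_const_mul]
    have h1 : v π = 0 := by simp [hv, Real.sin_nat_mul_pi]
    have h2 : v (-π) = 0 := by simp [hv, Real.sin_nat_mul_pi]
    rw [h1, h2, mul_zero, mul_zero, sub_zero, zero_sub]
    congr 2
    funext θ
    simp only [hv]
    ring
  have hcoeff : |∫ θ in (-π)..π, deriv g θ * Real.sin (m * θ)| ≤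
      2 * π * ‖fourierCoeffOn hππ d (m : ℤ)‖ := by
    rw [fourierCoeffOn_eq_integral]
    have hint : IntervalIntegrable
        (fun x : ℝ => fourier (-(m : ℤ)) (x : AddCircle (π - -π)) • d x) volume (-π) π := by
      rw [intervalIntegrable_iff_integrableOn_Ioc_of_le hππ.le]
      refine Integrable.bdd_mul (c := 1) (hdL2.integrable (by norm_num)) ?_ ?_
      · exact ((map_continuous (fourier (-(m : ℤ)))).comp
          (AddCircle.continuous_mk' _)).aestronglyMeasurable
      · exact ae_of_all _ fun x => (Circle.norm_coe _).le
    have him : ∫ θ in (-π)..π, deriv g θ * Real.sin (m * θ) =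
        -(∫ x in (-π)..π, fourier (-(m : ℤ)) (x : AddCircle (π - -π)) • d x).im := by
      have := Complex.imCLM.intervalIntegral_comp_comm hint
      simp only [Complex.imCLM_apply] at this
      rw [← this, ← intervalIntegral.integral_neg]
      refine intervalIntegral.integral_congr fun θ _ => ?_
      have hexp : fourier (-(m : ℤ)) (θ : AddCircle (π - -π)) =
          Complex.exp (((-(m * θ) : ℝ) : ℂ) * Complex.I) := by
        rw [fourier_coe_apply]
        congr 1
        have : (π : ℂ) ≠ 0 := by exact_mod_cast Real.pi_ne_zero
        push_cast
        field_simp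
        ring
      simp only [hexp, hd, smul_eq_mul, Complex.mul_im, Complex.ofReal_re, Complex.ofReal_im,
        Complex.exp_ofReal_mul_I_im, Real.sin_neg]
      ring
    rw [him, abs_neg, norm_smul, Real.norm_of_nonneg (by
      have := Real.pi_pos
      rw [sub_neg_eq_add]
      positivity)]
    refine (Complex.abs_im_le_norm _).trans_eq ?_
    have := Real.pi_ne_zero
    field_simp
    ring
  rw [hparts, abs_neg, abs_mul, abs_of_pos (by positivity : (0 : ℝ) < 1 / m)]
  set c := ‖fourierCoeffOn hππ d (m : ℤ)‖
  calc 1 / (m : ℝ) * |∫ θ in (-π)..π, deriv g θ * Real.sin (m * θ)|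
      ≤ 1 / (m : ℝ) * (2 * π * c) := by gcongr
    _ = π * (2 * (1 / m) * c) := by ring
    _ ≤ π * ((1 / (m : ℝ)) ^ 2 + c ^ 2) := by
        gcongr
        exact two_mul_le_add_sq _ _
    _ = π * (1 / (m : ℝ) ^ 2 + c ^ 2) := by rw [one_div_pow]

/-- If the distribution function grows at rate at least `c > 0` on `[a, b]` and `μ` is carried by
`(a, b]`, then the quantile function is Lipschitz on `(0, 1]`. -/
theorem lipschitzOnWith_quantileFn {μ : Measure ℝ} {a b c : ℝ} (hc : 0 < c)
    (ha : ∀ x ≤ a, cdfFn μ x = 0) (hb : cdfFn μ b = 1)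
    (hgrow : ∀ x y, a ≤ x → x ≤ y → y ≤ b → c * (y - x) ≤ cdfFn μ y - cdfFn μ x) :
    LipschitzOnWith (Real.toNNReal c⁻¹) (quantileFn μ) (Ioc 0 1) := by
  have hlt : ∀ u, 0 < u → ∀ x, u ≤ cdfFn μ x → a < x := fun u hu x hx => by
    by_contra! h
    rw [ha x h] at hx
    linarith
  have hbdd : ∀ u, 0 < u → BddBelow {x | u ≤ cdfFn μ x} := fun u hu =>
    ⟨a, fun x hx => (hlt u hu x hx).le⟩
  refine LipschitzOnWith.of_le_add_mul _ fun v hv u hu => ?_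
  rw [Real.coe_toNNReal _ (inv_pos.2 hc).le, Real.dist_eq, ← sub_le_iff_le_add]
  refine le_csInf ⟨b, by simpa [hb] using hu.2⟩ fun x hx => ?_
  rw [sub_le_iff_le_add]
  have hax := hlt u hu.1 x hx
  have hδ : 0 ≤ c⁻¹ * |v - u| := by positivity
  rcases le_or_gt (x + c⁻¹ * |v - u|) b with hle | hgt
  · refine csInf_le (hbdd v hv.1) ?_
    have h := hgrow x _ hax.le (by linarith) hle
    have hx' : u ≤ cdfFn μ x := hx
    have h2 : c * (x + c⁻¹ * |v - u| - x) = |v - u| := by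
      field_simp
      ring
    have := le_abs_self (v - u)
    change v ≤ cdfFn μ _
    linarith
  · exact (csInf_le (hbdd v hv.1) (by simpa [hb] using hv.2)).trans hgt.le

/-- The quantile function of a probability measure whose density is supported on `(a, b)` and
bounded below there by `c > 0` is Lipschitz on `(0, 1]`. -/
theorem lipschitzOnWith_quantileFn_of_density {μ : Measure ℝ} [IsProbabilityMeasure μ]
    {ρ : ℝ → ℝ} {a b c : ℝ} (hc : 0 < c)
    (hdens : μ = volume.withDensity (fun x => ENNReal.ofReal (ρ x)))
    (hsupp : ∀ x, x ∉ Ioo a b → ρ x = 0) (hρ : ∀ x ∈ Ioo a b, c ≤ ρ x) :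
    LipschitzOnWith (Real.toNNReal c⁻¹) (quantileFn μ) (Ioc 0 1) := by
  have hnull : ∀ s, MeasurableSet s → (∀ x ∈ s, x ∉ Ioo a b) → μ s = 0 := fun s hs h => by
    rw [hdens, withDensity_apply _ hs]
    exact setLIntegral_eq_zero hs fun x hx => by simp [hsupp x (h x hx)]
  refine lipschitzOnWith_quantileFn (a := a) (b := b) hc (fun x hx => ?_) ?_
    fun x y hax hxy hyb => ?_
  · rw [cdfFn, hnull _ measurableSet_Iic fun t ht h => absurd (h.1.trans_le ht) hx.not_gt]
    rfl
  · have h : μ (Iic b)ᶜ = 0 := hnull _ measurableSet_Iic.compl fun t ht h => ht h.2.le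
    rw [cdfFn, (prob_compl_eq_zero_iff measurableSet_Iic).1 h]
    rfl
  · have hunion : μ (Iic y) = μ (Iic x) + μ (Ioc x y) := by
      rw [← measure_union (Iic_disjoint_Ioc le_rfl) measurableSet_Ioc, Iic_union_Ioc_eq_Iic hxy]
    have hle : ENNReal.ofReal (c * (y - x)) ≤ μ (Ioc x y) := by
      calc ENNReal.ofReal (c * (y - x))
          = ∫⁻ _ in Ioo x y, ENNReal.ofReal c := by
            rw [setLIntegral_const, Real.volume_Ioo, ENNReal.ofReal_mul hc.le]
        _ ≤ ∫⁻ t in Ioo x y, ENNReal.ofReal (ρ t) :=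
            setLIntegral_mono' measurableSet_Ioo fun t ht => ENNReal.ofReal_le_ofReal
              (hρ t ⟨hax.trans_lt ht.1, ht.2.trans_le hyb⟩)
        _ = μ (Ioo x y) := by rw [hdens, withDensity_apply _ measurableSet_Ioo]
        _ ≤ μ (Ioc x y) := measure_mono Ioo_subset_Ioc_self
    rw [cdfFn, cdfFn, hunion, ENNReal.toReal_add (measure_ne_top _ _) (measure_ne_top _ _),
      add_sub_cancel_left]
    exact (ENNReal.ofReal_le_iff_le_toReal (measure_ne_top _ _)).1 hle

/-- If `μ` is a zero-mean probability measure with density `ρ` supported on a bounded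
interval `(a,b)` with `inf_{(a,b)} ρ > 0`, then Gross' map `Φ(z) = Σ_{n≥1} aₙ zⁿ`
(where `aₙ` are the Fourier cosine coefficients of `φ(θ) = q(|θ|/π)`) converges on
the open unit disc and its image `Φ(𝔻)` is bounded. -/
theorem gross_domain_bounded_of_density_bounded_below
    (μ : Measure ℝ) [IsProbabilityMeasure μ] (ρ : ℝ → ℝ) (a b : ℝ) (hab : a < b)
    (hdens : μ = volume.withDensity (fun x => ENNReal.ofReal (ρ x)))
    (hsupp : ∀ x, x ∉ Ioo a b → ρ x = 0)
    (hinf : 0 < ⨅ x : Ioo a b, ρ (x : ℝ))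
    (hmean : ∫ x, x ∂μ = 0)
    (φ : ℝ → ℝ) (hφ : ∀ θ, φ θ = quantileFn μ (|θ| / π))
    (aa : ℕ → ℝ)
    (ha : ∀ n : ℕ, aa n = (1 / π) * ∫ θ in (-π)..π, φ θ * Real.cos (n * θ)) :
    (∀ z ∈ Metric.ball (0 : ℂ) 1,
        Summable fun n : ℕ => (aa (n + 1) : ℂ) * z ^ (n + 1)) ∧
    ∃ C : ℝ, ∀ z ∈ Metric.ball (0 : ℂ) 1,
        ‖∑' n : ℕ, (aa (n + 1) : ℂ) * z ^ (n + 1)‖ ≤ C := by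
  obtain ⟨c, hc, hρ⟩ : ∃ c, 0 < c ∧ ∀ x ∈ Ioo a b, c ≤ ρ x := by
    refine ⟨_, hinf, fun x hx => ciInf_le (f := fun x : Ioo a b => ρ x) ?_ ⟨x, hx⟩⟩
    by_contra h
    rw [Real.iInf_of_not_bddBelow h] at hinf
    exact lt_irrefl _ hinf
  obtain ⟨G, hG, hGeq⟩ :=
    (lipschitzOnWith_quantileFn_of_density hc hdens hsupp hρ).extend_real
  have habs : LipschitzWith (Real.toNNReal π⁻¹) fun θ : ℝ => |θ| / π :=
    LipschitzWith.of_le_add_mul _ fun x y => by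
      rw [Real.coe_toNNReal _ (inv_pos.2 Real.pi_pos).le, Real.dist_eq, div_eq_inv_mul,
        div_eq_inv_mul, ← mul_add]
      have := abs_sub_abs_le_abs_sub x y
      gcongr
      linarith
  have hsum := summable_abs_integral_mul_cos_of_lipschitzWith (hG.comp habs)
  have haa : ∀ n : ℕ, aa n =
      (1 / π) * ∫ θ in (-π)..π, (G ∘ fun θ : ℝ => |θ| / π) θ * Real.cos (n * θ) := fun n => by
    rw [ha]
    congr 1
    refine intervalIntegral.integral_congr_ae ?_
    filter_upwards [Measure.ae_ne volume (0 : ℝ)] with θ hθ0 hθ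
    rw [uIoc_of_le (by linarith [Real.pi_pos])] at hθ
    rw [hφ, Function.comp, hGeq]
    exact ⟨div_pos (abs_pos.2 hθ0) Real.pi_pos,
      (div_le_one Real.pi_pos).2 (abs_le.2 ⟨hθ.1.le, hθ.2⟩)⟩
  have hsumaa : Summable fun n : ℕ => |aa (n + 1)| := by
    refine (hsum.mul_left |1 / π|).congr fun n => ?_
    rw [haa, abs_mul]
  have hle : ∀ z ∈ Metric.ball (0 : ℂ) 1, ∀ n : ℕ,
      ‖(aa (n + 1) : ℂ) * z ^ (n + 1)‖ ≤ |aa (n + 1)| := fun z hz n => by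
    rw [norm_mul, norm_pow, Complex.norm_real, Real.norm_eq_abs]
    exact mul_le_of_le_one_right (abs_nonneg _)
      (pow_le_one₀ (norm_nonneg _) (mem_ball_zero_iff.1 hz).le)
  exact ⟨fun z hz => Summable.of_norm_bounded hsumaa (hle z hz), ∑' n : ℕ, |aa (n + 1)|,
    fun z hz => tsum_of_norm_bounded hsumaa.hasSum (hle z hz)⟩
end

section
/- Let φ : ℝ → ℝ be a 2π-periodic function which is differentiable with bounded derivative. Then for every θ ∈ ℝ the principal-value limit defining the periodic Hilbert transform H{φ}(θ) exists and is finite, and H{φ}(θ) = (1/π) ∫_0^π (φ'(θ+t) + φ'(θ−t)) ln(sin(t/2)) dt. -/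
open Filter Set
open scoped Real

/-- The truncated integral whose limit as `η → 0⁺` defines the periodic Hilbert
transform of `f` at `x`: `(1/(2π)) ∫_{η ≤ |t| ≤ π} f(x−t) cot(t/2) dt`. -/
noncomputable def pvH (f : ℝ → ℝ) (x η : ℝ) : ℝ :=
  (1 / (2 * π)) *
    ∫ t in {t : ℝ | η ≤ |t| ∧ |t| ≤ π}, f (x - t) * (Real.cos (t / 2) / Real.sin (t / 2))

open MeasureTheory

theorem sin_half_pos {t : ℝ} (h0 : 0 < t) (hπ : t ≤ π) : 0 < Real.sin (t / 2) :=
  Real.sin_pos_of_pos_of_lt_pi (by linarith) (by linarith [Real.pi_pos])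

theorem intervalIntegrable_log_sin_half :
    IntervalIntegrable (fun t => Real.log (Real.sin (t / 2))) volume 0 π := by
  have h := (intervalIntegrable_log_sin (a := 0) (b := π / 2)).comp_mul_left (c := 1 / 2)
  simp only [Function.comp_apply] at h
  convert h using 1
  · ext t
    congr 2
    ring
  · simp
  · ring

theorem continuousOn_cot_half {s : Set ℝ} (hs : ∀ t ∈ s, Real.sin (t / 2) ≠ 0) :
    ContinuousOn (fun t => Real.cos (t / 2) / Real.sin (t / 2)) s :=
  ContinuousOn.div (by fun_prop) (by fun_prop) hs

/-- The truncated integral folded onto `[η, π]`, using that the cotangent is odd. -/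
theorem pvH_eq_intervalIntegral {f : ℝ → ℝ} (hf : Continuous f) (x : ℝ) {η : ℝ}
    (h0 : 0 < η) (hπ : η ≤ π) :
    pvH f x η = (1 / (2 * π)) *
      ∫ t in η..π, (f (x - t) - f (x + t)) * (Real.cos (t / 2) / Real.sin (t / 2)) := by
  set F : ℝ → ℝ := fun t => f (x - t) * (Real.cos (t / 2) / Real.sin (t / 2)) with hF
  have hset : {t : ℝ | η ≤ |t| ∧ |t| ≤ π} = Icc (-π) (-η) ∪ Icc η π := by
    ext t
    simp only [mem_ofPred_eq, mem_union, mem_Icc]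
    rcases abs_cases t with ⟨h, h'⟩ | ⟨h, h'⟩ <;> rw [h] <;> grind
  have hpos : ContinuousOn F (Icc η π) :=
    ContinuousOn.mul (by fun_prop) (continuousOn_cot_half fun t ht =>
      (sin_half_pos (h0.trans_le ht.1) ht.2).ne')
  have hneg : ContinuousOn F (Icc (-π) (-η)) := by
    refine ContinuousOn.mul (by fun_prop) (continuousOn_cot_half fun t ht => ?_)
    have := sin_half_pos (t := -t) (by linarith [ht.2]) (by linarith [ht.1])
    rw [neg_div, Real.sin_neg] at this
    linarith
  have hdisj : Disjoint (Icc (-π) (-η)) (Icc η π) :=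
    Set.disjoint_left.2 fun t ht ht' => by linarith [ht.2, ht'.1]
  have hposI : IntervalIntegrable F volume η π := hpos.intervalIntegrable_of_Icc hπ
  have hnegI : IntervalIntegrable (fun t => F (-t)) volume η π :=
    (hneg.comp continuousOn_neg fun t ht =>
      ⟨by linarith [ht.2], by linarith [ht.1]⟩).intervalIntegrable_of_Icc hπ
  rw [pvH, hset, setIntegral_union hdisj measurableSet_Icc hneg.integrableOn_Icc
    hpos.integrableOn_Icc, integral_Icc_eq_integral_Ioc, integral_Icc_eq_integral_Ioc,
    ← intervalIntegral.integral_of_le (by linarith), ← intervalIntegral.integral_of_le hπ,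
    ← intervalIntegral.integral_comp_neg, ← intervalIntegral.integral_add hnegI hposI]
  congr 1
  refine intervalIntegral.integral_congr fun t _ => ?_
  simp only [hF, sub_neg_eq_add, neg_div, Real.cos_neg, Real.sin_neg, div_neg]
  ring

theorem hasDerivAt_two_mul_log_sin_half {t : ℝ} (ht : Real.sin (t / 2) ≠ 0) :
    HasDerivAt (fun t => 2 * Real.log (Real.sin (t / 2)))
      (Real.cos (t / 2) / Real.sin (t / 2)) t := by
  convert! ((((hasDerivAt_id t).div_const 2).sin).log ht).const_mul 2 using 1
  simp only [id]
  ring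

theorem intervalIntegrable_of_bounded {g : ℝ → ℝ} (hg : Measurable g) {K : ℝ}
    (hK : ∀ t, |g t| ≤ K) (a b : ℝ) : IntervalIntegrable g volume a b :=
  (intervalIntegrable_const (c := K)).mono_fun hg.aestronglyMeasurable
    (Eventually.of_forall fun t => (hK t).trans (le_abs_self K))

/-- Integration by parts for the odd part of `φ` against the cotangent, away from `0`. -/
theorem integral_odd_part_mul_cot_half {φ : ℝ → ℝ} (hdiff : Differentiable ℝ φ) {C : ℝ}
    (hC : ∀ x, |deriv φ x| ≤ C) (θ : ℝ) {η : ℝ} (h0 : 0 < η) (hπ : η ≤ π) :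
    ∫ t in η..π, (φ (θ - t) - φ (θ + t)) * (Real.cos (t / 2) / Real.sin (t / 2)) =
      2 * (∫ t in η..π, (deriv φ (θ + t) + deriv φ (θ - t)) * Real.log (Real.sin (t / 2)))
        - 2 * ((φ (θ - η) - φ (θ + η)) * Real.log (Real.sin (η / 2))) := by
  have hsin : ∀ t ∈ uIcc η π, Real.sin (t / 2) ≠ 0 := fun t ht => by
    rw [uIcc_of_le hπ] at ht
    exact (sin_half_pos (h0.trans_le ht.1) ht.2).ne'
  have hu (t : ℝ) : HasDerivAt (fun t => φ (θ - t) - φ (θ + t))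
      (-(deriv φ (θ + t) + deriv φ (θ - t))) t := by
    convert! ((hdiff (θ - t)).hasDerivAt.comp_const_sub θ t).sub
      ((hdiff (θ + t)).hasDerivAt.comp_const_add θ t) using 1
    ring
  have hmeas : Measurable fun t => -(deriv φ (θ + t) + deriv φ (θ - t)) := by
    have := measurable_deriv φ
    fun_prop
  have hbound (t : ℝ) : |-(deriv φ (θ + t) + deriv φ (θ - t))| ≤ C + C := by
    rw [abs_neg]
    exact (abs_add_le _ _).trans (add_le_add (hC _) (hC _))
  rw [intervalIntegral.integral_mul_deriv_eq_deriv_mul (fun t _ => hu t)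
    (fun t ht => hasDerivAt_two_mul_log_sin_half (hsin t ht))
    (intervalIntegrable_of_bounded hmeas hbound η π)
    (continuousOn_cot_half hsin).intervalIntegrable]
  have hint : ∫ t in η..π, -(deriv φ (θ + t) + deriv φ (θ - t)) *
        (2 * Real.log (Real.sin (t / 2))) =
      -2 * ∫ t in η..π, (deriv φ (θ + t) + deriv φ (θ - t)) * Real.log (Real.sin (t / 2)) := by
    rw [← intervalIntegral.integral_const_mul]
    congr 1
    ext t
    ring
  rw [hint, Real.sin_pi_div_two, Real.log_one]
  ring

theorem tendsto_odd_part_mul_log_sin_half {φ : ℝ → ℝ} (hdiff : Differentiable ℝ φ) {C : ℝ}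
    (hC : ∀ x, |deriv φ x| ≤ C) (θ : ℝ) :
    Tendsto (fun η => (φ (θ - η) - φ (θ + η)) * Real.log (Real.sin (η / 2)))
      (nhdsWithin 0 (Ioi 0)) (nhds 0) := by
  have hlim : Tendsto (fun η : ℝ => 2 * C * π *
      |Real.sin (η / 2) * Real.log (Real.sin (η / 2))|) (nhdsWithin 0 (Ioi 0)) (nhds 0) := by
    have hcont : Continuous fun η : ℝ => 2 * C * π *
        |Real.sin (η / 2) * Real.log (Real.sin (η / 2))| :=
      continuous_const.mul (Real.continuous_mul_log.comp (by fun_prop : Continuous fun η : ℝ =>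
        Real.sin (η / 2))).abs
    simpa using (hcont.tendsto 0).mono_left nhdsWithin_le_nhds
  refine squeeze_zero_norm' ?_ hlim
  filter_upwards [Ioc_mem_nhdsGT Real.pi_pos] with η hη
  have hC0 : 0 ≤ C := (abs_nonneg _).trans (hC 0)
  have hlip : |φ (θ - η) - φ (θ + η)| ≤ C * (2 * η) := by
    have h := convex_univ.norm_image_sub_le_of_norm_deriv_le (f := φ) (C := C)
      (fun x _ => hdiff x) (fun x _ => hC x) (mem_univ (θ + η)) (mem_univ (θ - η))
    have habs : ‖θ - η - (θ + η)‖ = 2 * η := by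
      rw [Real.norm_eq_abs, abs_of_nonpos (by linarith [hη.1])]
      ring
    rwa [habs] at h
  have hsin : η ≤ π * Real.sin (η / 2) := by
    have h := Real.mul_le_sin (x := η / 2) (by linarith [hη.1]) (by linarith [hη.2])
    calc η = π * (2 / π * (η / 2)) := by field_simp
      _ ≤ _ := mul_le_mul_of_nonneg_left h Real.pi_pos.le
  rw [norm_mul, Real.norm_eq_abs, Real.norm_eq_abs, abs_mul,
    abs_of_pos (sin_half_pos hη.1 hη.2), ← mul_assoc]
  refine mul_le_mul_of_nonneg_right (hlip.trans ?_) (abs_nonneg _)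
  nlinarith [mul_le_mul_of_nonneg_left hsin hC0]

/-- For a `2π`-periodic differentiable function `φ` with bounded derivative, the
principal-value limit defining the periodic Hilbert transform exists at every point
and equals `(1/π) ∫_0^π (φ'(θ+t) + φ'(θ−t)) ln(sin(t/2)) dt`. -/
theorem hilbert_transform_exists_of_bounded_derivative
    (φ : ℝ → ℝ) (hper : Function.Periodic φ (2 * π))
    (hdiff : Differentiable ℝ φ) (C : ℝ) (hC : ∀ x, |deriv φ x| ≤ C) :
    ∀ θ : ℝ,
      Tendsto (fun η => pvH φ θ η) (nhdsWithin 0 (Ioi 0))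
        (nhds ((1 / π) *
          ∫ t in (0:ℝ)..π, (deriv φ (θ + t) + deriv φ (θ - t)) * Real.log (Real.sin (t / 2)))) := by
  intro θ
  set G : ℝ → ℝ := fun t =>
    (deriv φ (θ + t) + deriv φ (θ - t)) * Real.log (Real.sin (t / 2))
  have hmeas : Measurable fun t => deriv φ (θ + t) + deriv φ (θ - t) := by
    have := measurable_deriv φ
    fun_prop
  have hint : IntervalIntegrable G volume 0 π :=
    (intervalIntegrable_iff.1 intervalIntegrable_log_sin_half).bdd_mul (c := C + C)
      hmeas.aestronglyMeasurable (Eventually.of_forall fun t =>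
        (abs_add_le _ _).trans (add_le_add (hC _) (hC _))) |> intervalIntegrable_iff.2
  have hprim : Tendsto (fun η => ∫ t in η..π, G t) (nhdsWithin 0 (Ioi 0))
      (nhds (∫ t in (0 : ℝ)..π, G t)) := by
    have hcont : ContinuousOn (fun η => ∫ t in η..π, G t) (uIcc 0 π) :=
      intervalIntegral.continuousOn_primitive_interval_left
        ((intervalIntegrable_iff' (by finiteness)).1 hint)
    rw [uIcc_of_le Real.pi_pos.le] at hcont
    refine (hcont 0 ⟨le_rfl, Real.pi_pos.le⟩).mono_left ?_
    rw [← nhdsWithin_Ioc_eq_nhdsGT Real.pi_pos]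
    exact nhdsWithin_mono _ Ioc_subset_Icc_self
  have hlim := (((hprim.const_mul 2).sub
    ((tendsto_odd_part_mul_log_sin_half hdiff hC θ).const_mul 2)).const_mul (1 / (2 * π)))
  have hval : 1 / (2 * π) * (2 * (∫ t in (0 : ℝ)..π, G t) - 2 * 0) =
      1 / π * ∫ t in (0 : ℝ)..π, G t := by
    field_simp
    ring
  rw [hval] at hlim
  refine hlim.congr' ?_
  filter_upwards [Ioc_mem_nhdsGT Real.pi_pos] with η hη
  rw [pvH_eq_intervalIntegral hdiff.continuous θ hη.1 hη.2,
    integral_odd_part_mul_cot_half hdiff hC θ hη.1 hη.2]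
end

section
/- Let μ be a non-degenerate probability measure on ℝ with zero mean and finite second moment, with quantile function q, and let φ(θ) = q(|θ|/π) for θ ∈ (−π,π). Let aₙ = (1/π) ∫_{−π}^{π} φ(θ) cos(nθ) dθ be the Fourier cosine coefficients of φ, and define Φ(z) = Σ_{n=1}^∞ aₙ zⁿ. Then this power series converges for every z in the open unit disc 𝔻 = {z ∈ ℂ : |z| < 1}, and Φ is injective on 𝔻. -/
open MeasureTheory Filter Set
open scoped Real

open ProbabilityTheory in
theorem cdfFn_eq_cdf (μ : Measure ℝ) [IsProbabilityMeasure μ] : cdfFn μ = cdf μ := by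
  funext x
  rw [cdf_eq_real]
  rfl

section CDF

open scoped Topology

variable (μ : Measure ℝ)

theorem cdfFn_nonneg (x : ℝ) : 0 ≤ cdfFn μ x := ENNReal.toReal_nonneg

variable [IsProbabilityMeasure μ]

theorem monotone_cdfFn : Monotone (cdfFn μ) :=
  cdfFn_eq_cdf μ ▸ ProbabilityTheory.monotone_cdf μ

theorem cdfFn_le_one (x : ℝ) : cdfFn μ x ≤ 1 :=
  cdfFn_eq_cdf μ ▸ ProbabilityTheory.cdf_le_one μ x

theorem cdfFn_lt_of_lt_quantileFn {u x : ℝ} (hu : 0 < u) (hx : x < quantileFn μ u) :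
    cdfFn μ x < u := by
  have h := (cdfFn_eq_cdf μ ▸ ProbabilityTheory.tendsto_cdf_atBot μ).eventually_lt_const hu
  obtain ⟨b, hb⟩ := h.exists
  by_contra! hc
  have hbdd : BddBelow {x : ℝ | u ≤ cdfFn μ x} := by
    refine ⟨b, fun y hy => ?_⟩
    by_contra! hyb
    exact absurd (hy.trans (monotone_cdfFn μ hyb.le)) hb.not_ge
  exact hx.not_ge (csInf_le hbdd hc)

theorem le_cdfFn_of_quantileFn_lt {u x : ℝ} (hu : u < 1) (hx : quantileFn μ u < x) :
    u ≤ cdfFn μ x := by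
  have h := (cdfFn_eq_cdf μ ▸ ProbabilityTheory.tendsto_cdf_atTop μ).eventually_const_lt hu
  obtain ⟨b, hb⟩ := h.exists
  obtain ⟨y, hy, hyx⟩ := exists_lt_of_csInf_lt (s := {x : ℝ | u ≤ cdfFn μ x}) ⟨b, hb.le⟩ hx
  exact hy.trans (monotone_cdfFn μ hyx.le)

/-- A probability measure whose distribution function is almost everywhere `0` or `1` is a
point mass. -/
theorem exists_eq_dirac_of_cdfFn_ae (h : ∀ᵐ x, cdfFn μ x = 0 ∨ cdfFn μ x = 1) :
    ∃ c, μ = Measure.dirac c := by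
  set c := quantileFn μ (1 / 2) with hc
  have hbelow : ∀ x < c, cdfFn μ x = 0 := by
    intro x hx
    obtain ⟨y, hy, hy'⟩ := (Measure.dense_of_ae h).exists_between hx
    have hlt := cdfFn_lt_of_lt_quantileFn μ (by norm_num) (hc ▸ hy'.2)
    have hle := monotone_cdfFn μ hy'.1.le
    have := cdfFn_nonneg μ x
    rcases hy with hy | hy <;> linarith
  have habove : ∀ x > c, cdfFn μ x = 1 := by
    intro x hx
    obtain ⟨y, hy, hy'⟩ := (Measure.dense_of_ae h).exists_between hx
    have hge := le_cdfFn_of_quantileFn_lt μ (by norm_num) (hc ▸ hy'.1)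
    have hle := monotone_cdfFn μ hy'.2.le
    have := cdfFn_le_one μ x
    rcases hy with hy | hy <;> linarith
  have hat : cdfFn μ c = 1 := by
    have h1 : Tendsto (cdfFn μ) (𝓝[>] c) (𝓝 (cdfFn μ c)) := by
      rw [cdfFn_eq_cdf]
      exact ((ProbabilityTheory.cdf μ).right_continuous c).mono Ioi_subset_Ici_self
    have h2 : Tendsto (cdfFn μ) (𝓝[>] c) (𝓝 1) :=
      tendsto_const_nhds.congr' (by
        filter_upwards [self_mem_nhdsWithin] with x hx using (habove x hx).symm)
    exact tendsto_nhds_unique h1 h2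
  refine ⟨c, Measure.ext_of_Iic _ _ fun x => ?_⟩
  rw [← ENNReal.toReal_eq_toReal_iff' (measure_ne_top _ _) (measure_ne_top _ _)]
  change cdfFn μ x = _
  rcases lt_trichotomy x c with hx | rfl | hx
  · simp [hbelow x hx, hx]
  · simp [hat]
  · simp [habove x hx, hx.le]

variable {μ}

theorem measureReal_abs_le_abs_le (hmom : Integrable (fun x : ℝ => x ^ 2) μ) (x : ℝ) :
    μ.real {y | |x| ≤ |y|} ≤ (1 + ∫ y, y ^ 2 ∂μ) * (1 + x ^ 2)⁻¹ := by
  have h := mul_meas_ge_le_integral_of_nonneg (.of_forall fun y => sq_nonneg y) hmom (x ^ 2)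
  simp only [sq_le_sq] at h
  have h1 : μ.real {y | |x| ≤ |y|} ≤ 1 := measureReal_le_one
  rw [← div_eq_mul_inv, le_div_iff₀ (by positivity)]
  linarith

theorem cdfFn_le_of_neg (hmom : Integrable (fun x : ℝ => x ^ 2) μ) {x : ℝ} (hx : x < 0) :
    cdfFn μ x ≤ (1 + ∫ y, y ^ 2 ∂μ) * (1 + x ^ 2)⁻¹ := by
  refine le_trans (measureReal_mono fun y (hy : y ≤ x) => ?_) (measureReal_abs_le_abs_le hmom x)
  simp only [mem_ofPred_eq, abs_of_neg hx, abs_of_neg (hy.trans_lt hx)]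
  linarith

theorem one_sub_cdfFn_le_of_nonneg (hmom : Integrable (fun x : ℝ => x ^ 2) μ) {x : ℝ}
    (hx : 0 ≤ x) : 1 - cdfFn μ x ≤ (1 + ∫ y, y ^ 2 ∂μ) * (1 + x ^ 2)⁻¹ := by
  have h : 1 - cdfFn μ x = μ.real (Ioi x) := by
    rw [← compl_Iic, probReal_compl_eq_one_sub measurableSet_Iic]
    rfl
  rw [h]
  refine le_trans (measureReal_mono fun y (hy : x < y) => ?_) (measureReal_abs_le_abs_le hmom x)
  simp only [mem_ofPred_eq, abs_of_nonneg hx, abs_of_pos (hx.trans_lt hy)]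
  linarith

end CDF

theorem summable_coeff_mul_pow_succ {c : ℕ → ℂ} {M : ℝ} (hc : ∀ n, ‖c n‖ ≤ M) {z : ℂ}
    (hz : ‖z‖ < 1) : Summable fun n => c n * z ^ (n + 1) := by
  refine Summable.of_norm_bounded (g := fun n => M * ‖z‖ ^ (n + 1))
    (((summable_nat_add_iff 1).mpr
      (summable_geometric_of_lt_one (norm_nonneg z) hz)).mul_left M) fun n => ?_
  rw [norm_mul, norm_pow]
  gcongr
  exact hc n

theorem hasDerivAt_tsum_coeff_mul_pow_succ {c : ℕ → ℂ} {M : ℝ} (hc : ∀ n, ‖c n‖ ≤ M) {z : ℂ}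
    (hz : ‖z‖ < 1) : HasDerivAt (fun z : ℂ => ∑' n, c n * z ^ (n + 1))
      (∑' n : ℕ, ((n + 1 : ℕ) * c n) * z ^ n) z := by
  obtain ⟨r, hzr, hr⟩ := exists_between hz
  have hr0 : 0 ≤ r := (norm_nonneg z).trans hzr.le
  have hM : 0 ≤ M := (norm_nonneg _).trans (hc 0)
  have hu : Summable fun n : ℕ => ((n + 1 : ℕ) * M) * r ^ n := by
    have hr' : ‖r‖ < 1 := by rwa [Real.norm_of_nonneg hr0]
    have h1 := (summable_pow_mul_geometric_of_norm_lt_one 1 hr').add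
      (summable_pow_mul_geometric_of_norm_lt_one 0 hr')
    refine (h1.mul_left M).congr fun n => ?_
    push_cast
    ring
  refine hasDerivAt_tsum_of_isPreconnected (𝕜 := ℂ) (t := Metric.ball (0 : ℂ) r)
    (y₀ := 0) (g := fun n z => c n * z ^ (n + 1))
    (g' := fun n z => ((n + 1 : ℕ) * c n) * z ^ n) hu Metric.isOpen_ball
    (convex_ball 0 r).isPreconnected (fun n y _ => ?_) (fun n y hy => ?_)
    (Metric.mem_ball_self ((norm_nonneg z).trans_lt hzr)) ?_ (mem_ball_zero_iff.mpr hzr)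
  · convert! (hasDerivAt_pow (n + 1) y).const_mul (c n) using 1
    simp
    ring
  · rw [norm_mul, norm_mul, norm_pow, Complex.norm_natCast]
    have := (mem_ball_zero_iff.mp hy).le
    gcongr
    exact hc n
  · exact summable_coeff_mul_pow_succ hc (by simp)

/-- The signed kernel whose integral in `x` over `ℝ` is `y` when `s = {x | x < y}`. -/
noncomputable def layerKernel (T : ℝ → ℝ) (x θ : ℝ) : ℝ :=
  (if T x < θ then 1 else 0) - (if x < 0 then 1 else 0)

theorem integral_indicator_Iio_sub (y : ℝ) :
    ∫ x : ℝ, ((Iio y).indicator 1 x - (Iio 0).indicator 1 x : ℝ) = y := by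
  rcases le_total 0 y with hy | hy
  · have h : (fun x : ℝ => ((Iio y).indicator 1 x - (Iio 0).indicator 1 x : ℝ))
        = (Ico 0 y).indicator 1 := by
      funext x
      simp only [indicator, mem_Iio, mem_Ico, Pi.one_apply]
      split_ifs <;> grind
    rw [h, integral_indicator_one measurableSet_Ico]
    simp [measureReal_def, hy]
  · have h : (fun x : ℝ => ((Iio y).indicator 1 x - (Iio 0).indicator 1 x : ℝ))
        = fun x => -(Ico y 0).indicator 1 x := by
      funext x
      simp only [indicator, mem_Iio, mem_Ico, Pi.one_apply]
      split_ifs <;> grind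
    rw [h, integral_neg, integral_indicator_one measurableSet_Ico]
    simp [measureReal_def, hy]

theorem integral_layerKernel_left {T : ℝ → ℝ} {θ y : ℝ} (h₁ : ∀ x < y, T x < θ)
    (h₂ : ∀ x > y, θ ≤ T x) : ∫ x, layerKernel T x θ = y := by
  rw [← integral_indicator_Iio_sub y]
  apply integral_congr_ae
  filter_upwards [Measure.ae_ne volume y] with x hx
  rcases lt_or_gt_of_ne hx with h | h
  · simp [layerKernel, indicator, h₁ x h, h]
  · simp [layerKernel, indicator, (h₂ x h).not_gt, h.not_gt]

theorem integral_layerKernel_mul_cos {T : ℝ → ℝ} (h0 : ∀ x, 0 ≤ T x) (hpi : ∀ x, T x ≤ π)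
    {n : ℕ} (hn : n ≠ 0) (x : ℝ) :
    ∫ θ in Ioc 0 π, layerKernel T x θ * Real.cos (n * θ) = -(Real.sin (n * T x) / n) := by
  have hn' : (n : ℝ) ≠ 0 := by exact_mod_cast hn
  have hcos (a : ℝ) : ∫ θ in a..π, Real.cos (n * θ) = -(Real.sin (n * a) / n) := by
    rw [intervalIntegral.integral_comp_mul_left _ hn', integral_cos]
    simp [Real.sin_nat_mul_pi]
    ring
  have hi : IntegrableOn (fun θ : ℝ => Real.cos (n * θ)) (Ioc 0 π) :=
    (by fun_prop : Continuous fun θ : ℝ => Real.cos (n * θ)).integrableOn_Ioc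
  have h1 : (fun θ => layerKernel T x θ * Real.cos (n * θ)) = fun θ =>
      (Ioi (T x)).indicator (fun θ => Real.cos (n * θ)) θ
        - (if x < 0 then 1 else 0) * Real.cos (n * θ) := by
    funext θ
    simp only [layerKernel, indicator, mem_Ioi]
    split_ifs <;> ring
  rw [h1, integral_sub (hi.indicator measurableSet_Ioi) (hi.const_mul _), integral_const_mul,
    setIntegral_indicator measurableSet_Ioi, Ioc_inter_Ioi, max_eq_right (h0 x),
    ← intervalIntegral.integral_of_le (hpi x), ← intervalIntegral.integral_of_le Real.pi_pos.le,
    hcos, hcos]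
  simp

theorem measurable_layerKernel {T : ℝ → ℝ} (hT : Measurable T) :
    Measurable (Function.uncurry (layerKernel T)) := by
  unfold layerKernel Function.uncurry
  refine Measurable.sub (Measurable.ite ?_ measurable_const measurable_const)
    (Measurable.ite ?_ measurable_const measurable_const)
  · exact measurableSet_lt (hT.comp measurable_fst) measurable_snd
  · exact measurableSet_lt measurable_fst measurable_const

theorem abs_layerKernel_le_one (T : ℝ → ℝ) (x θ : ℝ) : |layerKernel T x θ| ≤ 1 := by
  unfold layerKernel
  split_ifs <;> simp

theorem integrable_layerKernel {T : ℝ → ℝ} (hT : Measurable T) (h0 : ∀ x, 0 ≤ T x)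
    (hpi : ∀ x, T x ≤ π) {C : ℝ}
    (hneg : ∀ x < 0, T x ≤ C * (1 + x ^ 2)⁻¹) (hpos : ∀ x ≥ 0, π - T x ≤ C * (1 + x ^ 2)⁻¹) :
    Integrable (Function.uncurry (layerKernel T)) (volume.prod (volume.restrict (Ioc 0 π))) := by
  have hm := measurable_layerKernel hT
  rw [integrable_prod_iff hm.aestronglyMeasurable]
  refine ⟨.of_forall fun x => ?_, ?_⟩
  · refine Integrable.mono' (integrable_const (1 : ℝ))
      (hm.comp measurable_prodMk_left).aestronglyMeasurable (.of_forall fun θ => ?_)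
    exact abs_layerKernel_le_one T x θ
  · refine Integrable.mono' (integrable_inv_one_add_sq.const_mul C)
      hm.aestronglyMeasurable.norm.integral_prod_right' (.of_forall fun x => ?_)
    rw [Real.norm_of_nonneg (integral_nonneg fun θ => norm_nonneg _)]
    simp only [Function.uncurry]
    rcases lt_or_ge x 0 with hx | hx
    · refine le_trans (le_of_eq ?_) (hneg x hx)
      have : (fun θ => ‖layerKernel T x θ‖) = (Iic (T x)).indicator 1 := by
        funext θ
        simp only [layerKernel, hx, indicator, mem_Iic, if_true, Pi.one_apply, ← not_lt]
        split_ifs <;> simp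
      rw [this, integral_indicator_one measurableSet_Iic, measureReal_restrict_apply
        measurableSet_Iic, inter_comm, Ioc_inter_Iic, min_eq_right (hpi x)]
      simp [measureReal_def, h0 x]
    · refine le_trans (le_of_eq ?_) (hpos x hx)
      have : (fun θ => ‖layerKernel T x θ‖) = (Ioi (T x)).indicator 1 := by
        funext θ
        simp only [layerKernel, hx.not_gt, indicator, mem_Ioi, if_false, Pi.one_apply]
        split_ifs <;> simp
      rw [this, integral_indicator_one measurableSet_Ioi, measureReal_restrict_apply
        measurableSet_Ioi, inter_comm, Ioc_inter_Ioi, max_eq_right (h0 x)]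
      simp [measureReal_def, hpi x]

theorem integrable_layerKernel_mul_cos {T : ℝ → ℝ}
    (hK : Integrable (Function.uncurry (layerKernel T)) (volume.prod (volume.restrict (Ioc 0 π))))
    (n : ℕ) : Integrable (Function.uncurry fun x θ => layerKernel T x θ * Real.cos (n * θ))
      (volume.prod (volume.restrict (Ioc 0 π))) := by
  refine hK.mul_bdd (c := 1) (by fun_prop) (.of_forall fun p => ?_)
  exact Real.abs_cos_le_one _

theorem integrable_sin_nat_mul {T : ℝ → ℝ} (h0 : ∀ x, 0 ≤ T x) (hpi : ∀ x, T x ≤ π)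
    (hK : Integrable (Function.uncurry (layerKernel T)) (volume.prod (volume.restrict (Ioc 0 π))))
    (n : ℕ) : Integrable fun x => Real.sin (n * T x) := by
  rcases eq_or_ne n 0 with rfl | hn
  · simp
  have h := (integrable_layerKernel_mul_cos hK n).integral_prod_left.const_mul (-(n : ℝ))
  refine h.congr (.of_forall fun x => ?_)
  have hn' : (n : ℝ) ≠ 0 := by exact_mod_cast hn
  simp only [Function.uncurry, integral_layerKernel_mul_cos h0 hpi hn x]
  field_simp

/-- The Fourier cosine coefficients of an even function that is a generalised inverse of `T`
on `(0, π)`, as integrals of sines along `T`. -/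
theorem fourier_cos_eq_integral_sin {T q φ : ℝ → ℝ} (h0 : ∀ x, 0 ≤ T x) (hpi : ∀ x, T x ≤ π)
    (hK : Integrable (Function.uncurry (layerKernel T)) (volume.prod (volume.restrict (Ioc 0 π))))
    (h₁ : ∀ θ ∈ Ioo 0 π, ∀ x < q θ, T x < θ) (h₂ : ∀ θ ∈ Ioo 0 π, ∀ x > q θ, θ ≤ T x)
    (hφ : ∀ θ, φ θ = q |θ|) {n : ℕ} (hn : n ≠ 0) :
    n * ((1 / π) * ∫ θ in (-π)..π, φ θ * Real.cos (n * θ))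
      = -(2 / π) * ∫ x, Real.sin (n * T x) := by
  have hn' : (n : ℝ) ≠ 0 := by exact_mod_cast hn
  have hKn := integrable_layerKernel_mul_cos hK n
  have hae : (fun θ => ∫ x, layerKernel T x θ * Real.cos (n * θ)) =ᵐ[volume.restrict (Ioc 0 π)]
      fun θ => φ θ * Real.cos (n * θ) := by
    rw [← restrict_Ioo_eq_restrict_Ioc]
    filter_upwards [ae_restrict_mem measurableSet_Ioo] with θ hθ
    rw [integral_mul_const, integral_layerKernel_left (h₁ θ hθ) (h₂ θ hθ), hφ,
      abs_of_pos hθ.1]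
  have hval : ∫ θ in (0)..π, φ θ * Real.cos (n * θ) = ∫ x, -(Real.sin (n * T x) / n) := by
    rw [intervalIntegral.integral_of_le Real.pi_pos.le, ← integral_congr_ae hae,
      ← integral_integral_swap hKn]
    simp_rw [integral_layerKernel_mul_cos h0 hpi hn]
  have heven (θ : ℝ) : φ θ * Real.cos (n * θ) = φ (-θ) * Real.cos (n * -θ) := by
    simp [hφ]
  have hint : IntervalIntegrable (fun θ => φ θ * Real.cos (n * θ)) volume 0 π := by
    rw [intervalIntegrable_iff_integrableOn_Ioc_of_le Real.pi_pos.le]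
    exact hKn.integral_prod_right.congr hae
  have hint' : IntervalIntegrable (fun θ => φ θ * Real.cos (n * θ)) volume (-π) 0 := by
    simpa [hφ] using (IntervalIntegrable.comp_sub_left hint 0).symm
  have hneg : ∫ θ in (-π)..0, φ θ * Real.cos (n * θ) = ∫ θ in (0)..π, φ θ * Real.cos (n * θ) := by
    have := intervalIntegral.integral_comp_neg (a := -π) (b := 0)
      fun θ => φ θ * Real.cos (n * θ)
    simpa [hφ] using this
  rw [← intervalIntegral.integral_add_adjacent_intervals hint' hint, hneg, hval, integral_neg,
    integral_div]
  field_simp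
  ring

theorem abs_sin_nat_mul_le (n : ℕ) (s : ℝ) : |Real.sin (n * s)| ≤ n * |Real.sin s| := by
  induction n with
  | zero => simp
  | succ n ih =>
    have h : Real.sin ((n + 1 : ℕ) * s) =
        Real.sin (n * s) * Real.cos s + Real.cos (n * s) * Real.sin s := by
      rw [← Real.sin_add]; push_cast; ring_nf
    rw [h]
    calc |Real.sin (n * s) * Real.cos s + Real.cos (n * s) * Real.sin s|
        ≤ |Real.sin (n * s)| * |Real.cos s| + |Real.cos (n * s)| * |Real.sin s| := by
          rw [← abs_mul, ← abs_mul]; exact abs_add_le _ _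
      _ ≤ |Real.sin (n * s)| * 1 + 1 * |Real.sin s| := by
          gcongr <;> apply Real.abs_cos_le_one
      _ ≤ ((n + 1 : ℕ) : ℝ) * |Real.sin s| := by push_cast; linarith

theorem re_one_add_div_one_sub_pos {a : ℂ} (ha : ‖a‖ < 1) : 0 < ((1 + a) / (1 - a)).re := by
  have hne : 1 - a ≠ 0 := by
    intro h
    rw [← sub_eq_zero.mp h] at ha
    simp at ha
  have h2 : a.re * a.re + a.im * a.im < 1 := by
    have := Complex.normSq_eq_norm_sq a
    rw [Complex.normSq_apply] at this
    rw [this]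
    nlinarith [norm_nonneg a]
  have hpos : 0 < Complex.normSq (1 - a) := Complex.normSq_pos.mpr hne
  rw [Complex.div_re, ← add_div]
  apply div_pos _ hpos
  simp
  nlinarith

/-- The sine generating function, in factored form. -/
theorem hasSum_sin_mul_pow (s : ℝ) {z : ℂ} (hz : ‖z‖ < 1) :
    HasSum (fun n : ℕ => (Real.sin ((n + 1 : ℕ) * s) : ℂ) * z ^ n)
      (Real.sin s / ((1 - z * Complex.exp (s * Complex.I)) *
        (1 - z * Complex.exp (-(s * Complex.I))))) := by
  set e := Complex.exp (s * Complex.I) with he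
  set e' := Complex.exp (-(s * Complex.I)) with he'
  have hee : e * e' = 1 := by rw [he, he', ← Complex.exp_add]; simp
  have hn : ‖z * e‖ < 1 := by rw [norm_mul, he, Complex.norm_exp_ofReal_mul_I, mul_one]; exact hz
  have hn' : ‖z * e'‖ < 1 := by
    have : e' = Complex.exp ((-s : ℝ) * Complex.I) := by rw [he']; push_cast; ring_nf
    rw [norm_mul, this, Complex.norm_exp_ofReal_mul_I, mul_one]; exact hz
  have hd : 1 - z * e ≠ 0 := fun h => by rw [← sub_eq_zero.mp h] at hn; simp at hn
  have hd' : 1 - z * e' ≠ 0 := fun h => by rw [← sub_eq_zero.mp h] at hn'; simp at hn'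
  have hs (t : ℝ) : (Real.sin t : ℂ) =
      (Complex.exp (-(t * Complex.I)) - Complex.exp (t * Complex.I)) * Complex.I / 2 := by
    rw [Complex.ofReal_sin, Complex.sin]; ring_nf
  have key := (((hasSum_geometric_of_norm_lt_one hn').mul_left e').sub
    ((hasSum_geometric_of_norm_lt_one hn).mul_left e)).mul_left (Complex.I / 2)
  convert! key using 1
  · funext n
    have h1 : Complex.exp ((((n + 1 : ℕ) * s : ℝ) : ℂ) * Complex.I) = e ^ (n + 1) := by
      rw [he, ← Complex.exp_nat_mul]; push_cast; ring_nf
    have h2 : Complex.exp (-((((n + 1 : ℕ) * s : ℝ) : ℂ) * Complex.I)) = e' ^ (n + 1) := by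
      rw [he', ← Complex.exp_nat_mul]; push_cast; ring_nf
    rw [hs, h1, h2]
    ring
  · rw [hs s, ← he, ← he', div_eq_iff (mul_ne_zero hd hd')]
    have h1 := inv_mul_cancel₀ hd
    have h2 := inv_mul_cancel₀ hd'
    generalize (1 - z * e)⁻¹ = u at *
    generalize (1 - z * e')⁻¹ = v at *
    linear_combination
      -(Complex.I / 2) * (e' * (1 - z * e) * h2 - e * (1 - z * e') * h1)

theorem re_one_sub_sq_div_pos (s : ℝ) {z : ℂ} (hz : ‖z‖ < 1) :
    0 < ((1 - z ^ 2) / ((1 - z * Complex.exp (s * Complex.I)) *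
        (1 - z * Complex.exp (-(s * Complex.I))))).re := by
  set e := Complex.exp (s * Complex.I) with he
  set e' := Complex.exp (-(s * Complex.I)) with he'
  have hee : e * e' = 1 := by rw [he, he', ← Complex.exp_add]; simp
  have hn : ‖z * e‖ < 1 := by rw [norm_mul, he, Complex.norm_exp_ofReal_mul_I, mul_one]; exact hz
  have hn' : ‖z * e'‖ < 1 := by
    have : e' = Complex.exp ((-s : ℝ) * Complex.I) := by rw [he']; push_cast; ring_nf
    rw [norm_mul, this, Complex.norm_exp_ofReal_mul_I, mul_one]; exact hz
  have hd : 1 - z * e ≠ 0 := fun h => by rw [← sub_eq_zero.mp h] at hn; simp at hn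
  have hd' : 1 - z * e' ≠ 0 := fun h => by rw [← sub_eq_zero.mp h] at hn'; simp at hn'
  have h : (1 - z ^ 2) / ((1 - z * e) * (1 - z * e')) =
      ((1 + z * e) / (1 - z * e) + (1 + z * e') / (1 - z * e')) / (2 : ℝ) := by
    push_cast
    field_simp
    linear_combination (2 * z ^ 2) * hee
  rw [h, Complex.div_ofReal_re, Complex.add_re]
  have := re_one_add_div_one_sub_pos hn
  have := re_one_add_div_one_sub_pos hn'
  positivity

/-- A holomorphic function on the unit disc with `Re ((1 - z²) f'(z)) < 0` is injective. -/
theorem injOn_ball_of_re_one_sub_sq_mul_deriv_neg {f f' : ℂ → ℂ}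
    (hf : ∀ z ∈ Metric.ball (0 : ℂ) 1, HasDerivAt f (f' z) z)
    (hneg : ∀ z ∈ Metric.ball (0 : ℂ) 1, ((1 - z ^ 2) * f' z).re < 0) :
    InjOn f (Metric.ball (0 : ℂ) 1) := by
  intro z₁ hz₁ z₂ hz₂ heq
  by_contra hne
  set ζ : ℂ → ℂ := fun w => (Complex.exp w - 1) / (Complex.exp w + 1) with hζ
  set L : ℂ → ℂ := fun z => Complex.log ((1 + z) / (1 - z)) with hL
  have hζL : ∀ z ∈ Metric.ball (0 : ℂ) 1, ζ (L z) = z := by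
    intro z hz
    have hpos := re_one_add_div_one_sub_pos (mem_ball_zero_iff.mp hz)
    have h0 : (1 + z) / (1 - z) ≠ 0 := by
      intro h; rw [h] at hpos; simp at hpos
    have h1 : 1 - z ≠ 0 := fun h => h0 (by rw [h, div_zero])
    simp only [hζ, hL, Complex.exp_log h0]
    have h2 : (1 + z) / (1 - z) + 1 ≠ 0 := by
      have : (1 + z) / (1 - z) + 1 = 2 / (1 - z) := by field_simp; ring
      rw [this]; exact div_ne_zero two_ne_zero h1
    rw [div_eq_iff h2]
    field_simp
    ring
  have hLim : ∀ z ∈ Metric.ball (0 : ℂ) 1, |(L z).im| < π / 2 := by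
    intro z hz
    rw [hL, Complex.log_im]
    exact Complex.abs_arg_lt_pi_div_two_iff.mpr
      (Or.inl (re_one_add_div_one_sub_pos (mem_ball_zero_iff.mp hz)))
  set d := L z₂ - L z₁ with hd
  have hd0 : d ≠ 0 := by
    intro h
    apply hne
    rw [← hζL z₁ hz₁, ← hζL z₂ hz₂, sub_eq_zero.mp h]
  set w : ℝ → ℂ := fun t => L z₁ + t * d with hw
  have hre : ∀ t ∈ Icc (0 : ℝ) 1, 0 < (Complex.exp (w t)).re := by
    intro t ht
    have him : (w t).im = (1 - t) * (L z₁).im + t * (L z₂).im := by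
      simp [hw, hd]; ring
    have h1 := abs_lt.mp (hLim z₁ hz₁)
    have h2 := abs_lt.mp (hLim z₂ hz₂)
    have hb : |(w t).im| < π / 2 := by
      rw [him]
      have := (convex_Ioo (-(π / 2)) (π / 2)) (mem_Ioo.mpr h1) (mem_Ioo.mpr h2)
        (sub_nonneg.mpr ht.2) ht.1 (by ring)
      simpa [abs_lt] using this
    rw [Complex.exp_re]
    exact mul_pos (Real.exp_pos _) (Real.cos_pos_of_mem_Ioo (abs_lt.mp hb))
  have hball : ∀ t ∈ Icc (0 : ℝ) 1, ζ (w t) ∈ Metric.ball (0 : ℂ) 1 := by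
    intro t ht
    have h := hre t ht
    set E := Complex.exp (w t) with hE
    have hE1 : E + 1 ≠ 0 := by
      intro h'
      have := congrArg Complex.re h'
      simp at this; linarith
    rw [mem_ball_zero_iff]
    simp only [hζ, norm_div, ← hE]
    rw [div_lt_one (norm_pos_iff.mpr hE1), ← sq_lt_sq₀ (norm_nonneg _) (norm_nonneg _),
      ← Complex.normSq_eq_norm_sq, ← Complex.normSq_eq_norm_sq, Complex.normSq_apply,
      Complex.normSq_apply]
    simp
    nlinarith
  have hder : ∀ t ∈ Icc (0 : ℝ) 1, HasDerivAt (fun t : ℝ => (f (ζ (w t)) / d).re)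
      (((1 - ζ (w t) ^ 2) * f' (ζ (w t))).re / 2) t := by
    intro t ht
    have hE1 : Complex.exp (w t) + 1 ≠ 0 := by
      intro h'
      have := congrArg Complex.re h'
      have := hre t ht
      simp at *; linarith
    have hwd : HasDerivAt w d t := by
      have := ((Complex.ofRealCLM.hasDerivAt (x := t)).mul_const d).const_add (L z₁)
      simpa [hw] using this
    have hζd : HasDerivAt ζ ((1 - ζ (w t) ^ 2) / 2) (w t) := by
      have := ((Complex.hasDerivAt_exp (w t)).sub_const 1).div
        ((Complex.hasDerivAt_exp (w t)).add_const 1) hE1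
      convert! this using 1
      simp only [hζ]
      field_simp
      ring
    have hc := (((hf _ (hball t ht)).comp (w t) hζd).comp_of_eq t hwd rfl).div_const d
    have hr := Complex.reCLM.hasFDerivAt.comp_hasDerivAt t hc
    convert! hr using 1
    have : f' (ζ (w t)) * ((1 - ζ (w t) ^ 2) / 2) * d / d =
        ((1 - ζ (w t) ^ 2) * f' (ζ (w t))) / (2 : ℝ) := by
      push_cast; field_simp
    rw [this, Complex.reCLM_apply, Complex.div_ofReal_re]
  have hanti : StrictAntiOn (fun t : ℝ => (f (ζ (w t)) / d).re) (Icc 0 1) := by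
    apply strictAntiOn_of_deriv_neg (convex_Icc 0 1)
    · exact fun t ht => (hder t ht).continuousAt.continuousWithinAt
    · intro t ht
      have ht' := interior_subset ht
      rw [(hder t ht').deriv]
      linarith [hneg _ (hball t ht')]
  have := hanti (left_mem_Icc.mpr zero_le_one) (right_mem_Icc.mpr zero_le_one) zero_lt_one
  simp only [hw, hd, Complex.ofReal_zero, Complex.ofReal_one, zero_mul, add_zero, one_mul,
    add_sub_cancel, hζL z₁ hz₁, hζL z₂ hz₂, heq, lt_irrefl] at this

/-- The generating function of the sine integrals of `T` has negative real part after
multiplication by `1 - z²`, provided `T` is valued in `[0, π]` and not a.e. in `{0, π}`. -/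
theorem re_one_sub_sq_mul_tsum_neg {T : ℝ → ℝ} (hT : Measurable T) (h0 : ∀ x, 0 ≤ T x)
    (hpi : ∀ x, T x ≤ π) (hi : ∀ n : ℕ, Integrable fun x => Real.sin (n * T x))
    (hne : ¬ ∀ᵐ x, Real.sin (T x) = 0) {b : ℕ → ℝ}
    (hb : ∀ n, b n = -(2 / π) * ∫ x, Real.sin ((n + 1 : ℕ) * T x)) {z : ℂ} (hz : ‖z‖ < 1) :
    ((1 - z ^ 2) * ∑' n : ℕ, (b n : ℂ) * z ^ n).re < 0 := by
  have hi1 : Integrable fun x => Real.sin (T x) := by simpa using hi 1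
  set S : ℝ → ℂ := fun x => Real.sin (T x) / ((1 - z * Complex.exp (T x * Complex.I)) *
        (1 - z * Complex.exp (-(T x * Complex.I)))) with hS
  have hnorm (n : ℕ) : ∫ x, ‖(Real.sin ((n + 1 : ℕ) * T x) : ℂ) * z ^ n‖ ≤
      (∫ x, |Real.sin (T x)|) * ((n + 1 : ℕ) * ‖z‖ ^ n) := by
    rw [← integral_mul_const]
    refine integral_mono (((hi (n + 1)).ofReal (𝕜 := ℂ)).mul_const _).norm (hi1.abs.mul_const _)
      fun x => ?_
    simp only [norm_mul, norm_pow, Complex.norm_real, Real.norm_eq_abs]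
    calc _ ≤ ((n + 1 : ℕ) * |Real.sin (T x)|) * ‖z‖ ^ n := by
          gcongr; exact abs_sin_nat_mul_le _ _
      _ = _ := by ring
  have hsummable : Summable fun n : ℕ => ((n + 1 : ℕ) : ℝ) * ‖z‖ ^ n := by
    have hz' : ‖(‖z‖)‖ < 1 := by rwa [norm_norm]
    refine ((summable_pow_mul_geometric_of_norm_lt_one 1 hz').add
      (summable_pow_mul_geometric_of_norm_lt_one 0 hz')).congr fun n => ?_
    push_cast
    ring
  have hsum := hasSum_integral_of_summable_integral_norm
    (F := fun (n : ℕ) x => (Real.sin ((n + 1 : ℕ) * T x) : ℂ) * z ^ n)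
    (fun n => ((hi (n + 1)).ofReal (𝕜 := ℂ)).mul_const _)
    (.of_nonneg_of_le (fun n => integral_nonneg fun x => norm_nonneg _) hnorm
      (hsummable.mul_left _))
  simp_rw [(hasSum_sin_mul_pow _ hz).tsum_eq, integral_mul_const, integral_complex_ofReal] at hsum
  have hD : ∑' n : ℕ, (b n : ℂ) * z ^ n = (-(2 / π) : ℝ) * ∫ x, S x := by
    refine (hsum.mul_left ((-(2 / π) : ℝ) : ℂ)).tsum_eq ▸ tsum_congr fun n => ?_
    rw [hb]
    push_cast
    ring
  have hden (s : ℝ) : 1 - ‖z‖ ≤ ‖1 - z * Complex.exp (s * Complex.I)‖ := by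
    have := norm_sub_norm_le (1 : ℂ) (z * Complex.exp (s * Complex.I))
    rwa [norm_mul, Complex.norm_exp_ofReal_mul_I, mul_one, norm_one] at this
  have hSint : Integrable S := by
    refine Integrable.mono' (hi1.abs.div_const ((1 - ‖z‖) * (1 - ‖z‖)))
      (by fun_prop : Measurable S).aestronglyMeasurable (.of_forall fun x => ?_)
    have h1 := hden (T x)
    have h2 := hden (-T x)
    rw [Complex.ofReal_neg, neg_mul] at h2
    have hz0 : 0 < 1 - ‖z‖ := sub_pos.mpr hz
    simp only [hS, norm_div, norm_mul, Complex.norm_real, Real.norm_eq_abs]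
    gcongr
  have hPint := hSint.const_mul (1 - z ^ 2)
  have hfac (x : ℝ) : ((1 - z ^ 2) * S x).re = Real.sin (T x) *
      ((1 - z ^ 2) / ((1 - z * Complex.exp (T x * Complex.I)) *
        (1 - z * Complex.exp (-(T x * Complex.I))))).re := by
    rw [← Complex.re_ofReal_mul]
    congr 1
    ring
  have hpos : 0 < ∫ x, ((1 - z ^ 2) * S x).re := by
    have hnn : 0 ≤ fun x => ((1 - z ^ 2) * S x).re := fun x => by
      simp only [hfac]
      exact mul_nonneg (Real.sin_nonneg_of_nonneg_of_le_pi (h0 x) (hpi x))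
        (re_one_sub_sq_div_pos (T x) hz).le
    refine (integral_nonneg hnn).lt_of_ne fun h => hne ?_
    have := (integral_eq_zero_iff_of_nonneg hnn hPint.re).mp h.symm
    filter_upwards [this] with x hx
    simp only [hfac, Pi.zero_apply] at hx
    exact (mul_eq_zero.mp hx).resolve_right (re_one_sub_sq_div_pos (T x) hz).ne'
  have hre : ((1 - z ^ 2) * ∫ x, S x).re = ∫ x, ((1 - z ^ 2) * S x).re := by
    rw [← integral_const_mul]
    exact (integral_re hPint).symm
  rw [hD, mul_left_comm, Complex.re_ofReal_mul, hre]
  have : 0 < 2 / π := by positivity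
  nlinarith

/-- Gross' theorem: for a non-degenerate zero-mean probability measure `μ` with finite
second moment, the power series `Φ(z) = Σ_{n≥1} aₙ zⁿ` built from the Fourier cosine
coefficients of `φ(θ) = q(|θ|/π)` converges on the open unit disc and is injective there. -/
theorem gross_univalence
    (μ : Measure ℝ) [IsProbabilityMeasure μ]
    (hnondeg : ∀ c : ℝ, μ ≠ Measure.dirac c)
    (hmom : Integrable (fun x : ℝ => x ^ 2) μ)
    (hmean : ∫ x, x ∂μ = 0)
    (φ : ℝ → ℝ) (hφ : ∀ θ, φ θ = quantileFn μ (|θ| / π))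
    (aa : ℕ → ℝ)
    (ha : ∀ n : ℕ, aa n = (1 / π) * ∫ θ in (-π)..π, φ θ * Real.cos (n * θ)) :
    (∀ z ∈ Metric.ball (0 : ℂ) 1,
        Summable fun n : ℕ => (aa (n + 1) : ℂ) * z ^ (n + 1)) ∧
    InjOn (fun z : ℂ => ∑' n : ℕ, (aa (n + 1) : ℂ) * z ^ (n + 1))
      (Metric.ball (0 : ℂ) 1) := by
  have hpi0 := Real.pi_pos
  set T : ℝ → ℝ := fun x => π * cdfFn μ x with hTdef
  have hT : Measurable T := (monotone_cdfFn μ).measurable.const_mul π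
  have h0 (x : ℝ) : 0 ≤ T x := mul_nonneg hpi0.le (cdfFn_nonneg μ x)
  have hpi (x : ℝ) : T x ≤ π := mul_le_of_le_one_right hpi0.le (cdfFn_le_one μ x)
  have hK := integrable_layerKernel (C := π * (1 + ∫ y, y ^ 2 ∂μ)) hT h0 hpi
    (fun x hx => by
      rw [mul_assoc]
      exact mul_le_mul_of_nonneg_left (cdfFn_le_of_neg hmom hx) hpi0.le)
    (fun x hx => by
      rw [mul_assoc, show π - T x = π * (1 - cdfFn μ x) by simp only [hTdef]; ring]
      exact mul_le_mul_of_nonneg_left (one_sub_cdfFn_le_of_nonneg hmom hx) hpi0.le)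
  have hi := integrable_sin_nat_mul h0 hpi hK
  have hb (n : ℕ) : ((n + 1 : ℕ) : ℝ) * aa (n + 1) =
      -(2 / π) * ∫ x, Real.sin ((n + 1 : ℕ) * T x) := by
    rw [ha]
    refine fourier_cos_eq_integral_sin (q := fun θ => quantileFn μ (θ / π)) h0 hpi hK
      (fun θ hθ x hx => ?_) (fun θ hθ x hx => ?_) hφ n.succ_ne_zero
    · have := cdfFn_lt_of_lt_quantileFn μ (div_pos hθ.1 hpi0) hx
      rwa [lt_div_iff₀' hpi0] at this
    · have := le_cdfFn_of_quantileFn_lt μ ((div_lt_one hpi0).mpr hθ.2) hx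
      rwa [div_le_iff₀' hpi0] at this
  have hne : ¬ ∀ᵐ x, Real.sin (T x) = 0 := by
    intro h
    obtain ⟨c, hc⟩ := exists_eq_dirac_of_cdfFn_ae μ (by
      filter_upwards [h] with x hx
      by_contra! hx'
      refine (Real.sin_pos_of_pos_of_lt_pi ?_ ?_).ne' hx
      · exact mul_pos hpi0 ((cdfFn_nonneg μ x).lt_of_ne' hx'.1)
      · exact mul_lt_of_lt_one_right hpi0 ((cdfFn_le_one μ x).lt_of_ne hx'.2))
    exact hnondeg c hc
  have hbound (n : ℕ) : ‖(aa (n + 1) : ℂ)‖ ≤ 2 / π * ∫ x, |Real.sin (T x)| := by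
    have hn : (0 : ℝ) < (n + 1 : ℕ) := by positivity
    have hle : |∫ x, Real.sin ((n + 1 : ℕ) * T x)| ≤
        (n + 1 : ℕ) * ∫ x, |Real.sin (T x)| := by
      rw [← integral_const_mul]
      refine abs_integral_le_integral_abs.trans (integral_mono (hi (n + 1)).abs ?_ fun x =>
        abs_sin_nat_mul_le _ _)
      simpa using (hi 1).abs.const_mul ((n + 1 : ℕ) : ℝ)
    have habs := congrArg abs (hb n)
    rw [abs_mul, abs_mul, abs_neg, abs_of_pos hn, abs_of_pos (by positivity : 0 < 2 / π)] at habs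
    rw [Complex.norm_real, Real.norm_eq_abs]
    refine le_of_mul_le_mul_left ?_ hn
    calc _ = _ := habs
      _ ≤ 2 / π * ((n + 1 : ℕ) * ∫ x, |Real.sin (T x)|) := by gcongr
      _ = _ := by ring
  refine ⟨fun z hz => summable_coeff_mul_pow_succ hbound (mem_ball_zero_iff.mp hz),
    injOn_ball_of_re_one_sub_sq_mul_deriv_neg
      (fun z hz => hasDerivAt_tsum_coeff_mul_pow_succ hbound (mem_ball_zero_iff.mp hz))
      fun z hz => ?_⟩
  have := re_one_sub_sq_mul_tsum_neg hT h0 hpi hi hne hb (mem_ball_zero_iff.mp hz)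
  simpa only [Complex.ofReal_mul, Complex.ofReal_natCast] using this
end

section
/- Let p > 1. There exists a constant λ_p > 0 such that for every 2π-periodic function f with ∫_{−π}^{π} |f(θ)|^p dθ < ∞, the principal-value limit H{f}(x) = lim_{η→0⁺} (1/(2π)) ∫_{η ≤ |t| ≤ π} f(x−t) cot(t/2) dt exists for almost every x ∈ (−π,π), and ( ∫_{−π}^{π} |H{f}(θ)|^p dθ )^{1/p} ≤ λ_p ( ∫_{−π}^{π} |f(θ)|^p dθ )^{1/p}. -/
open MeasureTheory Filter Set
open scoped Real

open scoped Topology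

/-- Lebesgue measure on the fundamental period `(-π, π]`. -/
noncomputable abbrev periodMeasure : Measure ℝ := volume.restrict (Ioc (-π) π)

/-- The Poisson kernel of the unit disc at radius `r`, as a function of the angle. -/
noncomputable def poissonKer (r t : ℝ) : ℝ := (1 - r ^ 2) / (1 - 2 * r * Real.cos t + r ^ 2)

/-- The conjugate Poisson kernel of the unit disc at radius `r`, as a function of the angle. -/
noncomputable def conjPoissonKer (r t : ℝ) : ℝ :=
  2 * r * Real.sin t / (1 - 2 * r * Real.cos t + r ^ 2)

/-- The Poisson integral of `f`. -/
noncomputable def poissonInt (f : ℝ → ℝ) (r x : ℝ) : ℝ :=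
  (2 * π)⁻¹ * ∫ θ, poissonKer r (x - θ) * f θ ∂periodMeasure

/-- The conjugate Poisson integral of `f`. -/
noncomputable def conjPoissonInt (f : ℝ → ℝ) (r x : ℝ) : ℝ :=
  (2 * π)⁻¹ * ∫ θ, conjPoissonKer r (x - θ) * f θ ∂periodMeasure

/-- The Herglotz integral of `f`, a holomorphic function on the unit disc. -/
noncomputable def herglotzInt (f : ℝ → ℝ) (z : ℂ) : ℂ :=
  Real.circleAverage (fun ζ ↦ herglotzRieszKernel 0 z ζ • ((f ζ.arg : ℝ) : ℂ)) 0 1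

lemma poissonKer_denom_pos {r : ℝ} (h0 : 0 ≤ r) (h1 : r < 1) (t : ℝ) :
    0 < 1 - 2 * r * Real.cos t + r ^ 2 := by
  nlinarith [Real.cos_le_one t, mul_nonneg h0 (sub_nonneg.2 (Real.cos_le_one t)),
    sq_pos_of_pos (sub_pos.2 h1)]

lemma poissonKer_nonneg {r : ℝ} (h0 : 0 ≤ r) (h1 : r < 1) (t : ℝ) : 0 ≤ poissonKer r t :=
  div_nonneg (by nlinarith) (poissonKer_denom_pos h0 h1 t).le

lemma poissonKer_pos {r : ℝ} (h0 : 0 ≤ r) (h1 : r < 1) (t : ℝ) : 0 < poissonKer r t :=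
  div_pos (by nlinarith) (poissonKer_denom_pos h0 h1 t)

lemma continuous_poissonKer {r : ℝ} (h0 : 0 ≤ r) (h1 : r < 1) : Continuous (poissonKer r) := by
  unfold poissonKer
  exact Continuous.div (by fun_prop) (by fun_prop) fun t ↦ (poissonKer_denom_pos h0 h1 t).ne'

lemma continuous_conjPoissonKer {r : ℝ} (h0 : 0 ≤ r) (h1 : r < 1) :
    Continuous (conjPoissonKer r) := by
  unfold conjPoissonKer
  exact Continuous.div (by fun_prop) (by fun_prop) fun t ↦ (poissonKer_denom_pos h0 h1 t).ne'

lemma poissonKer_neg (r t : ℝ) : poissonKer r (-t) = poissonKer r t := by simp [poissonKer]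

lemma conjPoissonKer_neg (r t : ℝ) : conjPoissonKer r (-t) = -conjPoissonKer r t := by
  simp [conjPoissonKer, neg_div]

lemma poissonKer_periodic (r : ℝ) : Function.Periodic (poissonKer r) (2 * π) := by
  intro t; simp [poissonKer]

lemma conjPoissonKer_periodic (r : ℝ) : Function.Periodic (conjPoissonKer r) (2 * π) := by
  intro t; simp [conjPoissonKer]

lemma integral_periodMeasure {E : Type*} [NormedAddCommGroup E] [NormedSpace ℝ E] (g : ℝ → E) :
    ∫ θ, g θ ∂periodMeasure = ∫ θ in (-π)..π, g θ := by
  rw [intervalIntegral.integral_of_le (by linarith [Real.pi_pos])]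

lemma circleAverage_eq_integral_periodMeasure {E : Type*} [NormedAddCommGroup E] [NormedSpace ℝ E]
    (g : ℂ → E) (R : ℝ) :
    Real.circleAverage g 0 R = (2 * π)⁻¹ • ∫ θ, g (circleMap 0 R θ) ∂periodMeasure := by
  rw [Real.circleAverage_eq_integral_add (-π), integral_periodMeasure]
  congr 1
  rw [intervalIntegral.integral_comp_add_right (fun θ ↦ g (circleMap 0 R θ))]
  congr 1 <;> ring

lemma arg_circleMap {θ : ℝ} (h : θ ∈ Ioc (-π) π) : (circleMap 0 1 θ).arg = θ := by
  rw [circleMap_zero, Complex.arg_real_mul _ one_pos, Complex.arg_exp_mul_I]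
  exact (toIocMod_eq_self _).2 (by convert h using 1; congr 1; ring)

lemma circleMap_mem_ball {r : ℝ} (h0 : 0 ≤ r) (h1 : r < 1) (x : ℝ) :
    circleMap 0 r x ∈ Metric.ball (0 : ℂ) 1 := by
  simpa [abs_of_nonneg h0] using h1

lemma herglotzRieszKernel_circleMap {r : ℝ} (h0 : 0 ≤ r) (h1 : r < 1) (x θ : ℝ) :
    herglotzRieszKernel 0 (circleMap 0 r x) (circleMap 0 1 θ) =
      poissonKer r (x - θ) + conjPoissonKer r (x - θ) * Complex.I := by
  have hD := (poissonKer_denom_pos h0 h1 (x - θ)).ne'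
  have hDc : (1 - 2 * r * Complex.cos (x - θ) + r ^ 2 : ℂ) ≠ 0 := by
    exact_mod_cast hD
  have hne : circleMap 0 1 θ - circleMap 0 r x ≠ 0 := by
    intro h
    have := congrArg norm (sub_eq_zero.1 h)
    simp [abs_of_nonneg h0] at this
    linarith
  rw [herglotzRieszKernel_def, sub_zero, sub_zero, div_eq_iff hne]
  simp only [poissonKer, conjPoissonKer]
  push_cast
  rw [div_mul_eq_mul_div, ← add_div, div_mul_eq_mul_div, eq_div_iff hDc]
  simp only [circleMap_zero, Complex.exp_mul_I, Complex.cos_sub, Complex.sin_sub]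
  have e1 := Complex.sin_sq_add_cos_sq (x : ℂ)
  have e2 := Complex.sin_sq_add_cos_sq (θ : ℂ)
  have e3 := Complex.I_sq
  clear hDc hD hne
  generalize Complex.cos x = a at *
  generalize Complex.sin x = b at *
  generalize Complex.cos θ = c at *
  generalize Complex.sin θ = d at *
  generalize Complex.I = i at *
  push_cast
  grind

lemma integrable_arg_circleMap {f : ℝ → ℝ} (hf : Integrable f periodMeasure) :
    CircleIntegrable (fun ζ ↦ ((f ζ.arg : ℝ) : ℂ)) 0 1 := by
  have h : IntervalIntegrable (fun θ ↦ ((f (circleMap 0 1 θ).arg : ℝ) : ℂ)) volume (-π)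
      (-π + 2 * π) := by
    rw [intervalIntegrable_iff_integrableOn_Ioc_of_le (by linarith [Real.pi_pos])]
    rw [show -π + 2 * π = π by ring]
    refine (hf.ofReal (𝕜 := ℂ)).congr ?_
    filter_upwards [ae_restrict_mem measurableSet_Ioc] with θ hθ
    simp [arg_circleMap hθ]
  have hper : Function.Periodic (fun θ ↦ ((f (circleMap 0 1 θ).arg : ℝ) : ℂ)) (2 * π) := by
    intro θ; simp only [periodic_circleMap 0 1 θ]
  exact hper.intervalIntegrable (by positivity) h 0 (2*π)

lemma differentiableOn_herglotzInt {f : ℝ → ℝ} (hf : Integrable f periodMeasure) :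
    DifferentiableOn ℂ (herglotzInt f) (Metric.ball 0 1) := fun _ hw ↦
  (hasDerivAt_circleAverage_herglotzRieszKernel_smul (integrable_arg_circleMap hf)
    hw).differentiableAt.differentiableWithinAt

lemma integrable_continuous_mul {E : Type*} [NormedAddCommGroup E] [NormedSpace ℝ E] {f : ℝ → E}
    (hf : Integrable f periodMeasure) {k : ℝ → ℝ} (hk : Continuous k) :
    Integrable (fun θ ↦ k θ • f θ) periodMeasure := by
  obtain ⟨C, hC⟩ := isCompact_Icc.exists_bound_of_continuousOn (s := Icc (-π) π) hk.continuousOn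
  refine Integrable.bdd_smul hf C hk.aestronglyMeasurable ?_
  filter_upwards [ae_restrict_mem measurableSet_Ioc] with θ hθ
  exact hC θ (Ioc_subset_Icc_self hθ)

lemma herglotzInt_circleMap {f : ℝ → ℝ} (hf : Integrable f periodMeasure) {r : ℝ} (h0 : 0 ≤ r)
    (h1 : r < 1) (x : ℝ) :
    herglotzInt f (circleMap 0 r x) = poissonInt f r x + conjPoissonInt f r x * Complex.I := by
  have hP := integrable_continuous_mul hf
    ((continuous_poissonKer h0 h1).comp
      (continuous_const.sub continuous_id : Continuous fun θ ↦ x - θ))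
  have hQ := integrable_continuous_mul hf
    ((continuous_conjPoissonKer h0 h1).comp
      (continuous_const.sub continuous_id : Continuous fun θ ↦ x - θ))
  simp only [Function.comp_def, smul_eq_mul] at hP hQ
  rw [herglotzInt, circleAverage_eq_integral_periodMeasure, poissonInt, conjPoissonInt]
  have : ∫ θ, herglotzRieszKernel 0 (circleMap 0 r x) (circleMap 0 1 θ) •
        ((f (circleMap 0 1 θ).arg : ℝ) : ℂ) ∂periodMeasure =
      ∫ θ, (((poissonKer r (x - θ) * f θ : ℝ) : ℂ) +
        ((conjPoissonKer r (x - θ) * f θ : ℝ) : ℂ) * Complex.I) ∂periodMeasure := by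
    refine integral_congr_ae ?_
    filter_upwards [ae_restrict_mem measurableSet_Ioc] with θ hθ
    rw [arg_circleMap hθ, herglotzRieszKernel_circleMap h0 h1, smul_eq_mul]
    push_cast; ring
  rw [this, integral_add hP.ofReal (hQ.ofReal.mul_const _), integral_mul_const,
    integral_complex_ofReal, integral_complex_ofReal, Complex.real_smul]
  push_cast; ring

lemma herglotzInt_zero (f : ℝ → ℝ) :
    herglotzInt f 0 = ((2 * π)⁻¹ * ∫ θ, f θ ∂periodMeasure : ℝ) := by
  rw [herglotzInt, circleAverage_eq_integral_periodMeasure]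
  have : ∫ θ, herglotzRieszKernel 0 0 (circleMap 0 1 θ) •
        ((f (circleMap 0 1 θ).arg : ℝ) : ℂ) ∂periodMeasure =
          ∫ θ, ((f θ : ℝ) : ℂ) ∂periodMeasure := by
    refine integral_congr_ae ?_
    filter_upwards [ae_restrict_mem measurableSet_Ioc] with θ hθ
    rw [arg_circleMap hθ, herglotzRieszKernel_def]
    simp
  rw [this, integral_complex_ofReal, Complex.real_smul]
  push_cast; ring

lemma integral_poissonKer {r : ℝ} (h0 : 0 ≤ r) (h1 : r < 1) (x : ℝ) :
    ∫ θ, poissonKer r (x - θ) ∂periodMeasure = 2 * π := by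
  have h := (diffContOnCl_const (𝕜 := ℂ) (c := (1 : ℂ))).circleAverage_re_herglotzRieszKernel_smul
    (R := 1) (circleMap_mem_ball h0 h1 x)
  rw [circleAverage_eq_integral_periodMeasure] at h
  simp only [Pi.smul_apply', Function.comp_apply, herglotzRieszKernel_circleMap h0 h1] at h
  simp at h
  rw [integral_complex_ofReal] at h
  have h' : π⁻¹ * 2⁻¹ * ∫ θ, poissonKer r (x - θ) ∂periodMeasure = 1 := by
    refine Complex.ofReal_injective ?_
    simpa only [Complex.ofReal_mul, Complex.ofReal_inv, Complex.ofReal_ofNat, Complex.ofReal_one]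
      using h
  have := Real.pi_pos
  field_simp at h'
  linarith

lemma Function.Periodic.integral_sub_periodMeasure {E : Type*} [NormedAddCommGroup E]
    [NormedSpace ℝ E] {h : ℝ → E} (hh : Function.Periodic h (2 * π)) (x : ℝ) :
    ∫ t, h (x - t) ∂periodMeasure = ∫ t, h t ∂periodMeasure := by
  rw [integral_periodMeasure, integral_periodMeasure, intervalIntegral.integral_comp_sub_left]
  have := hh.intervalIntegral_add_eq (x - π) (-π)
  convert this using 2 <;> ring

lemma Function.Periodic.intervalIntegrable_of_periodMeasure {E : Type*} [NormedAddCommGroup E]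
    {f : ℝ → E} (hp : Function.Periodic f (2 * π)) (hf : Integrable f periodMeasure) (a b : ℝ) :
    IntervalIntegrable f volume a b := by
  refine hp.intervalIntegrable (t := -π) (by positivity) ?_ a b
  rw [intervalIntegrable_iff_integrableOn_Ioc_of_le (by linarith [Real.pi_pos])]
  rwa [show -π + 2 * π = π by ring]

lemma Function.Periodic.integrable_sub_periodMeasure {E : Type*} [NormedAddCommGroup E]
    {f : ℝ → E} (hp : Function.Periodic f (2 * π)) (hf : Integrable f periodMeasure) (x : ℝ) :
    Integrable (fun t ↦ f (x - t)) periodMeasure := by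
  have h := (hp.intervalIntegrable_of_periodMeasure hf (x + π) (x - π)).comp_sub_left x
  rw [sub_add_cancel_left, sub_sub_cancel] at h
  exact (intervalIntegrable_iff_integrableOn_Ioc_of_le (by linarith [Real.pi_pos])).1 h

/-- `x` is a Lebesgue point of `f`. -/
def IsLebesguePt {E : Type*} [NormedAddCommGroup E] (f : ℝ → E) (x : ℝ) : Prop :=
  Tendsto (fun h : ℝ ↦ h⁻¹ * ∫ t in Icc (-h) h, ‖f (x - t) - f x‖) (𝓝[>] 0) (𝓝 0)

lemma ae_isLebesguePt {E : Type*} [NormedAddCommGroup E] {f : ℝ → E}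
    (hf : ∀ a b, IntervalIntegrable f volume a b) : ∀ᵐ x, IsLebesguePt f x := by
  have hloc : LocallyIntegrable f volume := fun x ↦
    ⟨Ioc (x - 1) (x + 1), Ioc_mem_nhds (by linarith) (by linarith),
      (intervalIntegrable_iff_integrableOn_Ioc_of_le (by linarith)).1 (hf _ _)⟩
  filter_upwards [IsUnifLocDoublingMeasure.ae_tendsto_average_norm_sub volume hloc 1] with x hx
  have h := hx (l := 𝓝[>] (0 : ℝ)) (fun _ ↦ x) (fun h ↦ h) tendsto_id (by
    filter_upwards [self_mem_nhdsWithin] with j hj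
    simpa using (le_of_lt hj : (0 : ℝ) ≤ j))
  have h2 := h.const_mul 2
  rw [mul_zero] at h2
  refine h2.congr' ?_
  filter_upwards [self_mem_nhdsWithin] with j hj
  have hj' : (0 : ℝ) < j := hj
  rw [setAverage_eq, Real.closedBall_eq_Icc, Measure.real, Real.volume_Icc,
    ENNReal.toReal_ofReal (by linarith), integral_Icc_eq_integral_Ioc, integral_Icc_eq_integral_Ioc,
    ← intervalIntegral.integral_of_le (by linarith),
    ← intervalIntegral.integral_of_le (by linarith),
    intervalIntegral.integral_comp_sub_left (fun y ↦ ‖f y - f x‖), smul_eq_mul, sub_neg_eq_add]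
  rw [add_comm x j, show x - j = -j + x by ring, show j + x = x + j by ring]
  field_simp
  ring_nf
  field_simp

lemma div_sq_add_sq_le_dyadic {η : ℝ} (hη : 0 < η) (t : ℝ) :
    ∃ k : ℕ, |t| ≤ 2 ^ k * η ∧ η / (η ^ 2 + t ^ 2) ≤ 4 * (1 / 4) ^ k / η := by
  by_cases h : |t| ≤ η
  · refine ⟨0, by simpa, ?_⟩
    rw [div_le_div_iff₀ (by positivity) hη]
    nlinarith [sq_nonneg t]
  · push Not at h
    obtain ⟨n, h1, h2⟩ := exists_nat_pow_near (x := |t| / η) (y := 2)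
      (by rw [le_div_iff₀ hη]; linarith) (by norm_num)
    rw [le_div_iff₀ hη] at h1
    rw [div_lt_iff₀ hη] at h2
    refine ⟨n + 1, h2.le, ?_⟩
    rw [div_le_div_iff₀ (by positivity) hη]
    have h3 : (2 ^ n * η) ^ 2 ≤ t ^ 2 := by
      rw [← sq_abs t]; exact pow_le_pow_left₀ (by positivity) h1 2
    have h4 : (1 / 4 : ℝ) ^ n * (2 ^ n) ^ 2 = 1 := by
      rw [← pow_mul, mul_comm n 2, pow_mul, ← mul_pow]; norm_num
    calc η * η = ((1 / 4 : ℝ) ^ n * (2 ^ n) ^ 2) * η ^ 2 := by rw [h4]; ring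
      _ = (1 / 4 : ℝ) ^ n * (2 ^ n * η) ^ 2 := by ring
      _ ≤ (1 / 4 : ℝ) ^ n * (η ^ 2 + t ^ 2) := by gcongr; nlinarith [sq_nonneg η]
      _ = _ := by rw [pow_succ]; ring

lemma tendsto_integral_mul_div_sq_add_sq {μ : Measure ℝ} {φ : ℝ → ℝ} (h0 : ∀ t, 0 ≤ φ t)
    (hφ : Integrable φ μ)
    (hlim : Tendsto (fun h : ℝ ↦ h⁻¹ * ∫ t in Icc (-h) h, φ t ∂μ) (𝓝[>] 0) (𝓝 0)) :
    Tendsto (fun η : ℝ ↦ ∫ t, φ t * (η / (η ^ 2 + t ^ 2)) ∂μ) (𝓝[>] 0) (𝓝 0) := by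
  set A : ℝ → ℝ := fun h ↦ h⁻¹ * ∫ t in Icc (-h) h, φ t ∂μ with hA
  have hA0 : ∀ h, 0 < h → 0 ≤ A h := fun h hh ↦
    mul_nonneg (by positivity) (integral_nonneg h0)
  obtain ⟨M, hM⟩ : ∃ M, ∀ h, 0 < h → A h ≤ M := by
    have h1 : ∀ᶠ h in 𝓝[>] (0 : ℝ), A h < 1 := hlim.eventually (gt_mem_nhds one_pos)
    obtain ⟨δ, hδ, hδ1⟩ := mem_nhdsGT_iff_exists_Ioo_subset.1 h1
    have hδ' : (0 : ℝ) < δ := hδ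
    refine ⟨1 + δ⁻¹ * ∫ t, φ t ∂μ, fun h hh ↦ ?_⟩
    have hI : 0 ≤ ∫ t, φ t ∂μ := integral_nonneg h0
    by_cases hc : h < δ
    · have : A h < 1 := hδ1 ⟨hh, hc⟩
      have : 0 ≤ δ⁻¹ * ∫ t, φ t ∂μ := by positivity
      linarith
    · push Not at hc
      have : A h ≤ δ⁻¹ * ∫ t, φ t ∂μ := by
        refine mul_le_mul (inv_anti₀ hδ' hc) (setIntegral_le_integral hφ (ae_of_all _ h0))
          (integral_nonneg h0) (by positivity)
      linarith
  set b : ℝ → ℕ → ℝ := fun η k ↦ 4 * (1 / 2) ^ k * A (2 ^ k * η) with hb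
  have hbs : Summable fun k : ℕ ↦ 4 * (1 / 2 : ℝ) ^ k * M :=
    (summable_geometric_two.mul_left 4).mul_right M
  have hbM : ∀ η > 0, ∀ k, ‖b η k‖ ≤ 4 * (1 / 2 : ℝ) ^ k * M := fun η hη k ↦ by
    have := hA0 (2 ^ k * η) (by positivity)
    rw [Real.norm_of_nonneg (by positivity)]
    exact mul_le_mul_of_nonneg_left (hM (2 ^ k * η) (by positivity)) (by positivity)
  have hsum : Tendsto (fun η : ℝ ↦ ∑' k, b η k) (𝓝[>] 0) (𝓝 (∑' _ : ℕ, 0)) := by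
    refine tendsto_tsum_of_dominated_convergence hbs (fun k ↦ ?_) ?_
    · have : Tendsto (fun η : ℝ ↦ (2 : ℝ) ^ k * η) (𝓝[>] 0) (𝓝[>] 0) := by
        refine tendsto_nhdsWithin_iff.2 ⟨?_, ?_⟩
        · have : Tendsto (fun η : ℝ ↦ (2 : ℝ) ^ k * η) (𝓝 0) (𝓝 (2 ^ k * 0)) :=
            (continuous_const.mul continuous_id).tendsto 0
          rw [mul_zero] at this
          exact this.mono_left nhdsWithin_le_nhds
        · filter_upwards [self_mem_nhdsWithin] with η hη
          have : (0 : ℝ) < η := hη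
          exact mem_Ioi.2 (by positivity)
      have h := (hlim.comp this).const_mul (4 * (1 / 2 : ℝ) ^ k)
      rwa [mul_zero] at h
    · filter_upwards [self_mem_nhdsWithin] with η hη using hbM η hη
  rw [tsum_zero] at hsum
  refine squeeze_zero' ?_ ?_ hsum
  · filter_upwards [self_mem_nhdsWithin] with η hη
    have : (0 : ℝ) < η := hη
    exact integral_nonneg fun t ↦ mul_nonneg (h0 t) (by positivity)
  · filter_upwards [self_mem_nhdsWithin] with η hη
    have hη' : (0 : ℝ) < η := hη
    have hbsη : Summable (b η) := Summable.of_norm_bounded hbs (hbM η hη)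
    have hb0 : ∀ k, 0 ≤ b η k := fun k ↦ by
      have := hA0 (2 ^ k * η) (by positivity)
      positivity
    set F : ℕ → ℝ → ℝ := fun k ↦ (Icc (-(2 ^ k * η)) (2 ^ k * η)).indicator
      (fun t ↦ 4 * (1 / 4) ^ k / η * φ t) with hF
    have hF0 : ∀ k t, 0 ≤ F k t := fun k t ↦ indicator_nonneg (fun t _ ↦ by
      have := h0 t; positivity) t
    have hFi : ∀ k, Integrable (F k) μ := fun k ↦
      (hφ.const_mul _).indicator measurableSet_Icc
    have hFint : ∀ k, ∫ t, F k t ∂μ = b η k := fun k ↦ by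
      rw [integral_indicator measurableSet_Icc, integral_const_mul]
      simp only [hb, hA]
      have h4 : (1 / 4 : ℝ) ^ k * 2 ^ k = (1 / 2) ^ k := by rw [← mul_pow]; norm_num
      rw [← h4]
      field_simp
    rw [integral_eq_lintegral_of_nonneg_ae
      (ae_of_all _ fun t ↦ mul_nonneg (h0 t) (by positivity))
      (hφ.aestronglyMeasurable.mul
        (by fun_prop : Measurable fun t : ℝ ↦ η / (η ^ 2 + t ^ 2)).aestronglyMeasurable)]
    refine ENNReal.toReal_le_of_le_ofReal (tsum_nonneg hb0) ?_
    rw [ENNReal.ofReal_tsum_of_nonneg hb0 hbsη]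
    calc ∫⁻ t, ENNReal.ofReal (φ t * (η / (η ^ 2 + t ^ 2))) ∂μ
        ≤ ∫⁻ t, ∑' k, ENNReal.ofReal (F k t) ∂μ := by
          refine lintegral_mono fun t ↦ ?_
          obtain ⟨k, hk1, hk2⟩ := div_sq_add_sq_le_dyadic hη' t
          refine le_trans ?_ (ENNReal.le_tsum k)
          refine ENNReal.ofReal_le_ofReal ?_
          simp only [hF]
          rw [indicator_of_mem (mem_Icc.2 (abs_le.1 hk1)), mul_comm]
          exact mul_le_mul_of_nonneg_right hk2 (h0 t)
      _ = ∑' k, ∫⁻ t, ENNReal.ofReal (F k t) ∂μ :=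
          lintegral_tsum fun k ↦ (hFi k).aestronglyMeasurable.aemeasurable.ennreal_ofReal
      _ = ∑' k, ENNReal.ofReal (b η k) := by
          congr 1; ext k
          rw [← ofReal_integral_eq_lintegral_ofReal (hFi k) (ae_of_all _ (hF0 k)), hFint]

lemma IsLebesguePt.tendsto_integral_kernel {E : Type*} [NormedAddCommGroup E] [NormedSpace ℝ E]
    {f : ℝ → E} (hp : Function.Periodic f (2 * π)) (hf : Integrable f periodMeasure) {x : ℝ}
    (hx : IsLebesguePt f x) {K : ℝ → ℝ → ℝ} {C : ℝ}
    (hK : ∀ᶠ η in 𝓝[>] 0, ∀ t ∈ Ioc (-π) π, |K η t| ≤ C * (η / (η ^ 2 + t ^ 2))) :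
    Tendsto (fun η ↦ ∫ t, K η t • (f (x - t) - f x) ∂periodMeasure) (𝓝[>] 0) (𝓝 0) := by
  have hint : Integrable (fun t ↦ ‖f (x - t) - f x‖) periodMeasure :=
    ((hp.integrable_sub_periodMeasure hf x).sub (integrable_const _)).norm
  have hlim : Tendsto (fun h : ℝ ↦ h⁻¹ * ∫ t in Icc (-h) h, ‖f (x - t) - f x‖ ∂periodMeasure)
      (𝓝[>] 0) (𝓝 0) := by
    refine Tendsto.congr' ?_ hx
    filter_upwards [Ioo_mem_nhdsGT Real.pi_pos] with h hh
    rw [periodMeasure, Measure.restrict_restrict measurableSet_Icc, inter_eq_left.2]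
    exact fun t ht ↦ ⟨by linarith [ht.1, hh.2], by linarith [ht.2, hh.2]⟩
  have h := (tendsto_integral_mul_div_sq_add_sq (fun _ ↦ norm_nonneg _) hint hlim).const_mul C
  rw [mul_zero] at h
  refine squeeze_zero_norm' ?_ h
  filter_upwards [hK, self_mem_nhdsWithin] with η hη hη0
  have hη0' : (0 : ℝ) < η := hη0
  rw [← integral_const_mul]
  refine norm_integral_le_of_norm_le
    (Integrable.const_mul (hint.mul_bdd (c := η / η ^ 2) ?_ ?_) _) ?_
  · exact (by fun_prop : Measurable fun t : ℝ ↦ η / (η ^ 2 + t ^ 2)).aestronglyMeasurable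
  · refine ae_of_all _ fun t ↦ ?_
    rw [Real.norm_of_nonneg (by positivity)]
    gcongr
    nlinarith [sq_nonneg t]
  · filter_upwards [ae_restrict_mem measurableSet_Ioc] with t ht
    rw [norm_smul, mul_comm (‖f (x - t) - f x‖), ← mul_assoc]
    exact mul_le_mul_of_nonneg_right (hη t ht) (norm_nonneg _)

lemma abs_le_pi_mul_abs_sin_half {t : ℝ} (ht : |t| ≤ π) : |t| ≤ π * |Real.sin (t / 2)| := by
  have h := Real.mul_abs_le_abs_sin (x := t / 2) (by rw [abs_div, abs_two]; linarith)
  rw [abs_div, abs_two] at h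
  have := Real.pi_pos
  field_simp at h
  linarith

lemma poissonKer_denom_eq (r t : ℝ) :
    1 - 2 * r * Real.cos t + r ^ 2 = (1 - r) ^ 2 + 4 * r * Real.sin (t / 2) ^ 2 := by
  have : Real.cos t = 1 - 2 * Real.sin (t / 2) ^ 2 := by
    have := Real.cos_two_mul (t / 2)
    rw [mul_div_cancel₀ _ (two_ne_zero)] at this
    rw [this, Real.cos_sq']; ring
  rw [this]; ring

lemma sq_add_sq_le_poissonKer_denom {η t : ℝ} (h1 : η < 1 / 2) (ht : |t| ≤ π) :
    η ^ 2 + t ^ 2 ≤ 5 * (1 - 2 * (1 - η) * Real.cos t + (1 - η) ^ 2) := by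
  rw [poissonKer_denom_eq]
  have h2 := abs_le_pi_mul_abs_sin_half ht
  have h3 : t ^ 2 ≤ π ^ 2 * Real.sin (t / 2) ^ 2 := by
    rw [← sq_abs t, ← sq_abs (Real.sin _), ← mul_pow]
    exact pow_le_pow_left₀ (abs_nonneg _) h2 2
  have h4 : π ^ 2 ≤ 10 := by nlinarith [Real.pi_lt_d2, Real.pi_pos]
  nlinarith [sq_nonneg (Real.sin (t / 2)), sq_nonneg η]

lemma poissonKer_le {η t : ℝ} (h0 : 0 < η) (h1 : η < 1 / 2) (ht : |t| ≤ π) :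
    |poissonKer (1 - η) t| ≤ 10 * (η / (η ^ 2 + t ^ 2)) := by
  rw [abs_of_nonneg (poissonKer_nonneg (by linarith) (by linarith) t), poissonKer, ← mul_div_assoc,
    div_le_div_iff₀ (poissonKer_denom_pos (by linarith) (by linarith) t) (by positivity)]
  have := sq_add_sq_le_poissonKer_denom h1 ht
  nlinarith [mul_nonneg h0.le (sub_nonneg.2 this),
    mul_nonneg (sq_nonneg η) (by positivity : 0 ≤ η ^ 2 + t ^ 2)]

/-- The kernel of the truncated Hilbert transform. -/
noncomputable def truncCot (η t : ℝ) : ℝ :=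
  {t : ℝ | η ≤ |t| ∧ |t| ≤ π}.indicator (fun t ↦ Real.cos (t / 2) / Real.sin (t / 2)) t

lemma truncCot_neg (η t : ℝ) : truncCot η (-t) = -truncCot η t := by
  simp only [truncCot, indicator_apply, mem_ofPred_eq, abs_neg, neg_div, Real.cos_neg, Real.sin_neg,
    div_neg]
  split_ifs <;> simp

lemma measurableSet_trunc (η : ℝ) : MeasurableSet {t : ℝ | η ≤ |t| ∧ |t| ≤ π} :=
  (measurableSet_le measurable_const measurable_id.abs).inter
    (measurableSet_le measurable_id.abs measurable_const)

lemma measurable_truncCot (η : ℝ) : Measurable (truncCot η) :=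
  Measurable.indicator (by fun_prop) (measurableSet_trunc η)

lemma conjPoissonKer_sub_truncCot_le {η t : ℝ} (h0 : 0 < η) (h1 : η < 1 / 2) (ht : |t| ≤ π) :
    |conjPoissonKer (1 - η) t - truncCot η t| ≤ 20 * (η / (η ^ 2 + t ^ 2)) := by
  have hD := poissonKer_denom_pos (r := 1 - η) (by linarith) (by linarith) t
  have hD5 := sq_add_sq_le_poissonKer_denom h1 ht
  have hpos : 0 < η ^ 2 + t ^ 2 := by positivity
  rw [← mul_div_assoc]
  by_cases hc : η ≤ |t|
  · have ht0 : 0 < |t| := h0.trans_le hc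
    have hs := abs_le_pi_mul_abs_sin_half ht
    have hs0 : Real.sin (t / 2) ≠ 0 := by
      intro h; rw [h] at hs; simp at hs; simp [hs] at ht0
    have hkey : conjPoissonKer (1 - η) t - truncCot η t =
        -(η ^ 2 * Real.cos (t / 2) / (Real.sin (t / 2) *
          (1 - 2 * (1 - η) * Real.cos t + (1 - η) ^ 2))) := by
      have e1 : Real.sin t = 2 * Real.sin (t / 2) * Real.cos (t / 2) := by
        rw [← Real.sin_two_mul]; congr 1; ring
      have e2 : Real.cos t = 1 - 2 * Real.sin (t / 2) ^ 2 := by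
        have := Real.cos_two_mul (t / 2)
        rw [mul_div_cancel₀ _ (two_ne_zero)] at this
        rw [this, Real.cos_sq']; ring
      rw [truncCot, indicator_of_mem (show t ∈ {t : ℝ | η ≤ |t| ∧ |t| ≤ π} from ⟨hc, ht⟩),
        conjPoissonKer]
      have hD' := hD.ne'
      field_simp
      rw [e1, e2]
      ring
    rw [hkey, abs_neg, abs_div, abs_mul, abs_mul, abs_of_pos hD, abs_of_nonneg (sq_nonneg η),
      div_le_div_iff₀ (mul_pos (abs_pos.2 hs0) hD) hpos]
    have hs' : η ≤ 4 * |Real.sin (t / 2)| := by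
      nlinarith [Real.pi_lt_four, abs_nonneg (Real.sin (t / 2))]
    have hcos := Real.abs_cos_le_one (t / 2)
    calc η ^ 2 * |Real.cos (t / 2)| * (η ^ 2 + t ^ 2)
        ≤ η ^ 2 * 1 * (5 * (1 - 2 * (1 - η) * Real.cos t + (1 - η) ^ 2)) := by gcongr
      _ = 5 * η * (η * (1 - 2 * (1 - η) * Real.cos t + (1 - η) ^ 2)) := by ring
      _ ≤ 5 * η * (4 * |Real.sin (t / 2)| *
          (1 - 2 * (1 - η) * Real.cos t + (1 - η) ^ 2)) := by gcongr
      _ = _ := by ring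
  · push Not at hc
    rw [truncCot, indicator_of_notMem (fun h ↦ by linarith [h.1]), sub_zero, conjPoissonKer,
      abs_div, abs_of_pos hD, div_le_div_iff₀ hD hpos, abs_mul, abs_mul, abs_two,
      abs_of_pos (by linarith : 0 < 1 - η)]
    have h3 : |Real.sin t| ≤ η := Real.abs_sin_le_abs.trans hc.le
    have h4 : 2 * (1 - η) * |Real.sin t| ≤ 2 * η := by nlinarith [abs_nonneg (Real.sin t)]
    calc _ ≤ 2 * η * (5 * (1 - 2 * (1 - η) * Real.cos t + (1 - η) ^ 2)) := by gcongr
      _ ≤ _ := by nlinarith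

lemma integral_periodMeasure_of_odd {k : ℝ → ℝ} (hk : ∀ t, k (-t) = -k t) :
    ∫ t, k t ∂periodMeasure = 0 := by
  rw [integral_periodMeasure]
  have h := intervalIntegral.integral_comp_neg (a := -π) (b := π) k
  simp only [hk, intervalIntegral.integral_neg, neg_neg] at h
  linarith

lemma pvH_eq (f : ℝ → ℝ) (x η : ℝ) :
    pvH f x η = (2 * π)⁻¹ * ∫ t, truncCot η t * f (x - t) ∂periodMeasure := by
  rw [pvH, one_div]
  congr 1
  have h1 : (fun t ↦ truncCot η t * f (x - t)) = {t : ℝ | η ≤ |t| ∧ |t| ≤ π}.indicator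
      (fun t ↦ f (x - t) * (Real.cos (t / 2) / Real.sin (t / 2))) := by
    ext t
    simp only [truncCot, indicator_apply]
    split_ifs <;> ring
  rw [h1, setIntegral_indicator (measurableSet_trunc η)]
  refine setIntegral_congr_set ?_
  have h2 : (Ioc (-π) π : Set ℝ) =ᵐ[volume] Icc (-π) π := Ioc_ae_eq_Icc
  refine ((h2.inter (ae_eq_refl {t : ℝ | η ≤ |t| ∧ |t| ≤ π})).trans (Eq.eventuallyEq ?_)).symm
  exact inter_eq_right.2 fun t ht ↦ abs_le.1 ht.2

lemma IsLebesguePt.tendsto_conjPoissonInt_sub_pvH {f : ℝ → ℝ}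
    (hp : Function.Periodic f (2 * π)) (hf : Integrable f periodMeasure) {x : ℝ}
    (hx : IsLebesguePt f x) :
    Tendsto (fun η ↦ conjPoissonInt f (1 - η) x - pvH f x η) (𝓝[>] 0) (𝓝 0) := by
  have hev : ∀ᶠ η in 𝓝[>] (0 : ℝ), η ∈ Ioo (0 : ℝ) (1 / 2) := Ioo_mem_nhdsGT (by norm_num)
  have h := hx.tendsto_integral_kernel hp hf
    (K := fun η t ↦ conjPoissonKer (1 - η) t - truncCot η t)
    (C := 20) (by
      filter_upwards [hev] with η hη t ht
      exact conjPoissonKer_sub_truncCot_le hη.1 hη.2 (abs_le.2 ⟨ht.1.le, ht.2⟩))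
  have h2 := h.const_mul (2 * π)⁻¹
  rw [mul_zero] at h2
  refine h2.congr' ?_
  filter_upwards [hev] with η hη
  have hη0 : 0 < η := hη.1
  have hfx := hp.integrable_sub_periodMeasure hf x
  have hQc := continuous_conjPoissonKer (r := 1 - η) (by linarith [hη.2]) (by linarith [hη.1])
  have hQf : Integrable (fun t ↦ conjPoissonKer (1 - η) t * f (x - t)) periodMeasure :=
    integrable_continuous_mul hfx hQc
  have hbd : ∀ᵐ t ∂periodMeasure,
      ‖conjPoissonKer (1 - η) t - truncCot η t‖ ≤ 20 * (η / η ^ 2) := by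
    filter_upwards [ae_restrict_mem measurableSet_Ioc] with t ht
    refine (conjPoissonKer_sub_truncCot_le hη.1 hη.2 (abs_le.2 ⟨ht.1.le, ht.2⟩)).trans ?_
    gcongr
    nlinarith [sq_nonneg t]
  have hm : AEStronglyMeasurable (fun t ↦ conjPoissonKer (1 - η) t - truncCot η t) periodMeasure :=
    (hQc.measurable.sub (measurable_truncCot η)).aestronglyMeasurable
  have hKf : Integrable (fun t ↦ (conjPoissonKer (1 - η) t - truncCot η t) * f (x - t))
      periodMeasure := hfx.bdd_mul hm hbd
  have hK1 : Integrable (fun t ↦ (conjPoissonKer (1 - η) t - truncCot η t) * f x)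
      periodMeasure := (integrable_const (f x)).bdd_mul hm hbd
  have hCf : Integrable (fun t ↦ truncCot η t * f (x - t)) periodMeasure := by
    refine (hQf.sub hKf).congr (ae_of_all _ fun t ↦ ?_)
    simp only [Pi.sub_apply]; ring
  have hV : conjPoissonInt f (1 - η) x =
      (2 * π)⁻¹ * ∫ t, conjPoissonKer (1 - η) t * f (x - t) ∂periodMeasure := by
    rw [conjPoissonInt]
    congr 1
    have hper : Function.Periodic (fun θ ↦ conjPoissonKer (1 - η) (x - θ) * f θ) (2 * π) := by
      intro θ
      beta_reduce
      rw [hp θ, ← sub_sub, (conjPoissonKer_periodic _).sub_eq]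
    rw [← hper.integral_sub_periodMeasure x]
    simp
  rw [hV, pvH_eq, ← mul_sub, ← integral_sub hQf hCf]
  congr 1
  simp only [smul_eq_mul, mul_sub]
  rw [integral_sub hKf hK1, integral_mul_const,
    integral_periodMeasure_of_odd (k := fun t ↦ conjPoissonKer (1 - η) t - truncCot η t), zero_mul,
    sub_zero]
  · simp only [sub_mul]
  · intro t
    rw [conjPoissonKer_neg, truncCot_neg]; ring

/-- Fatou's theorem for Poisson integrals, at a Lebesgue point. -/
lemma IsLebesguePt.tendsto_poissonInt {E : Type*} [NormedAddCommGroup E] [NormedSpace ℝ E]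
    [CompleteSpace E] {f : ℝ → E} (hp : Function.Periodic f (2 * π))
      (hf : Integrable f periodMeasure) {x : ℝ}
    (hx : IsLebesguePt f x) :
    Tendsto (fun η ↦ (2 * π)⁻¹ • ∫ θ, poissonKer (1 - η) (x - θ) • f θ ∂periodMeasure)
      (𝓝[>] 0) (𝓝 (f x)) := by
  have hev : ∀ᶠ η in 𝓝[>] (0 : ℝ), η ∈ Ioo (0 : ℝ) (1 / 2) := Ioo_mem_nhdsGT (by norm_num)
  have h := hx.tendsto_integral_kernel hp hf (K := fun η t ↦ poissonKer (1 - η) t)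
    (C := 10) (by
      filter_upwards [hev] with η hη t ht
      exact poissonKer_le hη.1 hη.2 (abs_le.2 ⟨ht.1.le, ht.2⟩))
  have h2 := (h.const_smul (2 * π)⁻¹).add_const (f x)
  rw [smul_zero, zero_add] at h2
  refine h2.congr' ?_
  filter_upwards [hev] with η hη
  have h0 : 0 ≤ 1 - η := by linarith [hη.2]
  have h1 : 1 - η < 1 := by linarith [hη.1]
  have hper : Function.Periodic (fun θ ↦ poissonKer (1 - η) (x - θ) • f θ) (2 * π) := by
    intro θ
    beta_reduce
    rw [hp θ, ← sub_sub, (poissonKer_periodic _).sub_eq]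
  have hc := continuous_poissonKer h0 h1
  have hI : ∫ t, poissonKer (1 - η) t ∂periodMeasure = 2 * π := by
    simpa [poissonKer_neg] using integral_poissonKer h0 h1 0
  rw [← hper.integral_sub_periodMeasure x]
  simp only [sub_sub_cancel, smul_sub]
  rw [integral_sub (integrable_continuous_mul (hp.integrable_sub_periodMeasure hf x) hc)
    (integrable_continuous_mul (integrable_const _) hc), integral_smul_const, hI, smul_sub,
    smul_smul,
    inv_mul_cancel₀ (by positivity), one_smul, sub_add_cancel]

lemma exists_abs_sin_rpow_le {p : ℝ} (hp : 1 < p) (hp2 : p ≤ 2) :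
    ∃ A B : ℝ, 0 < A ∧ 0 < B ∧ ∀ θ : ℝ, |θ| ≤ π / 2 →
      |Real.sin θ| ^ p ≤ A * Real.cos θ ^ p - B * Real.cos (θ * p) := by
  have hpi := Real.pi_pos
  obtain ⟨γ, hγ⟩ : ∃ γ, γ = π / 4 * (1 + p) / p := ⟨_, rfl⟩
  have hγp : γ * p = π / 4 * (1 + p) := by rw [hγ]; field_simp
  have hγ0 : 0 < γ := by rw [hγ]; positivity
  have hγ1 : γ < π / 2 := by
    rw [hγ, div_lt_iff₀ (by linarith)]; nlinarith
  have hcγ : 0 < Real.cos γ := Real.cos_pos_of_mem_Ioo ⟨by linarith, hγ1⟩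
  have hcpγ : Real.cos (γ * p) < 0 := by
    rw [hγp]
    exact Real.cos_neg_of_pi_div_two_lt_of_lt (by nlinarith) (by nlinarith)
  refine ⟨(1 + (-Real.cos (γ * p))⁻¹) / Real.cos γ ^ p, (-Real.cos (γ * p))⁻¹,
    by have := inv_pos.2 (neg_pos.2 hcpγ); positivity, inv_pos.2 (neg_pos.2 hcpγ), fun θ hθ ↦ ?_⟩
  have hB := inv_pos.2 (neg_pos.2 hcpγ)
  have h1 : |Real.sin θ| ^ p ≤ 1 :=
    Real.rpow_le_one (abs_nonneg _) (Real.abs_sin_le_one θ) (by linarith)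
  refine h1.trans ?_
  have hc0 : 0 ≤ Real.cos θ := Real.cos_nonneg_of_mem_Icc (abs_le.1 hθ)
  by_cases h : |θ| < γ
  · have h2 : Real.cos γ ≤ Real.cos θ := by
      rw [← Real.cos_abs θ]
      exact Real.cos_le_cos_of_nonneg_of_le_pi (abs_nonneg _) (by linarith) h.le
    have h3 : Real.cos γ ^ p ≤ Real.cos θ ^ p := Real.rpow_le_rpow hcγ.le h2 (by linarith)
    have h4 : (1 + (-Real.cos (γ * p))⁻¹) ≤
        (1 + (-Real.cos (γ * p))⁻¹) / Real.cos γ ^ p * Real.cos θ ^ p := by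
      rw [div_mul_eq_mul_div, le_div_iff₀ (by positivity)]
      gcongr
    have h5 := mul_le_mul_of_nonneg_left (Real.cos_le_one (θ * p)) hB.le
    linarith
  · push Not at h
    have h2 : Real.cos (θ * p) ≤ Real.cos (γ * p) := by
      rw [← Real.cos_abs (θ * p), abs_mul, abs_of_pos (by linarith : 0 < p)]
      exact Real.cos_le_cos_of_nonneg_of_le_pi (by positivity) (by nlinarith) (by gcongr)
    have h3 : 1 ≤ -((-Real.cos (γ * p))⁻¹ * Real.cos (θ * p)) := by
      rw [← mul_neg, ← inv_mul_cancel₀ (neg_pos.2 hcpγ).ne']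
      gcongr
    have h4 : 0 ≤ (1 + (-Real.cos (γ * p))⁻¹) / Real.cos γ ^ p * Real.cos θ ^ p := by positivity
    linarith

lemma exists_abs_im_rpow_le {p : ℝ} (hp : 1 < p) (hp2 : p ≤ 2) :
    ∃ A B : ℝ, 0 < A ∧ 0 < B ∧ ∀ z : ℂ, 0 < z.re →
      |z.im| ^ p ≤ A * z.re ^ p - B * (z ^ (p : ℂ)).re := by
  obtain ⟨A, B, hA, hB, h⟩ := exists_abs_sin_rpow_le hp hp2
  refine ⟨A, B, hA, hB, fun z hz ↦ ?_⟩
  have harg : |z.arg| ≤ π / 2 := Complex.abs_arg_le_pi_div_two_iff.2 hz.le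
  have hc0 : 0 ≤ Real.cos z.arg := Real.cos_nonneg_of_mem_Icc (abs_le.1 harg)
  have := mul_le_mul_of_nonneg_left (h z.arg harg) (Real.rpow_nonneg (norm_nonneg z) p)
  rw [Complex.cpow_ofReal_re, ← Complex.norm_mul_sin_arg z, ← Complex.norm_mul_cos_arg z, abs_mul,
    abs_norm, Real.mul_rpow (norm_nonneg _) (abs_nonneg _), Real.mul_rpow (norm_nonneg _) hc0]
  linarith

lemma continuous_herglotzInt_circleMap {f : ℝ → ℝ} (hf : Integrable f periodMeasure) {r : ℝ}
    (h0 : 0 ≤ r) (h1 : r < 1) : Continuous fun x ↦ herglotzInt f (circleMap 0 r x) :=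
  (differentiableOn_herglotzInt hf).continuousOn.comp_continuous (continuous_circleMap 0 r)
    fun x ↦ circleMap_mem_ball h0 h1 x

lemma poissonInt_eq_re {f : ℝ → ℝ} (hf : Integrable f periodMeasure) {r : ℝ}
    (h0 : 0 ≤ r) (h1 : r < 1) (x : ℝ) :
    poissonInt f r x = (herglotzInt f (circleMap 0 r x)).re := by
  simp [herglotzInt_circleMap hf h0 h1]

lemma conjPoissonInt_eq_im {f : ℝ → ℝ} (hf : Integrable f periodMeasure) {r : ℝ}
    (h0 : 0 ≤ r) (h1 : r < 1) (x : ℝ) :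
    conjPoissonInt f r x = (herglotzInt f (circleMap 0 r x)).im := by
  simp [herglotzInt_circleMap hf h0 h1]

lemma continuous_poissonInt {f : ℝ → ℝ} (hf : Integrable f periodMeasure) {r : ℝ}
    (h0 : 0 ≤ r) (h1 : r < 1) : Continuous (poissonInt f r) := by
  rw [funext (poissonInt_eq_re hf h0 h1)]
  exact Complex.continuous_re.comp (continuous_herglotzInt_circleMap hf h0 h1)

lemma continuous_conjPoissonInt {f : ℝ → ℝ} (hf : Integrable f periodMeasure) {r : ℝ}
    (h0 : 0 ≤ r) (h1 : r < 1) : Continuous (conjPoissonInt f r) := by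
  rw [funext (conjPoissonInt_eq_im hf h0 h1)]
  exact Complex.continuous_im.comp (continuous_herglotzInt_circleMap hf h0 h1)

lemma Continuous.integrable_periodMeasure {E : Type*} [NormedAddCommGroup E] {g : ℝ → E}
    (hg : Continuous g) : Integrable g periodMeasure :=
  (hg.integrableOn_Icc (a := -π) (b := π)).mono_set Ioc_subset_Icc_self

lemma poissonInt_nonneg {f : ℝ → ℝ} (hf0 : ∀ x, 0 ≤ f x) {r : ℝ}
    (h0 : 0 ≤ r) (h1 : r < 1) (x : ℝ) : 0 ≤ poissonInt f r x :=
  mul_nonneg (by positivity) (integral_nonneg fun _ ↦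
    mul_nonneg (poissonKer_nonneg h0 h1 _) (hf0 _))

lemma integrable_poissonKer_mul {f : ℝ → ℝ} (hf : Integrable f periodMeasure) {r : ℝ}
    (h0 : 0 ≤ r) (h1 : r < 1) (x : ℝ) :
    Integrable (fun θ ↦ poissonKer r (x - θ) * f θ) periodMeasure :=
  integrable_continuous_mul hf ((continuous_poissonKer h0 h1).comp
    (continuous_const.sub continuous_id : Continuous fun θ ↦ x - θ))

lemma integrable_conjPoissonKer_mul {f : ℝ → ℝ} (hf : Integrable f periodMeasure) {r : ℝ}
    (h0 : 0 ≤ r) (h1 : r < 1) (x : ℝ) :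
    Integrable (fun θ ↦ conjPoissonKer r (x - θ) * f θ) periodMeasure :=
  integrable_continuous_mul hf ((continuous_conjPoissonKer h0 h1).comp
    (continuous_const.sub continuous_id : Continuous fun θ ↦ x - θ))

lemma poissonInt_pos {f : ℝ → ℝ} (hf : Integrable f periodMeasure) (hf0 : ∀ x, 0 ≤ f x)
    (hne : ¬ f =ᵐ[periodMeasure] 0) {r : ℝ} (h0 : 0 ≤ r) (h1 : r < 1) (x : ℝ) :
    0 < poissonInt f r x := by
  refine (poissonInt_nonneg hf0 h0 h1 x).lt_of_ne' fun h ↦ hne ?_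
  rw [poissonInt, mul_eq_zero, or_iff_right (by positivity), integral_eq_zero_iff_of_nonneg
    (fun _ ↦ mul_nonneg (poissonKer_nonneg h0 h1 _) (hf0 _))
    (integrable_poissonKer_mul hf h0 h1 x)] at h
  filter_upwards [h] with θ hθ
  exact (mul_eq_zero.1 hθ).resolve_left (poissonKer_pos h0 h1 _).ne'

lemma integrable_prod_kernel {k : ℝ → ℝ} (hk : Continuous k) (hkp : Function.Periodic k (2 * π))
    {f g : ℝ → ℝ} (hf : Integrable f periodMeasure) (hg : Integrable g periodMeasure) :
    Integrable (fun z : ℝ × ℝ ↦ k (z.1 - z.2) * (g z.1 * f z.2))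
      (periodMeasure.prod periodMeasure) := by
  obtain ⟨C, hC⟩ := (hkp.isBounded_of_continuous (by positivity) hk).exists_norm_le
  refine (hg.mul_prod hf).bdd_mul (c := C) ?_ (ae_of_all _ fun z ↦ hC _ ⟨_, rfl⟩)
  exact (hk.comp (by fun_prop : Continuous fun z : ℝ × ℝ ↦ z.1 - z.2)).aestronglyMeasurable

lemma integral_poissonInt {f : ℝ → ℝ} (hf : Integrable f periodMeasure) {r : ℝ}
    (h0 : 0 ≤ r) (h1 : r < 1) :
    ∫ x, poissonInt f r x ∂periodMeasure = ∫ x, f x ∂periodMeasure := by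
  have h := integrable_prod_kernel (continuous_poissonKer h0 h1) (poissonKer_periodic r) hf
    (integrable_const 1)
  simp only [one_mul] at h
  simp only [poissonInt]
  rw [integral_const_mul, integral_integral_swap h]
  simp only [integral_mul_const]
  have : ∀ θ, ∫ x, poissonKer r (x - θ) ∂periodMeasure = 2 * π := fun θ ↦ by
    rw [← integral_poissonKer h0 h1 θ]
    congr 1; ext x; rw [← poissonKer_neg, neg_sub]
  simp only [this, integral_const_mul]
  rw [← mul_assoc, inv_mul_cancel₀ (by positivity), one_mul]

lemma integral_conjPoissonInt_mul {f g : ℝ → ℝ} (hf : Integrable f periodMeasure)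
    (hg : Integrable g periodMeasure) {r : ℝ} (h0 : 0 ≤ r) (h1 : r < 1) :
    ∫ x, conjPoissonInt f r x * g x ∂periodMeasure =
      -∫ x, f x * conjPoissonInt g r x ∂periodMeasure := by
  have h := integrable_prod_kernel (continuous_conjPoissonKer h0 h1) (conjPoissonKer_periodic r)
    hf hg
  have e1 : ∀ x, conjPoissonInt f r x * g x =
      (2 * π)⁻¹ * ∫ θ, conjPoissonKer r (x - θ) * (g x * f θ) ∂periodMeasure := fun x ↦ by
    rw [conjPoissonInt, mul_assoc, ← integral_mul_const]
    congr 2; ext θ; ring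
  have e2 : ∀ θ, f θ * conjPoissonInt g r θ =
      -((2 * π)⁻¹ * ∫ x, conjPoissonKer r (x - θ) * (g x * f θ) ∂periodMeasure) := fun θ ↦ by
    rw [conjPoissonInt, mul_left_comm, ← integral_const_mul, ← mul_neg, ← integral_neg]
    congr 2; ext x
    rw [← neg_sub x θ, conjPoissonKer_neg]; ring
  simp only [e1, e2]
  rw [integral_neg, integral_const_mul, integral_const_mul, integral_integral_swap h, neg_neg]

lemma poissonInt_rpow_le {p : ℝ} (hp : 1 < p) {f : ℝ → ℝ} (hf : Integrable f periodMeasure)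
    (hf0 : ∀ x, 0 ≤ f x) (hfp : Integrable (fun x ↦ f x ^ p) periodMeasure) {r : ℝ}
    (h0 : 0 ≤ r) (h1 : r < 1) (x : ℝ) :
    poissonInt f r x ^ p ≤ poissonInt (fun x ↦ f x ^ p) r x := by
  have hpq := Real.HolderConjugate.conjExponent hp
  set q := p.conjExponent
  set m := poissonInt f r x with hm
  have hm0 : 0 ≤ m := poissonInt_nonneg hf0 h0 h1 x
  have hmq : (m ^ (p - 1)) ^ q = m ^ p := by
    rw [← Real.rpow_mul hm0, hpq.sub_one_mul_conj]
  have e1 : m ^ p = (2 * π)⁻¹ * ∫ θ, poissonKer r (x - θ) * (f θ * m ^ (p - 1)) ∂periodMeasure := by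
    have : m ^ p = m * m ^ (p - 1) := by
      rw [← Real.rpow_one_add' hm0 (by linarith)]; congr 1; ring
    rw [this]
    conv_lhs => rw [hm, poissonInt]
    rw [mul_assoc, ← integral_mul_const]
    simp only [mul_assoc]
    rfl
  have hi := integrable_poissonKer_mul hfp h0 h1 x
  have hi1 := integrable_poissonKer_mul (integrable_const (1 : ℝ)) h0 h1 x
  have e2 : m ^ p ≤ (2 * π)⁻¹ * ∫ θ, ((poissonKer r (x - θ) * f θ ^ p) / p +
      poissonKer r (x - θ) * 1 * (m ^ p / q)) ∂periodMeasure := by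
    conv_lhs => rw [e1]
    refine mul_le_mul_of_nonneg_left ?_ (by positivity)
    refine integral_mono (integrable_poissonKer_mul (hf.mul_const _) h0 h1 x)
      ((hi.div_const _).add (hi1.mul_const _)) fun θ ↦ ?_
    have := Real.young_inequality_of_nonneg (hf0 θ) (Real.rpow_nonneg hm0 (p - 1)) hpq
    rw [hmq] at this
    have := mul_le_mul_of_nonneg_left this (poissonKer_nonneg h0 h1 (x - θ))
    refine this.trans (le_of_eq ?_)
    ring
  rw [integral_add (hi.div_const _) (hi1.mul_const _), integral_div, integral_mul_const] at e2
  simp only [mul_one] at e2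
  rw [integral_poissonKer h0 h1, mul_add, ← mul_assoc, inv_mul_cancel₀ (by positivity),
    one_mul] at e2
  have e3 : m ^ p / q = m ^ p - m ^ p / p := by
    have := hpq.inv_add_inv_eq_one
    rw [div_eq_mul_inv, div_eq_mul_inv, ← mul_one_sub]
    congr 1; linarith
  rw [e3] at e2
  have e4 : m ^ p / p ≤ ((2 * π)⁻¹ * ∫ θ, poissonKer r (x - θ) * f θ ^ p ∂periodMeasure) / p := by
    rw [mul_div_assoc]; linarith
  exact (div_le_div_iff_of_pos_right (by linarith)).1 e4

lemma exists_eq_circleMap {z : ℂ} (hz : z ∈ Metric.ball (0 : ℂ) 1) :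
    ∃ r x : ℝ, 0 ≤ r ∧ r < 1 ∧ z = circleMap 0 r x :=
  ⟨‖z‖, z.arg, norm_nonneg z, by simpa using hz, by simp [circleMap]⟩

lemma re_herglotzInt_nonneg {f : ℝ → ℝ} (hf : Integrable f periodMeasure) (hf0 : ∀ x, 0 ≤ f x)
    {z : ℂ} (hz : z ∈ Metric.ball (0 : ℂ) 1) : 0 ≤ (herglotzInt f z).re := by
  obtain ⟨r, x, h0, h1, rfl⟩ := exists_eq_circleMap hz
  rw [← poissonInt_eq_re hf h0 h1]
  exact poissonInt_nonneg hf0 h0 h1 x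

lemma re_herglotzInt_pos {f : ℝ → ℝ} (hf : Integrable f periodMeasure) (hf0 : ∀ x, 0 ≤ f x)
    (hne : ¬ f =ᵐ[periodMeasure] 0) {z : ℂ} (hz : z ∈ Metric.ball (0 : ℂ) 1) :
    0 < (herglotzInt f z).re := by
  obtain ⟨r, x, h0, h1, rfl⟩ := exists_eq_circleMap hz
  rw [← poissonInt_eq_re hf h0 h1]
  exact poissonInt_pos hf hf0 hne h0 h1 x

lemma diffContOnCl_ball_of_differentiableOn {G : ℂ → ℂ}
    (hG : DifferentiableOn ℂ G (Metric.ball 0 1)) {r : ℝ} (h1 : r < 1) :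
    DiffContOnCl ℂ G (Metric.ball 0 r) :=
  hG.diffContOnCl_ball (Metric.closedBall_subset_ball h1)

lemma integral_re_cpow_herglotzInt_nonneg {f : ℝ → ℝ} (hf : Integrable f periodMeasure)
    (hf0 : ∀ x, 0 ≤ f x) (hne : ¬ f =ᵐ[periodMeasure] 0) (p : ℝ) {r : ℝ} (h0 : 0 ≤ r) (h1 : r < 1) :
    0 ≤ ∫ θ, (herglotzInt f (circleMap 0 r θ) ^ (p : ℂ)).re ∂periodMeasure := by
  have hd : DifferentiableOn ℂ (fun z ↦ herglotzInt f z ^ (p : ℂ)) (Metric.ball 0 1) :=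
    (differentiableOn_herglotzInt hf).cpow (differentiableOn_const _)
      fun z hz ↦ Or.inl (re_herglotzInt_pos hf hf0 hne hz)
  have h := (show DiffContOnCl ℂ (fun z ↦ herglotzInt f z ^ (p : ℂ)) (Metric.ball 0 |r|) from
    diffContOnCl_ball_of_differentiableOn hd (by rwa [abs_of_nonneg h0])).circleAverage
  rw [circleAverage_eq_integral_periodMeasure, herglotzInt_zero] at h
  have hc : Continuous fun θ ↦ herglotzInt f (circleMap 0 r θ) ^ (p : ℂ) :=
    hd.continuousOn.comp_continuous (continuous_circleMap 0 r) fun x ↦ circleMap_mem_ball h0 h1 x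
  have h2 : ∫ θ, (herglotzInt f (circleMap 0 r θ) ^ (p : ℂ)).re ∂periodMeasure =
      (∫ θ, herglotzInt f (circleMap 0 r θ) ^ (p : ℂ) ∂periodMeasure).re :=
    Complex.reCLM.integral_comp_comm hc.integrable_periodMeasure
  have hm : 0 ≤ (2 * π)⁻¹ * ∫ θ, f θ ∂periodMeasure :=
    mul_nonneg (by positivity) (integral_nonneg hf0)
  have h3 := congrArg Complex.re h
  rw [Complex.smul_re, ← h2, ← Complex.ofReal_cpow hm, Complex.ofReal_re, smul_eq_mul] at h3
  have h4 := Real.rpow_nonneg hm p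
  rw [← h3] at h4
  exact (mul_nonneg_iff_of_pos_left (by positivity)).1 h4

lemma integral_abs_conjPoissonInt_rpow_le_of_nonneg {p : ℝ} (hp : 1 < p) (hp2 : p ≤ 2) :
    ∃ C : ℝ, 0 < C ∧ ∀ f : ℝ → ℝ, Integrable f periodMeasure → (∀ x, 0 ≤ f x) →
      Integrable (fun x ↦ f x ^ p) periodMeasure → ∀ r : ℝ, 0 ≤ r → r < 1 →
        ∫ x, |conjPoissonInt f r x| ^ p ∂periodMeasure ≤ C * ∫ x, f x ^ p ∂periodMeasure := by
  obtain ⟨A, B, hA, hB, h⟩ := exists_abs_im_rpow_le hp hp2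
  have hp0 : 0 < p := by linarith
  refine ⟨A, hA, fun f hf hf0 hfp r h0 h1 ↦ ?_⟩
  by_cases hne : f =ᵐ[periodMeasure] 0
  · have : ∀ x, conjPoissonInt f r x = 0 := fun x ↦ by
      rw [conjPoissonInt, integral_eq_zero_of_ae, mul_zero]
      filter_upwards [hne] with θ hθ
      simp [hθ]
    simp only [this, abs_zero, Real.zero_rpow hp0.ne', integral_zero]
    exact mul_nonneg hA.le (integral_nonneg fun x ↦ Real.rpow_nonneg (hf0 x) p)
  have hcV := continuous_conjPoissonInt hf h0 h1
  have hcU := continuous_poissonInt hf h0 h1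
  have hcF : Continuous fun θ ↦ (herglotzInt f (circleMap 0 r θ) ^ (p : ℂ)).re :=
    Complex.continuous_re.comp <| (continuous_herglotzInt_circleMap hf h0 h1).cpow continuous_const
      fun x ↦ Or.inl (re_herglotzInt_pos hf hf0 hne (circleMap_mem_ball h0 h1 x))
  have hiU : Integrable (fun x ↦ poissonInt f r x ^ p) periodMeasure :=
    (hcU.rpow_const fun _ ↦ Or.inr hp0.le).integrable_periodMeasure
  have hiF := hcF.integrable_periodMeasure
  calc ∫ x, |conjPoissonInt f r x| ^ p ∂periodMeasure
      ≤ ∫ x, (A * poissonInt f r x ^ p -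
          B * (herglotzInt f (circleMap 0 r x) ^ (p : ℂ)).re) ∂periodMeasure := by
        refine integral_mono
          (hcV.abs.rpow_const fun _ ↦ Or.inr hp0.le).integrable_periodMeasure
          ((hiU.const_mul A).sub (hiF.const_mul B)) fun x ↦ ?_
        have := h _ (re_herglotzInt_pos hf hf0 hne (circleMap_mem_ball h0 h1 x))
        rwa [← poissonInt_eq_re hf h0 h1, ← conjPoissonInt_eq_im hf h0 h1] at this
    _ = A * ∫ x, poissonInt f r x ^ p ∂periodMeasure -
          B * ∫ x, (herglotzInt f (circleMap 0 r x) ^ (p : ℂ)).re ∂periodMeasure := by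
        rw [integral_sub (hiU.const_mul A) (hiF.const_mul B), integral_const_mul,
          integral_const_mul]
    _ ≤ A * ∫ x, poissonInt f r x ^ p ∂periodMeasure :=
        sub_le_self _ (mul_nonneg hB.le (integral_re_cpow_herglotzInt_nonneg hf hf0 hne p h0 h1))
    _ ≤ A * ∫ x, f x ^ p ∂periodMeasure := by
        refine mul_le_mul_of_nonneg_left ?_ hA.le
        rw [← integral_poissonInt hfp h0 h1]
        exact integral_mono hiU (continuous_poissonInt hfp h0 h1).integrable_periodMeasure
          fun x ↦ poissonInt_rpow_le hp hf hf0 hfp h0 h1 x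

lemma conjPoissonInt_sub {f g : ℝ → ℝ} (hf : Integrable f periodMeasure)
    (hg : Integrable g periodMeasure) {r : ℝ} (h0 : 0 ≤ r) (h1 : r < 1) (x : ℝ) :
    conjPoissonInt (fun x ↦ f x - g x) r x = conjPoissonInt f r x - conjPoissonInt g r x := by
  simp only [conjPoissonInt, mul_sub]
  rw [integral_sub (integrable_conjPoissonKer_mul hf h0 h1 x)
    (integrable_conjPoissonKer_mul hg h0 h1 x), mul_sub]

lemma conjPoissonInt_posPart_sub_negPart {f : ℝ → ℝ} (hf : Integrable f periodMeasure)
    {r : ℝ} (h0 : 0 ≤ r) (h1 : r < 1) (x : ℝ) :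
    conjPoissonInt f r x =
      conjPoissonInt (fun x ↦ max (f x) 0) r x - conjPoissonInt (fun x ↦ max (-f x) 0) r x := by
  rw [← conjPoissonInt_sub hf.pos_part hf.neg_part h0 h1]
  congr 1
  ext x
  rcases le_total 0 (f x) with h | h <;> simp [h]

lemma integrable_rpow_of_abs_le {p : ℝ} (hp : 0 ≤ p) {f g : ℝ → ℝ}
    (hf : Integrable (fun x ↦ |f x| ^ p) periodMeasure)
    (hg : AEStronglyMeasurable g periodMeasure) (h0 : ∀ x, 0 ≤ g x) (h : ∀ x, g x ≤ |f x|) :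
    Integrable (fun x ↦ g x ^ p) periodMeasure :=
  hf.mono (hg.aemeasurable.pow_const p).aestronglyMeasurable <| ae_of_all _ fun x ↦ by
    rw [Real.norm_of_nonneg (Real.rpow_nonneg (h0 x) p),
      Real.norm_of_nonneg (Real.rpow_nonneg (abs_nonneg _) p)]
    exact Real.rpow_le_rpow (h0 x) (h x) hp

lemma abs_sub_rpow_le {p : ℝ} (hp : 1 < p) (a b : ℝ) :
    |a - b| ^ p ≤ 2 ^ (p - 1) * (|a| ^ p + |b| ^ p) :=
  (Real.rpow_le_rpow (abs_nonneg _) (abs_sub a b) (by linarith)).trans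
    (by exact_mod_cast
      NNReal.rpow_add_le_mul_rpow_add_rpow ⟨|a|, abs_nonneg a⟩ ⟨|b|, abs_nonneg b⟩ hp.le)

lemma integral_abs_conjPoissonInt_rpow_le_of_le_two {p : ℝ} (hp : 1 < p) (hp2 : p ≤ 2) :
    ∃ C : ℝ, 0 < C ∧ ∀ f : ℝ → ℝ, Integrable f periodMeasure →
      Integrable (fun x ↦ |f x| ^ p) periodMeasure → ∀ r : ℝ, 0 ≤ r → r < 1 →
        ∫ x, |conjPoissonInt f r x| ^ p ∂periodMeasure ≤ C * ∫ x, |f x| ^ p ∂periodMeasure := by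
  obtain ⟨C, hC, h⟩ := integral_abs_conjPoissonInt_rpow_le_of_nonneg hp hp2
  have hp0 : 0 ≤ p := by linarith
  refine ⟨2 ^ (p - 1) * (C + C), by positivity, fun f hf hfp r h0 h1 ↦ ?_⟩
  have hle1 : ∀ x, max (f x) 0 ≤ |f x| := fun x ↦ max_le (le_abs_self _) (abs_nonneg _)
  have hle2 : ∀ x, max (-f x) 0 ≤ |f x| := fun x ↦ max_le (neg_le_abs _) (abs_nonneg _)
  have hi1 := integrable_rpow_of_abs_le hp0 hfp hf.pos_part.1 (fun x ↦ le_max_right _ _) hle1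
  have hi2 := integrable_rpow_of_abs_le hp0 hfp hf.neg_part.1 (fun x ↦ le_max_right _ _) hle2
  have b1 := h _ hf.pos_part (fun x ↦ le_max_right _ _) hi1 r h0 h1
  have b2 := h _ hf.neg_part (fun x ↦ le_max_right _ _) hi2 r h0 h1
  have c1 : ∫ x, max (f x) 0 ^ p ∂periodMeasure ≤ ∫ x, |f x| ^ p ∂periodMeasure :=
    integral_mono hi1 hfp fun x ↦ Real.rpow_le_rpow (le_max_right _ _) (hle1 x) hp0
  have c2 : ∫ x, max (-f x) 0 ^ p ∂periodMeasure ≤ ∫ x, |f x| ^ p ∂periodMeasure :=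
    integral_mono hi2 hfp fun x ↦ Real.rpow_le_rpow (le_max_right _ _) (hle2 x) hp0
  have hiV : ∀ {g : ℝ → ℝ}, Integrable g periodMeasure →
      Integrable (fun x ↦ |conjPoissonInt g r x| ^ p) periodMeasure := fun hg ↦
    ((continuous_conjPoissonInt hg h0 h1).abs.rpow_const fun _ ↦
      Or.inr hp0).integrable_periodMeasure
  calc ∫ x, |conjPoissonInt f r x| ^ p ∂periodMeasure
      ≤ ∫ x, 2 ^ (p - 1) * (|conjPoissonInt (fun x ↦ max (f x) 0) r x| ^ p +
          |conjPoissonInt (fun x ↦ max (-f x) 0) r x| ^ p) ∂periodMeasure := by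
        refine integral_mono (hiV hf)
          (((hiV hf.pos_part).add (hiV hf.neg_part)).const_mul _) fun x ↦ ?_
        simp only [conjPoissonInt_posPart_sub_negPart hf h0 h1 x]
        exact abs_sub_rpow_le hp _ _
    _ = 2 ^ (p - 1) * (∫ x, |conjPoissonInt (fun x ↦ max (f x) 0) r x| ^ p ∂periodMeasure +
          ∫ x, |conjPoissonInt (fun x ↦ max (-f x) 0) r x| ^ p ∂periodMeasure) := by
        rw [integral_const_mul, integral_add (hiV hf.pos_part) (hiV hf.neg_part)]
    _ ≤ 2 ^ (p - 1) * (C * ∫ x, |f x| ^ p ∂periodMeasure +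
          C * ∫ x, |f x| ^ p ∂periodMeasure) := by
        have := mul_le_mul_of_nonneg_left c1 hC.le
        have := mul_le_mul_of_nonneg_left c2 hC.le
        gcongr <;> linarith
    _ = _ := by ring

lemma integral_abs_conjPoissonInt_rpow_le {p : ℝ} (hp : 1 < p) :
    ∃ C : ℝ, 0 < C ∧ ∀ f : ℝ → ℝ, Integrable f periodMeasure →
      Integrable (fun x ↦ |f x| ^ p) periodMeasure → ∀ r : ℝ, 0 ≤ r → r < 1 →
        ∫ x, |conjPoissonInt f r x| ^ p ∂periodMeasure ≤ C * ∫ x, |f x| ^ p ∂periodMeasure := by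
  rcases le_or_gt p 2 with hp2 | hp2
  · exact integral_abs_conjPoissonInt_rpow_le_of_le_two hp hp2
  have hpq := Real.HolderConjugate.conjExponent hp
  have hq2 : p.conjExponent ≤ 2 := by
    rw [Real.conjExponent, div_le_iff₀ (by linarith)]; linarith
  obtain ⟨q, hqdef⟩ : ∃ q, q = p.conjExponent := ⟨_, rfl⟩
  rw [← hqdef] at hpq hq2
  have hp0 : 0 < p := by linarith
  have hq0 : 0 < q := hpq.symm.pos
  obtain ⟨C, hC, h⟩ := integral_abs_conjPoissonInt_rpow_le_of_le_two hpq.symm.lt hq2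
  obtain ⟨l, hl⟩ : ∃ l : ℝ, l = (2 * C) ^ q⁻¹ := ⟨_, rfl⟩
  have hl0 : 0 < l := by rw [hl]; positivity
  have hlq : l ^ q = 2 * C := by rw [hl, Real.rpow_inv_rpow (by positivity) hq0.ne']
  refine ⟨2 * l ^ p, by positivity, fun f hf hfp r h0 h1 ↦ ?_⟩
  have hcV := continuous_conjPoissonInt hf h0 h1
  set V := conjPoissonInt f r
  set g : ℝ → ℝ := fun x ↦ |V x| ^ (p - 2) * V x with hg
  have hcg : Continuous g := (hcV.abs.rpow_const fun _ ↦ Or.inr (by linarith)).mul hcV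
  have hgi := hcg.integrable_periodMeasure
  have hVg : ∀ x, V x * g x = |V x| ^ p := fun x ↦ by
    have : p = (p - 2) + 2 := by ring
    conv_rhs => rw [this, Real.rpow_add_of_nonneg (abs_nonneg _) (by linarith) (by norm_num)]
    rw [Real.rpow_two, sq_abs, hg]; ring
  have hgq : ∀ x, |g x| ^ q = |V x| ^ p := fun x ↦ by
    rw [hg, abs_mul, abs_of_nonneg (Real.rpow_nonneg (abs_nonneg _) _)]
    have : |V x| ^ (p - 2) * |V x| = |V x| ^ (p - 1) := by
      rw [← Real.rpow_add_one' (abs_nonneg _) (by linarith)]; congr 1; ring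
    rw [this, ← Real.rpow_mul (abs_nonneg _), hpq.sub_one_mul_conj]
  have hVi : Integrable (fun x ↦ |V x| ^ p) periodMeasure :=
    (hcV.abs.rpow_const fun _ ↦ Or.inr hp0.le).integrable_periodMeasure
  have hW := h g hgi (by simpa only [hgq] using hVi) r h0 h1
  have hcW := continuous_conjPoissonInt hgi h0 h1
  have hdual := integral_conjPoissonInt_mul hf hgi h0 h1
  set W := conjPoissonInt g r
  simp only [hgq] at hW
  have hWi : Integrable (fun x ↦ |W x| ^ q) periodMeasure :=
    (hcW.abs.rpow_const fun _ ↦ Or.inr hq0.le).integrable_periodMeasure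
  have hfW : Integrable (fun x ↦ f x * W x) periodMeasure := by
    simpa only [smul_eq_mul, mul_comm] using integrable_continuous_mul hf hcW
  have key : ∫ x, |V x| ^ p ∂periodMeasure ≤
      ∫ x, (l ^ p * |f x| ^ p + (l ^ q)⁻¹ * |W x| ^ q) ∂periodMeasure := by
    have e : ∫ x, |V x| ^ p ∂periodMeasure = ∫ x, -(f x * W x) ∂periodMeasure := by
      rw [integral_neg, ← hdual]
      simp only [← hVg]
      rfl
    rw [e]
    refine integral_mono hfW.neg ((hfp.const_mul _).add (hWi.const_mul _)) fun x ↦ ?_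
    have y := Real.young_inequality_of_nonneg (mul_nonneg hl0.le (abs_nonneg (f x)))
      (mul_nonneg (inv_nonneg.2 hl0.le) (abs_nonneg (W x))) hpq
    have e1 : l * |f x| * (l⁻¹ * |W x|) = |f x * W x| := by
      rw [abs_mul]; field_simp
    rw [e1, Real.mul_rpow hl0.le (abs_nonneg _), Real.mul_rpow (inv_nonneg.2 hl0.le) (abs_nonneg _),
      Real.inv_rpow hl0.le] at y
    exact (neg_le_abs _).trans (y.trans (add_le_add
      (div_le_self (by positivity) hpq.lt.le) (div_le_self (by positivity) hpq.symm.lt.le)))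
  rw [integral_add (hfp.const_mul _) (hWi.const_mul _), integral_const_mul, integral_const_mul,
    hlq] at key
  have : (2 * C)⁻¹ * ∫ x, |W x| ^ q ∂periodMeasure ≤ 1 / 2 * ∫ x, |V x| ^ p ∂periodMeasure := by
    rw [inv_mul_le_iff₀ (by positivity)]
    linarith
  linarith

/-- Bounded sequences in a Hilbert space converge weakly along ultrafilters. -/
lemma exists_tendsto_inner_of_norm_le {E : Type*} [NormedAddCommGroup E] [InnerProductSpace ℂ E]
    [CompleteSpace E] {u : ℕ → E} {M : ℝ} (hu : ∀ n, ‖u n‖ ≤ M) (U : Ultrafilter ℕ) :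
    ∃ g : E, ∀ h : E, Tendsto (fun n ↦ inner ℂ h (u n)) U (𝓝 (inner ℂ h g)) := by
  let φ : ℕ → WeakDual ℂ E := fun n ↦ StrongDual.toWeakDual (InnerProductSpace.toDual ℂ E (u n))
  have hK := WeakDual.isCompact_closedBall (𝕜 := ℂ) (0 : StrongDual ℂ E) M
  obtain ⟨ψ, -, hψ⟩ := hK.ultrafilter_le_nhds' (U.map φ) (by
    refine Ultrafilter.mem_map.2 (Filter.univ_mem' fun n ↦ ?_)
    simpa [φ] using hu n)
  refine ⟨(InnerProductSpace.toDual ℂ E).symm (WeakDual.toStrongDual ψ), fun h ↦ ?_⟩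
  have h1 : Tendsto (fun n ↦ φ n h) U (𝓝 (ψ h)) :=
    ((WeakDual.eval_continuous h).tendsto ψ).comp hψ
  have h2 := (Complex.continuous_conj.tendsto _).comp h1
  have e1 : ∀ n, (starRingEnd ℂ) (φ n h) = inner ℂ h (u n) := fun n ↦ by
    rw [← inner_conj_symm h (u n)]; rfl
  have e2 : (starRingEnd ℂ) (ψ h) =
      inner ℂ h ((InnerProductSpace.toDual ℂ E).symm (WeakDual.toStrongDual ψ)) := by
    rw [← inner_conj_symm, InnerProductSpace.toDual_symm_apply]; rfl
  rw [← e2]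
  exact h2.congr e1

lemma eq_integral_poissonKer {G : ℂ → ℂ} (hG : DifferentiableOn ℂ G (Metric.ball 0 1))
    {r s : ℝ} (hr0 : 0 ≤ r) (hr1 : r < 1) (hs0 : 0 ≤ s) (hs1 : s < 1) (x : ℝ) :
    G (circleMap 0 (r * s) x) =
      (2 * π)⁻¹ • ∫ θ, poissonKer s (x - θ) • G (circleMap 0 r θ) ∂periodMeasure := by
  have hmul : ∀ t θ, (r : ℂ) * circleMap 0 t θ = circleMap 0 (r * t) θ := fun t θ ↦ by
    simp [circleMap, mul_assoc]
  have hd : DiffContOnCl ℂ (fun z ↦ G (r * z)) (Metric.ball 0 1) := by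
    have hm : ∀ z ∈ Metric.closedBall (0 : ℂ) 1, (r : ℂ) * z ∈ Metric.ball (0 : ℂ) 1 :=
        fun z hz ↦ by
      rw [mem_closedBall_zero_iff] at hz
      rw [mem_ball_zero_iff, norm_mul, Complex.norm_real, Real.norm_of_nonneg hr0]
      nlinarith
    refine ⟨hG.comp (by fun_prop) fun z hz ↦ hm z (Metric.ball_subset_closedBall hz), ?_⟩
    exact (hG.continuousOn.comp (by fun_prop) hm).mono Metric.closure_ball_subset_closedBall
  have h := hd.circleAverage_re_herglotzRieszKernel_smul (circleMap_mem_ball hs0 hs1 x)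
  rw [circleAverage_eq_integral_periodMeasure, hmul] at h
  rw [← h]
  congr 2
  ext θ
  simp only [Pi.smul_apply', Function.comp_apply, herglotzRieszKernel_circleMap hs0 hs1, hmul,
    mul_one]
  simp

lemma tendsto_one_div_add_one_nhdsGT :
    Tendsto (fun n : ℕ ↦ 1 / ((n : ℝ) + 1)) atTop (𝓝[>] 0) :=
  tendsto_nhdsWithin_iff.2 ⟨tendsto_one_div_add_atTop_nhds_zero_nat,
    .of_forall fun _ ↦ mem_Ioi.2 Nat.one_div_pos_of_nat⟩

lemma one_sub_one_div_mem (n : ℕ) : 0 ≤ 1 - 1 / ((n : ℝ) + 1) ∧ 1 - 1 / ((n : ℝ) + 1) < 1 :=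
  ⟨sub_nonneg.2 <| by rw [div_le_one (by positivity)]; simp,
    sub_lt_self _ Nat.one_div_pos_of_nat⟩

/-- Fatou's theorem: bounded holomorphic functions on the disc have radial limits almost
everywhere. -/
lemma ae_exists_tendsto_radial {G : ℂ → ℂ} (hG : DifferentiableOn ℂ G (Metric.ball 0 1))
    {M : ℝ} (hM : ∀ z ∈ Metric.ball (0 : ℂ) 1, ‖G z‖ ≤ M) :
    ∀ᵐ x : ℝ, ∃ w, Tendsto (fun η : ℝ ↦ G (circleMap 0 (1 - η) x)) (𝓝[>] 0) (𝓝 w) := by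
  let r : ℕ → ℝ := fun n ↦ 1 - 1 / ((n : ℝ) + 1)
  have hr0 : ∀ n, 0 ≤ r n := fun n ↦ (one_sub_one_div_mem n).1
  have hr1 : ∀ n, r n < 1 := fun n ↦ (one_sub_one_div_mem n).2
  have hrt : Tendsto r atTop (𝓝 1) := by
    simpa [r] using (tendsto_one_div_add_atTop_nhds_zero_nat (𝕜 := ℝ)).const_sub 1
  have hc : ∀ n, Continuous fun θ ↦ G (circleMap 0 (r n) θ) := fun n ↦
    hG.continuousOn.comp_continuous (continuous_circleMap 0 _)
      fun x ↦ circleMap_mem_ball (hr0 n) (hr1 n) x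
  have hb : ∀ n θ, ‖G (circleMap 0 (r n) θ)‖ ≤ M := fun n θ ↦
    hM _ (circleMap_mem_ball (hr0 n) (hr1 n) θ)
  have hL : ∀ n, MemLp (fun θ ↦ G (circleMap 0 (r n) θ)) 2 periodMeasure := fun n ↦
    MemLp.of_bound (hc n).aestronglyMeasurable M (ae_of_all _ (hb n))
  have hM0 : 0 ≤ M := (norm_nonneg _).trans (hb 0 0)
  obtain ⟨g, hg⟩ := exists_tendsto_inner_of_norm_le (u := fun n ↦ (hL n).toLp) (fun n ↦
    Lp.norm_le_of_ae_bound hM0 (by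
      filter_upwards [(hL n).coeFn_toLp] with θ hθ
      rw [hθ]; exact hb n θ)) (hyperfilter ℕ)
  let g' : ℝ → ℂ := fun x ↦ g (circleMap 0 1 x).arg
  have hgg' : ∀ θ ∈ Ioc (-π) π, g' θ = g θ := fun θ hθ ↦ by simp only [g', arg_circleMap hθ]
  have hg'p : Function.Periodic g' (2 * π) := fun x ↦ by simp only [g', periodic_circleMap 0 1 x]
  have hgi : Integrable g periodMeasure := (Lp.memLp g).integrable (by norm_num)
  have hg'i : Integrable g' periodMeasure := hgi.congr <| by
    filter_upwards [ae_restrict_mem measurableSet_Ioc] with θ hθ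
    exact (hgg' θ hθ).symm
  have key : ∀ s x : ℝ, 0 ≤ s → s < 1 → G (circleMap 0 s x) =
      (2 * π)⁻¹ • ∫ θ, poissonKer s (x - θ) • g' θ ∂periodMeasure := fun s x h0 h1 ↦ by
    have hck : Continuous fun θ : ℝ ↦ ((poissonKer s (x - θ) : ℝ) : ℂ) :=
      Complex.continuous_ofReal.comp ((continuous_poissonKer h0 h1).comp (by fun_prop))
    have hk : MemLp (fun θ : ℝ ↦ ((poissonKer s (x - θ) : ℝ) : ℂ)) 2 periodMeasure :=
      (memLp_two_iff_integrable_sq_norm hck.aestronglyMeasurable).2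
        (hck.norm.pow 2).integrable_periodMeasure
    have hin : ∀ v : Lp ℂ 2 periodMeasure, inner ℂ hk.toLp v =
        ∫ θ, poissonKer s (x - θ) • v θ ∂periodMeasure := fun v ↦ by
      rw [L2.inner_def]
      refine integral_congr_ae ?_
      filter_upwards [hk.coeFn_toLp] with θ hθ
      rw [hθ]
      simp [mul_comm]
    have t1 := (hg hk.toLp).const_smul (2 * π)⁻¹
    have e1 : ∀ n, (2 * π)⁻¹ • inner ℂ hk.toLp (hL n).toLp = G (circleMap 0 (r n * s) x) :=
        fun n ↦ by
      rw [eq_integral_poissonKer hG (hr0 n) (hr1 n) h0 h1, hin]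
      congr 1
      refine integral_congr_ae ?_
      filter_upwards [(hL n).coeFn_toLp] with θ hθ
      rw [hθ]
    simp only [e1] at t1
    have e2 : inner ℂ hk.toLp g = ∫ θ, poissonKer s (x - θ) • g' θ ∂periodMeasure := by
      rw [hin]
      exact setIntegral_congr_fun measurableSet_Ioc fun θ hθ ↦ by simp only [hgg' θ hθ]
    rw [e2] at t1
    have t2 : Tendsto (fun n ↦ G (circleMap 0 (r n * s) x)) atTop (𝓝 (G (circleMap 0 s x))) := by
      have c1 : ContinuousAt G (circleMap 0 s x) :=
        (hG.differentiableAt (Metric.isOpen_ball.mem_nhds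
          (circleMap_mem_ball h0 h1 x))).continuousAt
      have c2 : Continuous fun t : ℝ ↦ circleMap 0 t x := by unfold circleMap; fun_prop
      have c3 : Tendsto (fun n ↦ r n * s) atTop (𝓝 s) := by simpa using hrt.mul_const s
      exact c1.tendsto.comp ((c2.tendsto s).comp c3)
    exact tendsto_nhds_unique (t2.mono_left (Nat.hyperfilter_le_atTop)) t1
  filter_upwards [ae_isLebesguePt (hg'p.intervalIntegrable_of_periodMeasure hg'i)] with x hx
  refine ⟨g' x, (hx.tendsto_poissonInt hg'p hg'i).congr' ?_⟩
  filter_upwards [Ioo_mem_nhdsGT (zero_lt_one : (0 : ℝ) < 1)] with η hη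
  exact (key _ x (by linarith [hη.2]) (by linarith [hη.1])).symm

lemma ae_exists_frequently_le {α : Type*} [MeasurableSpace α] {μ : Measure α} {V : ℕ → α → ℝ}
    (hV : ∀ n, Measurable (V n)) (hi : ∀ n, Integrable (V n) μ) (h0 : ∀ n x, 0 ≤ V n x) {K : ℝ}
    (hK : ∀ n, ∫ x, V n x ∂μ ≤ K) : ∀ᵐ x ∂μ, ∃ M : ℝ, ∃ᶠ n in atTop, V n x ≤ M := by
  have h1 : ∫⁻ x, liminf (fun n ↦ ENNReal.ofReal (V n x)) atTop ∂μ ≤ ENNReal.ofReal K := by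
    refine (lintegral_liminf_le fun n ↦ (hV n).ennreal_ofReal).trans ?_
    refine (liminf_le_liminf (v := fun _ ↦ ENNReal.ofReal K) (.of_forall fun n ↦ ?_)).trans
      (liminf_const _).le
    rw [← ofReal_integral_eq_lintegral_ofReal (hi n) (ae_of_all _ (h0 n))]
    exact ENNReal.ofReal_le_ofReal (hK n)
  have h2 := ae_lt_top (Measurable.liminf fun n ↦ (hV n).ennreal_ofReal)
    (h1.trans_lt ENNReal.ofReal_lt_top).ne
  filter_upwards [h2] with x hx
  obtain ⟨M, hM1, -⟩ := ENNReal.lt_iff_exists_nnreal_btwn.1 hx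
  refine ⟨M, (frequently_lt_of_liminf_lt (by isBoundedDefault) hM1).mono fun n hn ↦ ?_⟩
  rw [← ENNReal.ofReal_coe_nnreal] at hn
  exact ((ENNReal.ofReal_lt_ofReal_iff_of_nonneg (h0 n x)).1 hn).le

lemma integral_le_of_tendsto_ae {α : Type*} [MeasurableSpace α] {μ : Measure α} {V : ℕ → α → ℝ}
    {H : α → ℝ} (hV : ∀ n, Measurable (V n)) (hi : ∀ n, Integrable (V n) μ) (h0 : ∀ n x, 0 ≤ V n x)
    {K : ℝ} (hK : ∀ n, ∫ x, V n x ∂μ ≤ K)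
    (hH : ∀ᵐ x ∂μ, Tendsto (fun n ↦ V n x) atTop (𝓝 (H x))) : ∫ x, H x ∂μ ≤ K := by
  have hK0 : 0 ≤ K := (integral_nonneg (h0 0)).trans (hK 0)
  have hH0 : 0 ≤ᵐ[μ] H := by
    filter_upwards [hH] with x hx
    exact ge_of_tendsto' hx fun n ↦ h0 n x
  have hHm : AEStronglyMeasurable H μ :=
    aestronglyMeasurable_of_tendsto_ae atTop (fun n ↦ (hV n).aestronglyMeasurable) hH
  rw [integral_eq_lintegral_of_nonneg_ae hH0 hHm]
  refine ENNReal.toReal_le_of_le_ofReal hK0 ?_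
  calc ∫⁻ x, ENNReal.ofReal (H x) ∂μ
      = ∫⁻ x, liminf (fun n ↦ ENNReal.ofReal (V n x)) atTop ∂μ := by
        refine lintegral_congr_ae ?_
        filter_upwards [hH] with x hx
        exact ((ENNReal.continuous_ofReal.tendsto _).comp hx).liminf_eq.symm
    _ ≤ liminf (fun n ↦ ∫⁻ x, ENNReal.ofReal (V n x) ∂μ) atTop :=
        lintegral_liminf_le fun n ↦ (hV n).ennreal_ofReal
    _ ≤ liminf (fun _ : ℕ ↦ ENNReal.ofReal K) atTop :=
        liminf_le_liminf (.of_forall fun n ↦ by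
          rw [← ofReal_integral_eq_lintegral_ofReal (hi n) (ae_of_all _ (h0 n))]
          exact ENNReal.ofReal_le_ofReal (hK n))
    _ = ENNReal.ofReal K := liminf_const _

lemma ae_exists_tendsto_conjPoissonInt_of_nonneg {p : ℝ} (hp : 1 < p) {f : ℝ → ℝ}
    (hper : Function.Periodic f (2 * π)) (hf : Integrable f periodMeasure) (hf0 : ∀ x, 0 ≤ f x)
    (hfp : Integrable (fun x ↦ f x ^ p) periodMeasure) :
    ∀ᵐ x ∂periodMeasure, ∃ y,
      Tendsto (fun η ↦ conjPoissonInt f (1 - η) x) (𝓝[>] 0) (𝓝 y) := by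
  have hp0 : 0 < p := by linarith
  have hre : ∀ z ∈ Metric.ball (0 : ℂ) 1, 1 ≤ (1 + herglotzInt f z).re := fun z hz ↦ by
    have := re_herglotzInt_nonneg hf hf0 hz
    simpa using this
  have hne : ∀ z ∈ Metric.ball (0 : ℂ) 1, 1 + herglotzInt f z ≠ 0 := fun z hz h ↦ by
    have := hre z hz
    rw [h] at this; norm_num at this
  have hd : DifferentiableOn ℂ (fun z ↦ (1 + herglotzInt f z)⁻¹) (Metric.ball 0 1) :=
    ((differentiableOn_const _).add (differentiableOn_herglotzInt hf)).inv hne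
  have hb : ∀ z ∈ Metric.ball (0 : ℂ) 1, ‖(1 + herglotzInt f z)⁻¹‖ ≤ 1 := fun z hz ↦ by
    rw [norm_inv]
    exact inv_le_one_of_one_le₀ ((hre z hz).trans (Complex.re_le_norm _))
  obtain ⟨C, hC, hbd⟩ := integral_abs_conjPoissonInt_rpow_le hp
  have hfp' : Integrable (fun x ↦ |f x| ^ p) periodMeasure := by
    simpa only [abs_of_nonneg (hf0 _)] using hfp
  have hcV : ∀ n : ℕ, Continuous fun x ↦ |conjPoissonInt f (1 - 1 / ((n : ℝ) + 1)) x| ^ p :=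
    fun n ↦ (continuous_conjPoissonInt hf (one_sub_one_div_mem n).1
      (one_sub_one_div_mem n).2).abs.rpow_const fun _ ↦ Or.inr hp0.le
  have hfreq := ae_exists_frequently_le (μ := periodMeasure) (fun n ↦ (hcV n).measurable)
    (fun n ↦ (hcV n).integrable_periodMeasure)
    (fun n x ↦ Real.rpow_nonneg (abs_nonneg _) _)
    (fun n ↦ hbd f hf hfp' _ (one_sub_one_div_mem n).1 (one_sub_one_div_mem n).2)
  filter_upwards [hfreq, ae_restrict_of_ae (ae_exists_tendsto_radial hd hb),
    ae_restrict_of_ae (ae_isLebesguePt (hper.intervalIntegrable_of_periodMeasure hf))]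
    with x ⟨M, hM⟩ ⟨w, hw⟩ hx
  have hU : Tendsto (fun η ↦ poissonInt f (1 - η) x) (𝓝[>] 0) (𝓝 (f x)) :=
    hx.tendsto_poissonInt hper hf
  have hw0 : w ≠ 0 := by
    rintro rfl
    have h1 := hw.comp tendsto_one_div_add_one_nhdsGT
    have h2 := hU.comp tendsto_one_div_add_one_nhdsGT
    have h3 : Tendsto (fun n : ℕ ↦ ‖1 + herglotzInt f (circleMap 0 (1 - 1 / ((n : ℝ) + 1)) x)‖)
        atTop atTop := by
      have h4 : Tendsto (fun n : ℕ ↦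
          ‖(1 + herglotzInt f (circleMap 0 (1 - 1 / ((n : ℝ) + 1)) x))⁻¹‖) atTop (𝓝[>] 0) :=
        tendsto_nhdsWithin_iff.2 ⟨by simpa using h1.norm, .of_forall fun n ↦ norm_pos_iff.2 <|
          inv_ne_zero <| hne _ <| circleMap_mem_ball (one_sub_one_div_mem n).1
            (one_sub_one_div_mem n).2 x⟩
      have h5 := h4.inv_tendsto_nhdsGT_zero
      refine h5.congr fun n ↦ ?_
      simp
    have h6 : ∀ᶠ n : ℕ in atTop, poissonInt f (1 - 1 / ((n : ℝ) + 1)) x < f x + 1 :=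
      h2.eventually_lt_const (lt_add_one _)
    have h7 := h3.eventually_gt_atTop (1 + (f x + 1) + |M| ^ p⁻¹)
    obtain ⟨n, hn, hn6, hn7⟩ := (hM.and_eventually (h6.and h7)).exists
    have hr := one_sub_one_div_mem n
    rw [herglotzInt_circleMap hf hr.1 hr.2] at hn7
    have hn8 : |conjPoissonInt f (1 - 1 / ((n : ℝ) + 1)) x| ≤ |M| ^ p⁻¹ := by
      rw [Real.le_rpow_inv_iff_of_pos (abs_nonneg _) (abs_nonneg _) hp0]
      exact hn.trans (le_abs_self M)
    have hU0 := poissonInt_nonneg hf0 hr.1 hr.2 x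
    have hn9 := (norm_add_le (1 : ℂ) _).trans (add_le_add_right (norm_add_le
      (poissonInt f (1 - 1 / ((n : ℝ) + 1)) x : ℂ)
      (conjPoissonInt f (1 - 1 / ((n : ℝ) + 1)) x * Complex.I)) _)
    rw [norm_mul, Complex.norm_I, Complex.norm_real, Complex.norm_real, norm_one,
      Real.norm_of_nonneg hU0, Real.norm_eq_abs] at hn9
    linarith
  refine ⟨(w⁻¹).im, ?_⟩
  refine ((Complex.continuous_im.tendsto _).comp (hw.inv₀ hw0)).congr' ?_
  filter_upwards [Ioo_mem_nhdsGT (zero_lt_one : (0 : ℝ) < 1)] with η hη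
  have h0 : 0 ≤ 1 - η := by linarith [hη.2]
  have h1 : 1 - η < 1 := by linarith [hη.1]
  simp [conjPoissonInt_eq_im hf h0 h1]

lemma ae_exists_tendsto_conjPoissonInt {p : ℝ} (hp : 1 < p) {f : ℝ → ℝ}
    (hper : Function.Periodic f (2 * π)) (hf : Integrable f periodMeasure)
    (hfp : Integrable (fun x ↦ |f x| ^ p) periodMeasure) :
    ∀ᵐ x ∂periodMeasure, ∃ y,
      Tendsto (fun η ↦ conjPoissonInt f (1 - η) x) (𝓝[>] 0) (𝓝 y) := by
  have hp0 : 0 ≤ p := by linarith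
  have hi1 := integrable_rpow_of_abs_le hp0 hfp hf.pos_part.1 (fun x ↦ le_max_right _ _)
    fun x ↦ max_le (le_abs_self _) (abs_nonneg _)
  have hi2 := integrable_rpow_of_abs_le hp0 hfp hf.neg_part.1 (fun x ↦ le_max_right _ _)
    fun x ↦ max_le (neg_le_abs _) (abs_nonneg _)
  filter_upwards [ae_exists_tendsto_conjPoissonInt_of_nonneg hp
      (fun x ↦ by simp only [hper x]) hf.pos_part (fun x ↦ le_max_right _ _) hi1,
    ae_exists_tendsto_conjPoissonInt_of_nonneg hp
      (fun x ↦ by simp only [hper x]) hf.neg_part (fun x ↦ le_max_right _ _) hi2]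
    with x ⟨a, ha⟩ ⟨b, hb⟩
  refine ⟨a - b, (ha.sub hb).congr' ?_⟩
  filter_upwards [Ioo_mem_nhdsGT (zero_lt_one : (0 : ℝ) < 1)] with η hη
  exact (conjPoissonInt_posPart_sub_negPart hf (by linarith [hη.2]) (by linarith [hη.1]) x).symm

lemma Function.Periodic.aemeasurable_of_periodMeasure {g : ℝ → ℝ}
    (hp : Function.Periodic g (2 * π)) (hg : AEMeasurable g periodMeasure) :
    AEMeasurable g volume := by
  rw [← Measure.restrict_univ (μ := volume), ← iUnion_Ioc_add_zsmul Real.two_pi_pos (-π),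
    aemeasurable_iUnion_iff]
  intro k
  have hm : MeasurePreserving (fun t : ℝ ↦ t - k • (2 * π)) volume volume :=
    measurePreserving_sub_right volume _
  have h := hg.comp_quasiMeasurePreserving
    (hm.restrict_preimage (s := Ioc (-π) π) measurableSet_Ioc).quasiMeasurePreserving
  have e1 : (fun t : ℝ ↦ t - k • (2 * π)) ⁻¹' Ioc (-π) π =
      Ioc (-π + k • (2 * π)) (-π + (k + 1) • (2 * π)) := by
    rw [preimage_sub_const_Ioc]
    congr 1
    rw [add_smul, one_smul]; ring
  rw [e1] at h
  refine h.congr (ae_of_all _ fun t ↦ ?_)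
  exact hp.sub_zsmul_eq k

lemma eventually_pvH_eq_zero {f : ℝ → ℝ} (hp : Function.Periodic f (2 * π))
    (hf : ¬ AEMeasurable f periodMeasure) (x : ℝ) : ∀ᶠ η in 𝓝[>] 0, pvH f x η = 0 := by
  by_contra hcon
  refine hf ?_
  have hfr : ∃ᶠ η in 𝓝[>] (0 : ℝ), pvH f x η ≠ 0 := not_eventually.1 hcon
  have hex : ∀ n : ℕ, ∃ η : ℝ, η < 1 / ((n : ℝ) + 1) ∧ pvH f x η ≠ 0 := fun n ↦ by
    obtain ⟨η, h1, h2⟩ := (hfr.and_eventually (Ioo_mem_nhdsGT Nat.one_div_pos_of_nat)).exists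
    exact ⟨η, h2.2, h1⟩
  choose η hη hne using hex
  have hm : ∀ n, AEMeasurable (fun t ↦ f (x - t) * (Real.cos (t / 2) / Real.sin (t / 2)))
      (volume.restrict {t : ℝ | η n ≤ |t| ∧ |t| ≤ π}) := fun n ↦ by
    by_contra hnm
    refine hne n ?_
    rw [pvH, integral_non_aestronglyMeasurable (fun h ↦ hnm h.aemeasurable), mul_zero]
  have hU : AEMeasurable (fun t ↦ f (x - t) * (Real.cos (t / 2) / Real.sin (t / 2)))
      periodMeasure := by
    refine (aemeasurable_iUnion_iff.2 hm).mono_measure (Measure.restrict_mono' ?_ le_rfl)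
    filter_upwards [Measure.ae_ne volume (0 : ℝ)] with t h0 ht
    obtain ⟨n, hn⟩ := exists_nat_one_div_lt (abs_pos.2 h0)
    exact mem_iUnion.2 ⟨n, ((hη n).trans hn).le, abs_le.2 ⟨ht.1.le, ht.2⟩⟩
  have hg : AEMeasurable (fun t ↦ f (x - t)) periodMeasure := by
    have hc : Measurable fun t : ℝ ↦ (Real.cos (t / 2) / Real.sin (t / 2))⁻¹ := by fun_prop
    refine (hU.mul hc.aemeasurable).congr ?_
    filter_upwards [ae_restrict_mem measurableSet_Ioc,
      ae_restrict_of_ae (Measure.ae_ne volume (0 : ℝ)), ae_restrict_of_ae (Measure.ae_ne volume π)]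
      with t ht h0 hpi
    have hs : Real.sin (t / 2) ≠ 0 := fun h ↦ h0 <| by
      have := (Real.sin_eq_zero_iff_of_lt_of_lt (by linarith [ht.1, Real.pi_pos])
        (by linarith [ht.2, Real.pi_pos])).1 h
      linarith
    have hcs : Real.cos (t / 2) ≠ 0 := (Real.cos_pos_of_mem_Ioo
      ⟨by linarith [ht.1], by linarith [lt_of_le_of_ne ht.2 hpi]⟩).ne'
    simp only [Pi.mul_apply]
    rw [mul_assoc, mul_inv_cancel₀ (div_ne_zero hcs hs), mul_one]
  have hgp : Function.Periodic (fun t ↦ f (x - t)) (2 * π) := fun t ↦ by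
    simp only [← sub_sub, hp.sub_eq]
  have := (hgp.aemeasurable_of_periodMeasure hg).comp_quasiMeasurePreserving
    (Measure.measurePreserving_sub_left volume x).quasiMeasurePreserving
  refine (this.congr (ae_of_all _ fun t ↦ ?_)).restrict
  simp

/-- Strong `L^p` boundedness (`p > 1`) of the periodic Hilbert transform: the
principal-value limit exists a.e. on `(−π,π)` and satisfies
`‖H{f}‖_p ≤ λ_p ‖f‖_p`. -/
theorem hilbert_transform_strong_type
    (p : ℝ) (hp : 1 < p) :
    ∃ lam : ℝ, 0 < lam ∧
      ∀ f : ℝ → ℝ, Function.Periodic f (2 * π) →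
        Integrable (fun θ => |f θ| ^ p) (volume.restrict (Ioo (-π) π)) →
        ∃ H : ℝ → ℝ,
          (∀ᵐ x ∂(volume.restrict (Ioo (-π) π)),
            Tendsto (fun η => pvH f x η) (nhdsWithin 0 (Ioi 0)) (nhds (H x))) ∧
          (∫ θ in (-π)..π, |H θ| ^ p) ^ (1 / p) ≤
            lam * (∫ θ in (-π)..π, |f θ| ^ p) ^ (1 / p) := by
  have hp0 : 0 < p := by linarith
  obtain ⟨C, hC, hbd⟩ := integral_abs_conjPoissonInt_rpow_le hp
  refine ⟨C ^ (1 / p), by positivity, fun f hper hfp ↦ ?_⟩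
  rw [Measure.restrict_congr_set Ioo_ae_eq_Ioc] at hfp ⊢
  simp only [← integral_periodMeasure]
  have hI0 : 0 ≤ ∫ θ, |f θ| ^ p ∂periodMeasure :=
    integral_nonneg fun _ ↦ Real.rpow_nonneg (abs_nonneg _) _
  by_cases hm : AEMeasurable f periodMeasure
  · have hf : Integrable f periodMeasure := by
      refine ((integrable_const (1 : ℝ)).add hfp).mono' hm.aestronglyMeasurable
        (ae_of_all _ fun x ↦ ?_)
      rw [Real.norm_eq_abs, Pi.add_apply]
      rcases le_total |f x| 1 with h | h
      · linarith [Real.rpow_nonneg (abs_nonneg (f x)) p]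
      · linarith [Real.self_le_rpow_of_one_le h hp.le]
    have hlim : ∀ᵐ x ∂periodMeasure, ∃ y,
        Tendsto (fun η ↦ conjPoissonInt f (1 - η) x) (𝓝[>] 0) (𝓝 y) ∧
        Tendsto (fun η ↦ pvH f x η) (𝓝[>] 0) (𝓝 y) := by
      filter_upwards [ae_exists_tendsto_conjPoissonInt hp hper hf hfp,
        ae_restrict_of_ae (ae_isLebesguePt (hper.intervalIntegrable_of_periodMeasure hf))]
        with x ⟨y, hy⟩ hx
      exact ⟨y, hy, by simpa using hy.sub (hx.tendsto_conjPoissonInt_sub_pvH hper hf)⟩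
    let H : ℝ → ℝ := fun x ↦ limUnder (𝓝[>] 0) (pvH f x)
    have hH : ∀ᵐ x ∂periodMeasure,
        Tendsto (fun η ↦ conjPoissonInt f (1 - η) x) (𝓝[>] 0) (𝓝 (H x)) ∧
        Tendsto (fun η ↦ pvH f x η) (𝓝[>] 0) (𝓝 (H x)) := by
      filter_upwards [hlim] with x ⟨y, hy1, hy2⟩
      rw [show H x = y from hy2.limUnder_eq]
      exact ⟨hy1, hy2⟩
    refine ⟨H, hH.mono fun x hx ↦ hx.2, ?_⟩
    have hcV : ∀ n : ℕ, Continuous fun x ↦ |conjPoissonInt f (1 - 1 / ((n : ℝ) + 1)) x| ^ p :=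
      fun n ↦ (continuous_conjPoissonInt hf (one_sub_one_div_mem n).1
        (one_sub_one_div_mem n).2).abs.rpow_const fun _ ↦ Or.inr hp0.le
    have hle : ∫ x, |H x| ^ p ∂periodMeasure ≤ C * ∫ x, |f x| ^ p ∂periodMeasure := by
      refine integral_le_of_tendsto_ae (fun n ↦ (hcV n).measurable)
        (fun n ↦ (hcV n).integrable_periodMeasure)
        (fun n x ↦ Real.rpow_nonneg (abs_nonneg _) _)
        (fun n ↦ hbd f hf hfp _ (one_sub_one_div_mem n).1 (one_sub_one_div_mem n).2) ?_
      filter_upwards [hH] with x hx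
      exact ((hx.1.comp tendsto_one_div_add_one_nhdsGT).abs).rpow_const (Or.inr hp0.le)
    rw [← Real.mul_rpow hC.le hI0]
    exact Real.rpow_le_rpow (integral_nonneg fun _ ↦ Real.rpow_nonneg (abs_nonneg _) _) hle
      (by positivity)
  · refine ⟨0, ae_of_all _ fun x ↦ ?_, ?_⟩
    · exact tendsto_const_nhds.congr' ((eventually_pvH_eq_zero hper hm x).mono fun η h ↦ h.symm)
    · simp only [Pi.zero_apply, abs_zero, Real.zero_rpow hp0.ne', integral_zero]
      rw [Real.zero_rpow (by positivity)]
      positivity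
end

section
/- For every x ∈ ℝ, the principal-value limit lim_{η→0⁺} (1/(2π)) ∫_{η ≤ |t| ≤ π} cos(x−t) cot(t/2) dt exists and equals sin(x); that is, the periodic Hilbert transform of cosine is sine, and consequently for every n ≥ 1 the periodic Hilbert transform of θ ↦ cos(nθ) is θ ↦ sin(nθ). -/
open Filter Set
open scoped Real

/-- For `0 < η ≤ π`, the truncated integral folds onto `[η, π]`. -/
lemma pvH_eq_integral {f : ℝ → ℝ} (hf : Continuous f) (x : ℝ) {η : ℝ} (h₀ : 0 < η) (hπ : η ≤ π) :
    pvH f x η = (1 / (2 * π)) *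
      ∫ t in η..π, (f (x - t) - f (x + t)) * (Real.cos (t / 2) / Real.sin (t / 2)) := by
  have hset : {t : ℝ | η ≤ |t| ∧ |t| ≤ π} = Icc η π ∪ Icc (-π) (-η) := by
    ext t
    simp only [mem_ofPred_eq, mem_union, mem_Icc]
    rcases abs_cases t with ⟨h, h'⟩ | ⟨h, h'⟩ <;> rw [h] <;> grind
  have hdisj : Disjoint (Icc η π) (Icc (-π) (-η)) := by
    rw [Set.disjoint_left]
    rintro t ⟨h₁, -⟩ ⟨-, h₂⟩
    linarith
  have hsin : ∀ t ∈ Icc η π, Real.sin (t / 2) ≠ 0 := fun t ht =>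
    (Real.sin_pos_of_pos_of_lt_pi (by linarith [ht.1]) (by linarith [ht.2, Real.pi_pos])).ne'
  have hcont₁ : ContinuousOn
      (fun t => f (x - t) * (Real.cos (t / 2) / Real.sin (t / 2))) (Icc η π) :=
    ContinuousOn.mul (by fun_prop) (ContinuousOn.div (by fun_prop) (by fun_prop) hsin)
  have hcont₂ : ContinuousOn
      (fun t => f (x - t) * (Real.cos (t / 2) / Real.sin (t / 2))) (Icc (-π) (-η)) := by
    refine ContinuousOn.mul (by fun_prop) (ContinuousOn.div (by fun_prop) (by fun_prop) ?_)
    intro t ht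
    have := hsin (-t) ⟨by linarith [ht.2], by linarith [ht.1]⟩
    rwa [neg_div, Real.sin_neg, neg_ne_zero] at this
  have hcont₃ : ContinuousOn
      (fun t => f (x + t) * (Real.cos (t / 2) / Real.sin (t / 2))) (Icc η π) :=
    ContinuousOn.mul (by fun_prop) (ContinuousOn.div (by fun_prop) (by fun_prop) hsin)
  have hneg : ∫ t in (-π)..(-η), f (x - t) * (Real.cos (t / 2) / Real.sin (t / 2)) =
      -∫ t in η..π, f (x + t) * (Real.cos (t / 2) / Real.sin (t / 2)) := by
    rw [← intervalIntegral.integral_comp_neg, ← intervalIntegral.integral_neg]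
    refine intervalIntegral.integral_congr fun t _ => ?_
    simp only [neg_div, Real.cos_neg, Real.sin_neg, sub_neg_eq_add, div_neg, mul_neg]
  rw [pvH, hset, MeasureTheory.setIntegral_union hdisj measurableSet_Icc
    hcont₁.integrableOn_Icc hcont₂.integrableOn_Icc,
    MeasureTheory.integral_Icc_eq_integral_Ioc, MeasureTheory.integral_Icc_eq_integral_Ioc,
    ← intervalIntegral.integral_of_le hπ, ← intervalIntegral.integral_of_le (by linarith), hneg,
    ← sub_eq_add_neg, ← intervalIntegral.integral_sub
      (hcont₁.intervalIntegrable_of_Icc hπ) (hcont₃.intervalIntegrable_of_Icc hπ)]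
  simp only [sub_mul]

/-- The conjugate-kernel identity expressing `sin (n t) cot (t / 2)` as a cosine sum. -/
lemma sin_nat_mul_mul_cos_half (n : ℕ) (t : ℝ) :
    Real.sin (n * t) * Real.cos (t / 2) =
      (∑ k ∈ Finset.range n, (Real.cos (k * t) + Real.cos ((k + 1 : ℕ) * t))) *
        Real.sin (t / 2) := by
  induction n with
  | zero => simp
  | succ n ih =>
    rw [Finset.sum_range_succ, add_mul, ← ih]
    have hc : Real.cos t = 2 * Real.cos (t / 2) ^ 2 - 1 := by
      rw [← Real.cos_two_mul]; congr 1; ring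
    have hs : Real.sin t = 2 * Real.sin (t / 2) * Real.cos (t / 2) := by
      rw [← Real.sin_two_mul]; congr 1; ring
    rw [Nat.cast_succ, add_mul, one_mul, Real.sin_add, Real.cos_add, hc, hs]
    linear_combination (2 * Real.sin (n * t) * Real.cos (t / 2)) *
      Real.sin_sq_add_cos_sq (t / 2)

lemma integral_cos_nat_mul {n : ℕ} (hn : n ≠ 0) : ∫ t in (0 : ℝ)..π, Real.cos (n * t) = 0 := by
  rw [intervalIntegral.integral_comp_mul_left _ (Nat.cast_ne_zero.mpr hn)]
  simp [Real.sin_nat_mul_pi]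

lemma integral_sum_cos_add_cos {n : ℕ} (hn : 1 ≤ n) :
    ∫ t in (0 : ℝ)..π, ∑ k ∈ Finset.range n,
      (Real.cos (k * t) + Real.cos ((k + 1 : ℕ) * t)) = π := by
  have hint (k : ℕ) : IntervalIntegrable (fun t : ℝ => Real.cos (k * t))
      MeasureTheory.volume 0 π := (by fun_prop : Continuous _).intervalIntegrable _ _
  rw [intervalIntegral.integral_finsetSum fun k _ => (hint k).add (hint (k + 1)),
    Finset.sum_eq_single_of_mem 0 (Finset.mem_range.mpr hn)]
  · rw [intervalIntegral.integral_add (hint 0) (hint (0 + 1)),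
      integral_cos_nat_mul (Nat.succ_ne_zero 0)]
    simp
  · intro k _ hk
    rw [intervalIntegral.integral_add (hint k) (hint (k + 1)),
      integral_cos_nat_mul hk, integral_cos_nat_mul k.succ_ne_zero, add_zero]

lemma tendsto_pvH_cos_nat_mul {n : ℕ} (hn : 1 ≤ n) (x : ℝ) :
    Tendsto (fun η => pvH (fun θ => Real.cos (n * θ)) x η) (nhdsWithin 0 (Ioi 0))
      (nhds (Real.sin (n * x))) := by
  set D : ℝ → ℝ := fun t =>
    ∑ k ∈ Finset.range n, (Real.cos (k * t) + Real.cos ((k + 1 : ℕ) * t))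
  have hDc : Continuous D := by fun_prop
  have hlim : Tendsto (fun η => 1 / π * Real.sin (n * x) * ∫ t in η..π, D t)
      (nhdsWithin 0 (Ioi 0)) (nhds (Real.sin (n * x))) := by
    have hc : Continuous fun η => ∫ t in η..π, D t := by
      simp_rw [fun η => intervalIntegral.integral_symm (f := D) (μ := MeasureTheory.volume) π η]
      exact (intervalIntegral.continuous_primitive
        (fun a b => hDc.intervalIntegrable a b) π).neg
    have h := ((hc.tendsto' 0 π (integral_sum_cos_add_cos hn)).const_mul
      (1 / π * Real.sin (n * x))).mono_left (nhdsWithin_le_nhds (s := Ioi 0))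
    rwa [show 1 / π * Real.sin (n * x) * π = Real.sin (n * x) by
      field_simp [Real.pi_ne_zero]] at h
  refine hlim.congr' ?_
  filter_upwards [Ioc_mem_nhdsGT Real.pi_pos] with η hη
  have hfold : ∫ t in η..π, (Real.cos (n * (x - t)) - Real.cos (n * (x + t))) *
      (Real.cos (t / 2) / Real.sin (t / 2)) = ∫ t in η..π, 2 * Real.sin (n * x) * D t := by
    refine intervalIntegral.integral_congr fun t ht => ?_
    rw [uIcc_of_le hη.2] at ht
    have hs : Real.sin (t / 2) ≠ 0 :=
      (Real.sin_pos_of_pos_of_lt_pi (by linarith [ht.1, hη.1])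
        (by linarith [ht.2, Real.pi_pos])).ne'
    have hk : Real.sin (n * t) * Real.cos (t / 2) = D t * Real.sin (t / 2) :=
      sin_nat_mul_mul_cos_half n t
    simp only [mul_sub, mul_add, Real.cos_sub, Real.cos_add]
    field_simp
    linear_combination (2 * Real.sin (n * x)) * hk
  rw [pvH_eq_integral (by fun_prop) x hη.1 hη.2, hfold, intervalIntegral.integral_const_mul]
  field_simp

/-- The periodic Hilbert transform of cosine is sine, and more generally the periodic
Hilbert transform of `θ ↦ cos(nθ)` is `θ ↦ sin(nθ)` for every `n ≥ 1`. -/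
theorem hilbert_transform_cos_eq_sin :
    (∀ x : ℝ,
      Tendsto (fun η => pvH Real.cos x η) (nhdsWithin 0 (Ioi 0)) (nhds (Real.sin x))) ∧
    (∀ n : ℕ, 1 ≤ n → ∀ x : ℝ,
      Tendsto (fun η => pvH (fun θ => Real.cos (n * θ)) x η) (nhdsWithin 0 (Ioi 0))
        (nhds (Real.sin (n * x)))) := by
  refine ⟨fun x => ?_, fun n hn x => tendsto_pvH_cos_nat_mul hn x⟩
  simpa using tendsto_pvH_cos_nat_mul le_rfl x
end

section
/- Fix α > 0 and define φ : (−π,π) → ℝ by φ(θ) = −(1 − 2|θ|/π)^{1/(α+1)} for |θ| < π/2 and φ(θ) = 2^{1/(α+1)} (|θ|/π − 1/2)^{1/(α+1)} for π/2 < |θ| < π (this is the function φ(θ) = q(|θ|/π) associated with the probability density ρ(x) = ((α+1)/2)|x|^α on (−1,1)). Then the function t ↦ φ(t) cot((π/2 − t)/2) is absolutely integrable on (−π,π). -/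
open MeasureTheory Filter Set
open scoped Real

/-- The function `φ(θ) = q(|θ|/π)` associated with the density
`ρ(x) = ((α+1)/2)|x|^α` on `(−1,1)`, given explicitly. -/
noncomputable def phiAlpha (α : ℝ) (θ : ℝ) : ℝ :=
  if |θ| < π / 2 then -((1 - 2 * |θ| / π) ^ ((1 : ℝ) / (α + 1)))
  else (2 : ℝ) ^ ((1 : ℝ) / (α + 1)) * (|θ| / π - 1 / 2) ^ ((1 : ℝ) / (α + 1))

theorem intervalIntegrable_abs_sub_rpow {r : ℝ} (hr : -1 < r) (a b c : ℝ) :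
    IntervalIntegrable (fun t : ℝ => |t - c| ^ r) volume a b := by
  have h : IntervalIntegrable (fun x : ℝ => |x| ^ r) volume (a - c) (b - c) := by
    have h := (intervalIntegral.intervalIntegrable_cpow' (a := a - c) (b := b - c)
      (r := (r : ℂ)) (by simpa using hr)).norm
    simpa [Complex.norm_cpow_real] using h
  simpa using h.comp_sub_right c

theorem abs_div_two_pi_le_abs_sin {x : ℝ} (h₁ : -(π / 2) ≤ x) (h₂ : x ≤ 3 * π / 4) :
    |x| / (2 * π) ≤ |Real.sin x| := by
  have hπ := Real.pi_pos
  rcases le_or_gt x (π / 2) with h | h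
  · refine le_trans ?_ (Real.mul_abs_le_abs_sin (abs_le.2 ⟨h₁, h⟩))
    rw [div_mul_eq_mul_div, div_le_div_iff₀ (by positivity) hπ]
    nlinarith [mul_nonneg (abs_nonneg x) hπ.le]
  · have hs := Real.mul_le_sin (x := π - x) (by linarith) (by linarith)
    rw [Real.sin_pi_sub] at hs
    refine le_trans ?_ (hs.trans (le_abs_self _))
    rw [abs_of_pos (by linarith), div_mul_eq_mul_div, div_le_div_iff₀ (by positivity) hπ]
    nlinarith

theorem measurable_phiAlpha (α : ℝ) : Measurable (phiAlpha α) := by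
  unfold phiAlpha
  exact Measurable.ite (measurableSet_lt (by fun_prop) (by fun_prop))
    (by fun_prop) (by fun_prop)

theorem abs_phiAlpha_eq (α t : ℝ) :
    |phiAlpha α t| = |2 * |t| / π - 1| ^ ((1 : ℝ) / (α + 1)) := by
  have hπ := Real.pi_pos
  unfold phiAlpha
  split_ifs with h
  · have h' : 2 * |t| / π < 1 := by rw [div_lt_one hπ]; linarith
    rw [abs_neg, abs_of_nonneg (Real.rpow_nonneg (by linarith) _), abs_sub_comm,
      abs_of_nonneg (sub_nonneg.2 h'.le)]
  · have h' : 1 / 2 ≤ |t| / π := by rw [le_div_iff₀ hπ]; linarith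
    rw [← Real.mul_rpow (by norm_num) (by linarith),
      abs_of_nonneg (Real.rpow_nonneg (by linarith) _),
      show 2 * (|t| / π - 1 / 2) = 2 * |t| / π - 1 by ring,
      abs_of_nonneg (a := 2 * |t| / π - 1) (by rw [mul_div_assoc]; linarith)]

theorem abs_phiAlpha_le {α : ℝ} (hα : 0 < α) (t : ℝ) :
    |phiAlpha α t| ≤ |t - π / 2| ^ ((1 : ℝ) / (α + 1)) := by
  have hπ := Real.pi_gt_three
  rw [abs_phiAlpha_eq]
  refine Real.rpow_le_rpow (abs_nonneg _) ?_ (by positivity)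
  have h : |(|t| - π / 2)| ≤ |t - π / 2| := by
    simpa only [abs_of_pos Real.pi_div_two_pos] using abs_abs_sub_abs_le_abs_sub t (π / 2)
  rw [show 2 * |t| / π - 1 = 2 / π * (|t| - π / 2) by field_simp, abs_mul,
    abs_of_pos (by positivity : 0 < 2 / π)]
  have h2 : 2 / π ≤ 1 := by rw [div_le_one Real.pi_pos]; linarith
  exact (mul_le_of_le_one_left (abs_nonneg _) h2).trans h

/-- The function `t ↦ φ(t) cot((π/2 − t)/2)` is absolutely integrable on `(−π, π)`,
even though `φ` has a vertical tangent at `±π/2`. -/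
theorem phiAlpha_mul_cot_integrable (α : ℝ) (hα : 0 < α) :
    IntegrableOn
      (fun t : ℝ =>
        phiAlpha α t * (Real.cos ((π / 2 - t) / 2) / Real.sin ((π / 2 - t) / 2)))
      (Ioo (-π) π) := by
  have hp : -1 < (1 : ℝ) / (α + 1) - 1 := by
    have : 0 < (1 : ℝ) / (α + 1) := by positivity
    linarith
  have hπ := Real.pi_pos
  have hg : IntegrableOn (fun t : ℝ => 4 * π * |t - π / 2| ^ ((1 : ℝ) / (α + 1) - 1))
      (Ioo (-π) π) :=
    (((intervalIntegrable_iff_integrableOn_Ioo_of_le (by linarith)).1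
      (intervalIntegrable_abs_sub_rpow hp (-π) π (π / 2))).const_mul _)
  refine Integrable.mono' hg ?_ ?_
  · exact ((measurable_phiAlpha α).mul (by fun_prop)).aestronglyMeasurable
  · filter_upwards [ae_restrict_mem measurableSet_Ioo] with t ⟨ht₁, ht₂⟩
    rcases eq_or_ne t (π / 2) with rfl | hne
    · simp only [sub_self, zero_div, Real.sin_zero, div_zero, mul_zero, norm_zero]
      positivity
    have hd : 0 < |t - π / 2| := abs_pos.2 (sub_ne_zero.2 hne)
    have hs := abs_div_two_pi_le_abs_sin (x := (π / 2 - t) / 2) (by linarith) (by linarith)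
    rw [abs_div, abs_sub_comm, abs_two, div_div] at hs
    rw [Real.norm_eq_abs, abs_mul, abs_div, Real.rpow_sub_one hd.ne']
    calc _ ≤ |t - π / 2| ^ ((1 : ℝ) / (α + 1)) * (1 / (|t - π / 2| / (2 * (2 * π)))) := by
          gcongr
          · exact abs_phiAlpha_le hα t
          · exact Real.abs_cos_le_one _
      _ = _ := by field_simp; ring
end

section
/- Fix α > 0 and let μ be the probability measure on ℝ with density ρ(x) = ((α+1)/2)|x|^α χ_{(−1,1)}(x), quantile function q, and φ(θ) = q(|θ|/π) extended 2π-periodically. Then for every θ ∈ (−π,π), including θ = ±π/2 where φ has infinite derivative, the principal-value limit defining the periodic Hilbert transform H{φ}(θ) exists and is finite. -/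
open MeasureTheory Filter Set
open scoped Real

/-- The odd power function `s ↦ sign(s)|s|^p`, written through positive and negative parts. -/
noncomputable def signedPow (p s : ℝ) : ℝ := max s 0 ^ p - max (-s) 0 ^ p

lemma signedPow_of_nonneg {p s : ℝ} (hp : 0 < p) (hs : 0 ≤ s) : signedPow p s = s ^ p := by
  simp [signedPow, hs, Real.zero_rpow hp.ne']

lemma signedPow_neg (p s : ℝ) : signedPow p (-s) = -signedPow p s := by
  simp [signedPow]

lemma continuous_signedPow {p : ℝ} (hp : 0 < p) : Continuous (signedPow p) := by
  unfold signedPow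
  exact ((continuous_id.max continuous_const).rpow_const fun _ => Or.inr hp.le).sub
    ((continuous_neg.max continuous_const).rpow_const fun _ => Or.inr hp.le)

lemma strictMono_signedPow {p : ℝ} (hp : 0 < p) : StrictMono (signedPow p) := by
  refine strictMono_of_odd_strictMonoOn_nonneg (signedPow_neg p) fun a ha b hb hab => ?_
  rw [signedPow_of_nonneg hp ha, signedPow_of_nonneg hp hb]
  exact Real.rpow_lt_rpow ha hab hp

lemma signedPow_signedPow_inv {p : ℝ} (hp : 0 < p) (s : ℝ) :
    signedPow p (signedPow p⁻¹ s) = s := by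
  have key : ∀ t : ℝ, 0 ≤ t → signedPow p (signedPow p⁻¹ t) = t := fun t ht => by
    rw [signedPow_of_nonneg (inv_pos.2 hp) ht,
      signedPow_of_nonneg hp (Real.rpow_nonneg ht _), Real.rpow_inv_rpow ht hp.ne']
  rcases le_total 0 s with hs | hs
  · exact key s hs
  · have h := key (-s) (by linarith)
    rw [signedPow_neg, signedPow_neg] at h
    linarith

lemma signedPow_one {p : ℝ} (hp : 0 < p) : signedPow p 1 = 1 := by
  rw [signedPow_of_nonneg hp zero_le_one, Real.one_rpow]

lemma abs_rpow_sub_rpow_le {b x y : ℝ} (hb : 0 ≤ b) (hb1 : b ≤ 1) (hx : 0 ≤ x) (hy : 0 ≤ y) :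
    |x ^ b - y ^ b| ≤ |x - y| ^ b := by
  wlog h : y ≤ x generalizing x y
  · rw [abs_sub_comm, abs_sub_comm x]
    exact this hy hx (le_of_not_ge h)
  have h1 := Real.rpow_add_le_add_rpow (sub_nonneg.2 h) hy hb hb1
  rw [sub_add_cancel] at h1
  rw [abs_of_nonneg (sub_nonneg.2 h),
    abs_of_nonneg (sub_nonneg.2 (Real.rpow_le_rpow hy h hb))]
  linarith

lemma abs_signedPow_sub_le {b : ℝ} (hb : 0 ≤ b) (hb1 : b ≤ 1) (x y : ℝ) :
    |signedPow b x - signedPow b y| ≤ 2 * |x - y| ^ b := by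
  have h1 := (abs_rpow_sub_rpow_le hb hb1 (le_max_right x 0) (le_max_right y 0)).trans
    (Real.rpow_le_rpow (abs_nonneg _) (abs_max_sub_max_le_abs x y 0) hb)
  have h2 := (abs_rpow_sub_rpow_le hb hb1 (le_max_right (-x) 0) (le_max_right (-y) 0)).trans
    (Real.rpow_le_rpow (abs_nonneg _) (abs_max_sub_max_le_abs (-x) (-y) 0) hb)
  rw [show -x - -y = -(x - y) by ring, abs_neg] at h2
  unfold signedPow
  rw [abs_le] at *
  constructor <;> linarith [h1.1, h1.2, h2.1, h2.2]

lemma hasDerivAt_signedPow {p x : ℝ} (hp : 0 < p) (hx : x ≠ 0) :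
    HasDerivAt (signedPow p) (p * |x| ^ (p - 1)) x := by
  rcases hx.lt_or_gt with h | h
  · have h1 : HasDerivAt (fun y : ℝ => -((-y) ^ p)) (p * |x| ^ (p - 1)) x := by
      have := ((hasDerivAt_neg x).rpow_const (p := p) (Or.inl (by simpa using hx))).neg
      rwa [show p * |x| ^ (p - 1) = -(-1 * p * (-x) ^ (p - 1)) by rw [abs_of_neg h]; ring]
    refine h1.congr_of_eventuallyEq ?_
    filter_upwards [Iio_mem_nhds h] with y hy
    have hy : y < 0 := hy
    rw [← signedPow_of_nonneg hp (by linarith : 0 ≤ -y), signedPow_neg, neg_neg]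
  · have h1 : HasDerivAt (fun y : ℝ => y ^ p) (p * |x| ^ (p - 1)) x := by
      rw [abs_of_pos h]
      exact Real.hasDerivAt_rpow_const (Or.inl hx)
    refine h1.congr_of_eventuallyEq ?_
    filter_upwards [Ioi_mem_nhds h] with y hy
    exact signedPow_of_nonneg hp (le_of_lt hy)

section Quantile

variable {α : ℝ} {μ : Measure ℝ}

lemma cdfFn_powerDensity (hα : 0 < α)
    (hdens : μ = volume.withDensity (fun x =>
      ENNReal.ofReal (if x ∈ Ioo (-1 : ℝ) 1 then ((α + 1) / 2) * |x| ^ α else 0)))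
    {x : ℝ} (hx : x ∈ Icc (-1 : ℝ) 1) :
    cdfFn μ x = (1 + signedPow (α + 1) x) / 2 := by
  have hp : 0 < α + 1 := by linarith
  set d : ℝ → ℝ := fun t => (α + 1) / 2 * |t| ^ α
  have hdc : Continuous d :=
    continuous_const.mul (continuous_abs.rpow_const fun _ => Or.inr hα.le)
  have hd0 : ∀ t, 0 ≤ d t := fun t => by positivity
  have hind : (fun t => ENNReal.ofReal (if t ∈ Ioo (-1 : ℝ) 1 then ((α + 1) / 2) * |t| ^ α else 0))
      = (Ioo (-1 : ℝ) 1).indicator fun t => ENNReal.ofReal (d t) := by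
    ext t
    by_cases ht : t ∈ Ioo (-1 : ℝ) 1
    · rw [indicator_of_mem ht, if_pos ht]
    · rw [indicator_of_notMem ht, if_neg ht, ENNReal.ofReal_zero]
  have hset : (Iic x ∩ Ioo (-1 : ℝ) 1 : Set ℝ) =ᵐ[volume] Ioc (-1 : ℝ) x := by
    have h1 : Iic x ∩ Icc (-1 : ℝ) 1 = Icc (-1) x := by
      ext t
      simp only [mem_inter_iff, mem_Iic, mem_Icc]
      exact ⟨fun h => ⟨h.2.1, h.1⟩, fun h => ⟨h.2, h.1, h.2.trans hx.2⟩⟩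
    have h2 : (Iic x ∩ Ioo (-1 : ℝ) 1 : Set ℝ) =ᵐ[volume] (Iic x ∩ Icc (-1 : ℝ) 1 : Set ℝ) :=
      (ae_eq_refl _).inter Ioo_ae_eq_Icc
    rw [h1] at h2
    exact h2.trans Ioc_ae_eq_Icc.symm
  have hint : ∫ t in (-1)..x, d t = (1 + signedPow (α + 1) x) / 2 := by
    have h := integral_eq_of_hasDerivAt_off_countable_of_le
      (fun t => signedPow (α + 1) t / 2) d hx.1 (countable_singleton (0 : ℝ))
      ((continuous_signedPow hp).div_const 2).continuousOn
      (fun t ht => by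
        have h := (hasDerivAt_signedPow hp ht.2).div_const 2
        rwa [add_sub_cancel_right, mul_div_right_comm] at h)
      (hdc.intervalIntegrable _ _)
    rw [h, signedPow_neg, signedPow_one hp]
    ring
  have hfi : IntegrableOn d (Ioc (-1) x) volume :=
    (hdc.integrableOn_Icc).mono_set Ioc_subset_Icc_self
  rw [cdfFn, hdens, withDensity_apply _ measurableSet_Iic, hind,
    setLIntegral_indicator measurableSet_Ioo, inter_comm, setLIntegral_congr hset,
    ← ofReal_integral_eq_lintegral_ofReal hfi (ae_of_all _ hd0),
    ENNReal.toReal_ofReal (integral_nonneg hd0), ← hint,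
    intervalIntegral.integral_of_le hx.1]

lemma quantileFn_powerDensity [IsFiniteMeasure μ] (hα : 0 < α)
    (hdens : μ = volume.withDensity (fun x =>
      ENNReal.ofReal (if x ∈ Ioo (-1 : ℝ) 1 then ((α + 1) / 2) * |x| ^ α else 0)))
    {u : ℝ} (hu : u ∈ Ioo (0 : ℝ) 1) :
    quantileFn μ u = signedPow (α + 1)⁻¹ (2 * u - 1) := by
  have hp : 0 < α + 1 := by linarith
  have hmono : Monotone (cdfFn μ) := fun a b hab =>
    ENNReal.toReal_mono (measure_ne_top _ _) (measure_mono (Iic_subset_Iic.2 hab))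
  set q := signedPow (α + 1)⁻¹ (2 * u - 1) with hq
  have hs := strictMono_signedPow (inv_pos.2 hp)
  have hq1 : q < 1 := by
    rw [← signedPow_one (inv_pos.2 hp)]
    exact hs (by linarith [hu.2])
  have hq0 : -1 < q := by
    rw [← signedPow_one (inv_pos.2 hp), ← signedPow_neg]
    exact hs (by linarith [hu.1])
  have hFq : cdfFn μ q = u := by
    rw [cdfFn_powerDensity hα hdens ⟨hq0.le, hq1.le⟩, hq, signedPow_signedPow_inv hp]
    ring
  have hset : {x : ℝ | u ≤ cdfFn μ x} = Ici q := by
    ext x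
    refine ⟨fun h => ?_, fun h => hFq.symm.le.trans (hmono h)⟩
    by_contra hx
    have hxq : max x (-1) < q := max_lt (not_le.1 hx) hq0
    have h1 := hmono (le_max_left x (-1))
    have h2 : cdfFn μ (max x (-1)) < cdfFn μ q := by
      rw [cdfFn_powerDensity hα hdens ⟨le_max_right _ _, hxq.le.trans hq1.le⟩,
        cdfFn_powerDensity hα hdens ⟨hq0.le, hq1.le⟩]
      linarith [strictMono_signedPow hp hxq]
    have h3 : u ≤ cdfFn μ x := h
    linarith
  rw [quantileFn, hset, csInf_Ici]

end Quantile

lemma integrableOn_abs_rpow {r : ℝ} (hr : -1 < r) (a : ℝ) :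
    IntegrableOn (fun t : ℝ => |t| ^ r) (Icc (-a) a) := by
  rcases lt_or_ge a 0 with ha | ha
  · rw [Icc_eq_empty (by linarith)]
    exact integrableOn_empty
  have h1 : IntervalIntegrable (fun t : ℝ => |t| ^ r) volume 0 a := by
    refine (intervalIntegral.intervalIntegrable_rpow' hr).congr fun t ht => ?_
    rw [uIoc_of_le ha] at ht
    simp only [abs_of_pos ht.1]
  have h2 : IntervalIntegrable (fun t : ℝ => |t| ^ r) volume (-a) 0 := by
    rw [IntervalIntegrable.iff_comp_neg]
    simpa using h1.symm
  exact (intervalIntegrable_iff_integrableOn_Icc_of_le (by linarith)).1 (h2.trans h1)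

lemma abs_cot_half_le {t : ℝ} (ht : |t| ≤ π) :
    |Real.cos (t / 2) / Real.sin (t / 2)| ≤ π * |t|⁻¹ := by
  rcases eq_or_ne t 0 with rfl | h0
  · simp
  have h0' : 0 < |t| := abs_pos.2 h0
  have h2 : |t / 2| = |t| / 2 := by rw [abs_div, abs_two]
  have h := Real.mul_abs_le_abs_sin (x := t / 2) (by rw [h2]; linarith)
  rw [h2, show 2 / π * (|t| / 2) = |t| / π by ring] at h
  have hpos : 0 < |t| / π := div_pos h0' Real.pi_pos
  rw [abs_div]
  calc |Real.cos (t / 2)| / |Real.sin (t / 2)| ≤ 1 / (|t| / π) :=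
        div_le_div₀ zero_le_one (Real.abs_cos_le_one _) hpos h
    _ = π * |t|⁻¹ := by field_simp

lemma setIntegral_eq_zero_of_odd {f : ℝ → ℝ} {s : Set ℝ} (hs : MeasurableSet s)
    (hsymm : ∀ t, -t ∈ s ↔ t ∈ s) (hf : ∀ t, f (-t) = -f t) : ∫ t in s, f t = 0 := by
  have h : ∫ t, s.indicator f t = -∫ t, s.indicator f t := by
    rw [← integral_neg, ← integral_neg_eq_self]
    refine integral_congr_ae (ae_of_all _ fun t => ?_)
    by_cases ht : t ∈ s
    · simp [indicator_of_mem ht, indicator_of_mem ((hsymm t).2 ht), hf]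
    · simp [indicator_of_notMem ht, indicator_of_notMem (mt (hsymm t).1 ht)]
  rw [integral_indicator hs] at h
  linarith

/-- A pointwise Hölder condition makes the principal value converge. -/
theorem exists_tendsto_pvH_of_holder {f : ℝ → ℝ} (hf : Continuous f) {C b : ℝ} (hb : 0 < b)
    (x : ℝ) (hC : ∀ t, |f (x - t) - f x| ≤ C * |t| ^ b) :
    ∃ L : ℝ, Tendsto (fun η => pvH f x η) (nhdsWithin 0 (Ioi 0)) (nhds L) := by
  set c : ℝ → ℝ := fun t => Real.cos (t / 2) / Real.sin (t / 2) with hc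
  set S : ℝ → Set ℝ := fun η => {t | η ≤ |t| ∧ |t| ≤ π} with hS
  set g : ℝ → ℝ := fun t => (f (x - t) - f x) * c t with hg
  have hSc : ∀ η, IsClosed (S η) := fun η =>
    (isClosed_le continuous_const continuous_abs).inter
      (isClosed_le continuous_abs continuous_const)
  have hSI : ∀ η, S η ⊆ Icc (-π) π := fun η t ht => abs_le.1 ht.2
  have hgm : Measurable g := by
    simp only [hg, hc]
    fun_prop
  have hcS : ∀ η, 0 < η → ContinuousOn c (S η) := by
    intro η hη
    refine ContinuousOn.div (by fun_prop) (by fun_prop) fun t ht hsin => ?_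
    have ht0 : 0 < |t| := hη.trans_le ht.1
    have h2 : |t / 2| = |t| / 2 := by rw [abs_div, abs_two]
    have h := Real.mul_abs_le_abs_sin (x := t / 2) (by rw [h2]; linarith [ht.2])
    rw [hsin, abs_zero, h2] at h
    have : 0 < 2 / π * (|t| / 2) := by positivity
    linarith
  have hpv : ∀ η, 0 < η → pvH f x η = 1 / (2 * π) * ∫ t in S η, g t := by
    intro η hη
    have hK : IsCompact (S η) := isCompact_Icc.of_isClosed_subset (hSc η) (hSI η)
    have i1 : IntegrableOn g (S η) :=
      (ContinuousOn.mul (by fun_prop) (hcS η hη)).integrableOn_compact hK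
    have i2 : IntegrableOn (fun t => f x * c t) (S η) :=
      (continuousOn_const.mul (hcS η hη)).integrableOn_compact hK
    have h0 : ∫ t in S η, f x * c t = 0 := by
      refine setIntegral_eq_zero_of_odd (hSc η).measurableSet (fun t => by simp [hS]) fun t => ?_
      simp only [hc, neg_div, Real.cos_neg, Real.sin_neg, div_neg, mul_neg]
    have h1 : ∫ t in S η, f (x - t) * c t = ∫ t in S η, g t := by
      rw [← add_zero (∫ t in S η, g t), ← h0, ← integral_add i1 i2]
      refine integral_congr_ae (ae_of_all _ fun t => ?_)
      simp only [hg]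
      ring
    rw [pvH, ← h1]
  have hbound : ∀ t ∈ Icc (-π) π, |g t| ≤ C * π * |t| ^ (b - 1) := by
    intro t ht
    rcases eq_or_ne t 0 with rfl | h0
    · have hC1 : 0 ≤ C := by simpa using (abs_nonneg _).trans (hC 1)
      simp only [hg, hc]
      simp only [zero_div, Real.sin_zero, div_zero, mul_zero, abs_zero]
      exact mul_nonneg (mul_nonneg hC1 Real.pi_pos.le) (Real.rpow_nonneg le_rfl _)
    have h0' : 0 < |t| := abs_pos.2 h0
    rw [hg, abs_mul]
    calc |f (x - t) - f x| * |c t| ≤ (C * |t| ^ b) * (π * |t|⁻¹) :=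
          mul_le_mul (hC t) (abs_cot_half_le (abs_le.2 ht)) (abs_nonneg _)
            ((abs_nonneg _).trans (hC t))
      _ = C * π * |t| ^ (b - 1) := by
          rw [Real.rpow_sub_one h0'.ne', div_eq_mul_inv]
          ring
  refine ⟨1 / (2 * π) * ∫ t, (Icc (-π) π).indicator g t, ?_⟩
  have hlim : Tendsto (fun η => ∫ t, (S η).indicator g t) (nhdsWithin 0 (Ioi 0))
      (nhds (∫ t, (Icc (-π) π).indicator g t)) := by
    refine tendsto_integral_filter_of_dominated_convergence
      ((Icc (-π) π).indicator fun t => C * π * |t| ^ (b - 1)) ?_ ?_ ?_ ?_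
    · exact Eventually.of_forall fun η =>
        (hgm.indicator (hSc η).measurableSet).aestronglyMeasurable
    · refine Eventually.of_forall fun η => ae_of_all _ fun t => ?_
      by_cases ht : t ∈ S η
      · rw [indicator_of_mem ht, indicator_of_mem (hSI η ht)]
        exact hbound t (hSI η ht)
      · rw [indicator_of_notMem ht, norm_zero]
        exact indicator_nonneg (fun s hs => (abs_nonneg _).trans (hbound s hs)) t
    · exact (integrable_indicator_iff measurableSet_Icc).2
        ((integrableOn_abs_rpow (by linarith) π).const_mul _)
    · have h0 : ∀ᵐ t : ℝ, t ≠ 0 := Measure.ae_ne volume 0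
      filter_upwards [h0] with t ht
      refine tendsto_const_nhds.congr' ?_
      filter_upwards [mem_nhdsWithin_of_mem_nhds (Iio_mem_nhds (abs_pos.2 ht))] with η hη
      by_cases htI : t ∈ Icc (-π) π
      · rw [indicator_of_mem htI, indicator_of_mem (show t ∈ S η from ⟨le_of_lt hη, abs_le.2 htI⟩)]
      · rw [indicator_of_notMem htI, indicator_of_notMem (fun h => htI (hSI η h))]
  refine (hlim.const_mul (1 / (2 * π))).congr' ?_
  filter_upwards [self_mem_nhdsWithin] with η hη
  rw [hpv η hη, integral_indicator (hSc η).measurableSet]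

lemma pvH_congr_of_countable {f g : ℝ → ℝ} {s : Set ℝ} (hs : s.Countable)
    (h : ∀ y, y ∉ s → f y = g y) (x η : ℝ) : pvH f x η = pvH g x η := by
  have hs' : ((fun t => x - t) ⁻¹' s).Countable := hs.preimage (sub_right_injective)
  unfold pvH
  congr 1
  refine integral_congr_ae (ae_restrict_of_ae ?_)
  filter_upwards [hs'.ae_notMem volume] with t ht
  rw [h _ ht]

lemma eq_comp_norm_addCircle {φ q : ℝ → ℝ} (hper : Function.Periodic φ (2 * π))
    (hφ : ∀ θ ∈ Ioo (-π) π, θ ≠ 0 → φ θ = q |θ|) {y : ℝ}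
    (hy : y ∉ range fun n : ℤ => (n : ℝ) * π) :
    φ y = q ‖(y : AddCircle (2 * π))‖ := by
  have hpi := Real.pi_pos
  have hle := AddCircle.norm_le_half_period (2 * π) (x := (y : AddCircle (2 * π)))
    (by positivity)
  rw [abs_of_pos (by positivity), mul_div_cancel_left₀ _ two_ne_zero] at hle
  rw [AddCircle.norm_eq] at hle ⊢
  set n := round ((2 * π)⁻¹ * y)
  have hne : ∀ m : ℤ, y ≠ m * π := fun m hm => hy ⟨m, hm.symm⟩
  have h1 := abs_le.1 hle
  rw [← hφ _ ⟨lt_of_le_of_ne h1.1 fun h => hne (2 * n - 1) ?_,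
    lt_of_le_of_ne h1.2 fun h => hne (2 * n + 1) ?_⟩ fun h => hne (2 * n) ?_]
  · exact (hper.sub_int_mul_eq n).symm
  all_goals push_cast; linarith

/-- For the probability measure with density `ρ(x) = ((α+1)/2)|x|^α` on `(−1,1)`,
the periodic Hilbert transform of `φ(θ) = q(|θ|/π)` (extended `2π`-periodically)
exists and is finite at every `θ ∈ (−π, π)`, including `θ = ±π/2` where `φ` has an
infinite derivative. -/
theorem hilbert_transform_exists_for_power_density
    (α : ℝ) (hα : 0 < α) (μ : Measure ℝ) [IsProbabilityMeasure μ]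
    (hdens : μ = volume.withDensity (fun x =>
      ENNReal.ofReal (if x ∈ Ioo (-1 : ℝ) 1 then ((α + 1) / 2) * |x| ^ α else 0)))
    (φ : ℝ → ℝ) (hper : Function.Periodic φ (2 * π))
    (hφ : ∀ θ ∈ Ioo (-π) π, φ θ = quantileFn μ (|θ| / π)) :
    ∀ θ ∈ Ioo (-π) π, ∃ L : ℝ,
      Tendsto (fun η => pvH φ θ η) (nhdsWithin 0 (Ioi 0)) (nhds L) := by
  have hp : 0 < α + 1 := by linarith
  have hpi := Real.pi_pos
  have hb : 0 < (α + 1)⁻¹ := inv_pos.2 hp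
  have hb1 : (α + 1)⁻¹ ≤ 1 := inv_le_one_of_one_le₀ (by linarith)
  set q : ℝ → ℝ := fun s => signedPow (α + 1)⁻¹ (2 * (s / π) - 1)
  have hqc : Continuous q := (continuous_signedPow hb).comp (by fun_prop)
  have hφq : ∀ θ ∈ Ioo (-π) π, θ ≠ 0 → φ θ = q |θ| := by
    intro θ hθ h0
    rw [hφ θ hθ, quantileFn_powerDensity hα hdens
      ⟨div_pos (abs_pos.2 h0) hpi, (div_lt_one hpi).2 (abs_lt.2 hθ)⟩]
  intro θ _
  simp only [pvH_congr_of_countable (countable_range _)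
    (fun y hy => eq_comp_norm_addCircle hper hφq hy) θ]
  refine exists_tendsto_pvH_of_holder (f := fun y => q ‖(y : AddCircle (2 * π))‖)
    (C := 2 * (2 / π) ^ (α + 1)⁻¹) (b := (α + 1)⁻¹)
    (hqc.comp (continuous_norm.comp (AddCircle.continuous_mk' _))) hb θ fun t => ?_
  have hlip : |‖((θ - t : ℝ) : AddCircle (2 * π))‖ - ‖(θ : AddCircle (2 * π))‖| ≤ |t| := by
    refine (abs_norm_sub_norm_le _ _).trans ?_
    rw [← AddCircle.coe_sub, sub_sub_cancel_left, AddCircle.coe_neg, norm_neg]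
    exact QuotientAddGroup.norm_mk_le_norm
  refine (abs_signedPow_sub_le hb.le hb1 _ _).trans ?_
  rw [mul_assoc, ← Real.mul_rpow (by positivity) (abs_nonneg t)]
  gcongr
  rw [show ∀ a c : ℝ, 2 * (a / π) - 1 - (2 * (c / π) - 1) = 2 / π * (a - c) by intros; ring,
    abs_mul, abs_of_pos (by positivity : 0 < 2 / π)]
  gcongr
end
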